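/- Let γ_n → ∞ and let ρ^{γ_n} ∈ C([0,T];P(ℝ^{2d})) satisfy, for a constant C > 0 independent of n, I^{γ_n}(ρ^{γ_n}) + F(ρ^{γ_n}_t|_{t=0}) ≤ C. Then there exists a subsequence (not relabeled) such that: (1) ρ^{γ_n} → ρ in M([0,T]×ℝ^{2d}) with respect to the narrow topology (duality with bounded continuous functions); (2) ξ^{γ_n}_#ρ^{γ_n} → ξ_#ρ in C([0,T];P(ℝ^d)), uniformly in time with respect to the narrow topology on P(ℝ^d), where ξ^γ(q,p) := q + p/γ and ξ(q,p) := q; and (3) for almost every t ∈ [0,T] the time slice ρ_t of the limit satisfies I(ρ_t|μ) = 0. -/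

import Mathlib

open MeasureTheory Real Filter Topology Set
open scoped ENNReal NNReal

noncomputable section

/-- Phase space ℝ^{2d} = ℝ^d_q × ℝ^d_p. -/
abbrev Phase (d : ℕ) := (Fin d → ℝ) × (Fin d → ℝ)

/-- The unit direction in the `p_i` coordinate. -/
def dirP {d : ℕ} (i : Fin d) : Phase d := (0, Pi.single i 1)

/-- The unit direction in the `q_i` coordinate. -/
def dirQ {d : ℕ} (i : Fin d) : Phase d := (Pi.single i 1, 0)

/-- Partial derivative in the `p_i` variable. -/
def pdP {d : ℕ} (φ : Phase d → ℝ) (x : Phase d) (i : Fin d) : ℝ :=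
  fderiv ℝ φ x (dirP i)

/-- The Laplacian in the `p` variables. -/
def laplP {d : ℕ} (φ : Phase d → ℝ) (x : Phase d) : ℝ :=
  ∑ i, fderiv ℝ (fun y => pdP φ y i) x (dirP i)

/-- `φ ∈ C_c^∞(ℝ^{2d})`. -/
def IsTestFn {d : ℕ} (φ : Phase d → ℝ) : Prop :=
  ContDiff ℝ (⊤ : ℕ∞) φ ∧ HasCompactSupport φ

/-- The integrand of the duality formula for the relative Fisher information. -/
def fisherIntegrand {d : ℕ} (m : ℝ) (φ : Phase d → ℝ) (x : Phase d) : ℝ :=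
  laplP φ x - (1 / m) * ∑ i, x.2 i * pdP φ x i - (1 / 2) * ∑ i, (pdP φ x i) ^ 2

/-- The relative Fisher information (w.r.t. the `p`-variable). -/
def relFisher {d : ℕ} (m : ℝ) (ν : Measure (Phase d)) : ℝ≥0∞ :=
  ⨆ φ : {φ : Phase d → ℝ // IsTestFn φ},
    ENNReal.ofReal (2 * ∫ x, fisherIntegrand m φ.1 x ∂ν)

/-- Time derivative of a function on `ℝ × ℝ^{2d}`. -/
def tder {d : ℕ} (f : ℝ × Phase d → ℝ) (z : ℝ × Phase d) : ℝ :=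
  fderiv ℝ f z (1, 0)

/-- Partial derivative in `q_i` of a function on `ℝ × ℝ^{2d}`. -/
def qderT {d : ℕ} (f : ℝ × Phase d → ℝ) (z : ℝ × Phase d) (i : Fin d) : ℝ :=
  fderiv ℝ f z (0, dirQ i)

/-- Partial derivative in `p_i` of a function on `ℝ × ℝ^{2d}`. -/
def pderT {d : ℕ} (f : ℝ × Phase d → ℝ) (z : ℝ × Phase d) (i : Fin d) : ℝ :=
  fderiv ℝ f z (0, dirP i)

/-- Laplacian in the `p`-variables of a function on `ℝ × ℝ^{2d}`. -/
def laplPT {d : ℕ} (f : ℝ × Phase d → ℝ) (z : ℝ × Phase d) : ℝ :=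
  ∑ i, fderiv ℝ (fun w => pderT f w i) z ((0 : ℝ), dirP i)

/-- `f ∈ C_b^{1,2}(ℝ × ℝ^{2d})`: (jointly) twice continuously differentiable, bounded
together with its first and second derivatives. -/
def IsCb2 {E : Type*} [NormedAddCommGroup E] [NormedSpace ℝ E] (f : E → ℝ) : Prop :=
  ContDiff ℝ 2 f ∧ ∃ M : ℝ, ∀ z, |f z| ≤ M ∧ ‖fderiv ℝ f z‖ ≤ M ∧
    ‖fderiv ℝ (fderiv ℝ f) z‖ ≤ M

/-- The Hamiltonian `H(q,p) = p²/(2m) + V(q)`. -/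
def Hfun {d : ℕ} (m : ℝ) (V : (Fin d → ℝ) → ℝ) (x : Phase d) : ℝ :=
  (∑ i, (x.2 i) ^ 2) / (2 * m) + V x.1

/-- `(∂_i ψ ∗ ν)(q)` for a measure `ν` on phase space (convolution acts on `q` only). -/
def convGradPsi {d : ℕ} (ψ : (Fin d → ℝ) → ℝ) (ν : Measure (Phase d))
    (q : Fin d → ℝ) (i : Fin d) : ℝ :=
  ∫ y, fderiv ℝ ψ (q - y.1) (Pi.single i 1) ∂ν

/-- The generator `L_ν f = γ J∇(H+ψ∗ν)·∇f − γ²(p/m)·∇_p f + γ²Δ_p f`, acting on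
functions of `(t,x) ∈ ℝ × ℝ^{2d}` (derivatives in the spatial directions only). -/
def Lop {d : ℕ} (m γ : ℝ) (V ψ : (Fin d → ℝ) → ℝ) (ν : Measure (Phase d))
    (f : ℝ × Phase d → ℝ) (z : ℝ × Phase d) : ℝ :=
  γ * ((∑ i, (z.2.2 i / m) * qderT f z i)
      - ∑ i, (fderiv ℝ V z.2.1 (Pi.single i 1) + convGradPsi ψ ν z.2.1 i) * pderT f z i)
    - γ ^ 2 * ∑ i, (z.2.2 i / m) * pderT f z i
    + γ ^ 2 * laplPT f z

/-- The large-deviation rate functional `I^γ` of the VFP equation, in duality form. -/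
def RateI {d : ℕ} (m γ T : ℝ) (V ψ : (Fin d → ℝ) → ℝ)
    (ρ : ℝ → ProbabilityMeasure (Phase d)) : ℝ≥0∞ :=
  ⨆ f : {f : ℝ × Phase d → ℝ // IsCb2 f},
    ENNReal.ofReal (
      (∫ x, f.1 (T, x) ∂(ρ T : Measure (Phase d)))
      - (∫ x, f.1 (0, x) ∂(ρ 0 : Measure (Phase d)))
      - (∫ t in Icc (0 : ℝ) T,
          (∫ x, (tder f.1 (t, x) + Lop m γ V ψ (ρ t : Measure (Phase d)) f.1 (t, x))
            ∂(ρ t : Measure (Phase d))))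
      - γ ^ 2 / 2 * ∫ t in Icc (0 : ℝ) T,
          (∫ x, (∑ i, (pderT f.1 (t, x) i) ^ 2) ∂(ρ t : Measure (Phase d))))

/-- Relative entropy in Donsker–Varadhan duality form,
`H(ν|ζ) = sup_{φ ∈ C_c^∞} [∫ φ dν − log ∫ e^φ dζ]`. -/
def relEntDV {d : ℕ} (ν ζ : Measure (Phase d)) : ℝ≥0∞ :=
  ⨆ φ : {φ : Phase d → ℝ // IsTestFn φ},
    ENNReal.ofReal ((∫ x, φ.1 x ∂ν) - Real.log (∫ x, Real.exp (φ.1 x) ∂ζ))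

/-- Normalization constant `Z_H = ∫ e^{−H}`. -/
def gibbsZ (d : ℕ) (m : ℝ) (V : (Fin d → ℝ) → ℝ) : ℝ :=
  ∫ x : Phase d, Real.exp (-(Hfun m V x))

/-- The normalized Gibbs measure `Z_H⁻¹ e^{−H} dx`. -/
def gibbs (d : ℕ) (m : ℝ) (V : (Fin d → ℝ) → ℝ) : Measure (Phase d) :=
  (ENNReal.ofReal (gibbsZ d m V))⁻¹ •
    volume.withDensity (fun x => ENNReal.ofReal (Real.exp (-(Hfun m V x))))

/-- The interaction energy `∫ (ψ∗ν) dν`. -/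
def interactionEnergy {d : ℕ} (ψ : (Fin d → ℝ) → ℝ) (ν : Measure (Phase d)) : ℝ :=
  ∫ x, (∫ y, ψ (x.1 - y.1) ∂ν) ∂ν

/-- The free energy `F(ν) = H(ν | Z_H⁻¹e^{−H}dx) + ½∫(ψ∗ν)dν`. -/
def FreeEnergy {d : ℕ} (m : ℝ) (V ψ : (Fin d → ℝ) → ℝ) (ν : Measure (Phase d)) : ℝ≥0∞ :=
  relEntDV ν (gibbs d m V) + ENNReal.ofReal ((1 / 2) * interactionEnergy ψ ν)

/-- The standing assumptions (V1)–(V2) on the potentials `V` and `ψ`. -/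
structure PotentialHyp (d : ℕ) (m : ℝ) (V ψ : (Fin d → ℝ) → ℝ) : Prop where
  hd : 1 ≤ d
  hm : 0 < m
  V_smooth : ContDiff ℝ 2 V
  V_nonneg : ∀ q, 0 ≤ V q
  V_hess_bdd : ∃ K, ∀ q, ‖fderiv ℝ (fderiv ℝ V) q‖ ≤ K
  V_grad_growth : ∃ C > 0, ∀ q,
    (∑ i, (fderiv ℝ V q (Pi.single i 1)) ^ 2) ≤ C * (1 + V q)
  V_exp_int : Integrable (fun q => Real.exp (-V q)) (volume : Measure (Fin d → ℝ))
  ψ_smooth : ContDiff ℝ 2 ψ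
  ψ_int : Integrable ψ (volume : Measure (Fin d → ℝ))
  ψ_grad_int : ∀ i, Integrable (fun q => fderiv ℝ ψ q (Pi.single i 1))
    (volume : Measure (Fin d → ℝ))
  ψ_symm : ∀ q, ψ (-q) = ψ q
  ψ_deriv_bdd : ∃ K, ∀ q, ‖fderiv ℝ ψ q‖ ≤ K ∧ ‖fderiv ℝ (fderiv ℝ ψ) q‖ ≤ K
  ψ_conv_nonneg : ∀ ν : ProbabilityMeasure (Fin d → ℝ),
    0 ≤ ∫ q, (∫ q', ψ (q - q') ∂(ν : Measure (Fin d → ℝ))) ∂(ν : Measure (Fin d → ℝ))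

/-- The coarse-graining map `ξ^γ(q,p) = q + p/γ`. -/
def xiGamma {d : ℕ} (γ : ℝ) (x : Phase d) : Fin d → ℝ :=
  fun i => x.1 i + x.2 i / γ

section BoundedC2

variable {E F : Type*} [NormedAddCommGroup E] [NormedSpace ℝ E]
  [NormedAddCommGroup F] [NormedSpace ℝ F]

lemma isCb2_iff_iteratedFDeriv {f : E → ℝ} :
    IsCb2 f ↔ ContDiff ℝ 2 f ∧ ∃ M : ℝ, ∀ z, ∀ i ≤ 2, ‖iteratedFDeriv ℝ i f z‖ ≤ M := by
  have h2 : ∀ z, ‖iteratedFDeriv ℝ 2 f z‖ = ‖fderiv ℝ (fderiv ℝ f) z‖ := by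
    intro z
    rw [← norm_iteratedFDeriv_fderiv, norm_iteratedFDeriv_one]
  constructor
  · rintro ⟨h, M, hM⟩
    refine ⟨h, M, fun z i hi => ?_⟩
    interval_cases i
    · simpa using (hM z).1
    · simpa [norm_iteratedFDeriv_one] using (hM z).2.1
    · rw [h2]; exact (hM z).2.2
  · rintro ⟨h, M, hM⟩
    refine ⟨h, M, fun z => ⟨?_, ?_, ?_⟩⟩
    · simpa using hM z 0 (by norm_num)
    · simpa [norm_iteratedFDeriv_one] using hM z 1 (by norm_num)
    · rw [← h2]; exact hM z 2 le_rfl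

lemma IsCb2.mul {f g : E → ℝ} (hf : IsCb2 f) (hg : IsCb2 g) : IsCb2 (fun z => f z * g z) := by
  rw [isCb2_iff_iteratedFDeriv] at *
  obtain ⟨hf, M, hM⟩ := hf
  obtain ⟨hg, N, hN⟩ := hg
  have hM0 : 0 ≤ M := (norm_nonneg _).trans (hM 0 0 (by norm_num))
  have hN0 : 0 ≤ N := (norm_nonneg _).trans (hN 0 0 (by norm_num))
  refine ⟨hf.mul hg, 4 * (M * N), fun z i hi => ?_⟩
  refine (norm_iteratedFDeriv_mul_le hf hg z (by exact_mod_cast hi)).trans ?_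
  have : ∀ j ∈ Finset.range (i + 1), (i.choose j : ℝ) * ‖iteratedFDeriv ℝ j f z‖ *
      ‖iteratedFDeriv ℝ (i - j) g z‖ ≤ (i.choose j : ℝ) * (M * N) := by
    intro j hj
    rw [mul_assoc]
    have hj' : j ≤ i := by simpa [Nat.lt_succ_iff] using hj
    gcongr
    · exact hM z j (by omega)
    · exact hN z _ (by omega)
  refine (Finset.sum_le_sum this).trans ?_
  rw [← Finset.sum_mul]
  have h4 : (∑ j ∈ Finset.range (i + 1), (i.choose j : ℝ)) ≤ 4 := by
    have := Nat.sum_range_choose i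
    rw [← Nat.cast_sum, this]
    interval_cases i <;> norm_num
  gcongr

lemma IsCb2.comp_clm {f : F → ℝ} (hf : IsCb2 f) (L : E →L[ℝ] F) : IsCb2 (fun z => f (L z)) := by
  rw [isCb2_iff_iteratedFDeriv] at *
  obtain ⟨hf, M, hM⟩ := hf
  have hM0 : 0 ≤ M := (norm_nonneg _).trans (hM 0 0 (by norm_num))
  refine ⟨hf.comp L.contDiff, M * (1 + ‖L‖) ^ 2, fun z i hi => ?_⟩
  have h := L.iteratedFDeriv_comp_right hf z (i := i) (by exact_mod_cast hi)
  change ‖iteratedFDeriv ℝ i (f ∘ L) z‖ ≤ _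
  rw [h]
  refine (ContinuousMultilinearMap.norm_compContinuousLinearMap_le _ _).trans ?_
  rw [Finset.prod_const, Finset.card_univ, Fintype.card_fin]
  have h1 : ‖L‖ ^ i ≤ (1 + ‖L‖) ^ 2 := by
    refine (pow_le_pow_left₀ (norm_nonneg _) (by linarith : ‖L‖ ≤ 1 + ‖L‖) i).trans ?_
    exact pow_le_pow_right₀ (by linarith [norm_nonneg L]) hi
  gcongr
  exact hM _ i hi

lemma isCb2_of_hasCompactSupport {f : E → ℝ} (hf : ContDiff ℝ 2 f) (hc : HasCompactSupport f) :
    IsCb2 f := by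
  rw [isCb2_iff_iteratedFDeriv]
  have h : ∀ i : ℕ, i ≤ 2 → ∃ M, ∀ z, ‖iteratedFDeriv ℝ i f z‖ ≤ M := fun i hi =>
    (hc.iteratedFDeriv (𝕜 := ℝ) i).exists_bound_of_continuous
      (hf.continuous_iteratedFDeriv (by exact_mod_cast hi))
  obtain ⟨M0, h0⟩ := h 0 (by norm_num)
  obtain ⟨M1, h1⟩ := h 1 (by norm_num)
  obtain ⟨M2, h2⟩ := h 2 (by norm_num)
  refine ⟨hf, max M0 (max M1 M2), fun z i hi => ?_⟩
  interval_cases i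
  · exact (h0 z).trans (le_max_left _ _)
  · exact (h1 z).trans ((le_max_left _ _).trans (le_max_right _ _))
  · exact (h2 z).trans ((le_max_right _ _).trans (le_max_right _ _))

lemma contDiff_two_of_hasDerivAt {f f' f'' : ℝ → ℝ} (h1 : ∀ x, HasDerivAt f (f' x) x)
    (h2 : ∀ x, HasDerivAt f' (f'' x) x) (h3 : Continuous f'') : ContDiff ℝ 2 f := by
  have e1 : deriv f = f' := funext fun x => (h1 x).deriv
  have e2 : deriv f' = f'' := funext fun x => (h2 x).deriv
  have c1 : ContDiff ℝ 1 f' := by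
    rw [contDiff_one_iff_deriv]
    exact ⟨fun x => (h2 x).differentiableAt, by rwa [e2]⟩
  have : ContDiff ℝ (1 + 1) f := by
    rw [contDiff_succ_iff_deriv]
    exact ⟨fun x => (h1 x).differentiableAt, by simp, by rwa [e1]⟩
  simpa [one_add_one_eq_two] using this

lemma isCb2_of_hasDerivAt {f f' f'' : ℝ → ℝ} {M : ℝ} (h1 : ∀ x, HasDerivAt f (f' x) x)
    (h2 : ∀ x, HasDerivAt f' (f'' x) x) (h3 : Continuous f'')
    (b0 : ∀ x, |f x| ≤ M) (b1 : ∀ x, |f' x| ≤ M) (b2 : ∀ x, |f'' x| ≤ M) : IsCb2 f := by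
  rw [isCb2_iff_iteratedFDeriv]
  have e1 : deriv f = f' := funext fun x => (h1 x).deriv
  have e2 : deriv f' = f'' := funext fun x => (h2 x).deriv
  refine ⟨contDiff_two_of_hasDerivAt h1 h2 h3, M, fun z i hi => ?_⟩
  rw [norm_iteratedFDeriv_eq_norm_iteratedDeriv]
  interval_cases i
  · simpa using b0 z
  · simpa [iteratedDeriv_one, e1] using b1 z
  · simpa [iteratedDeriv_succ, iteratedDeriv_one, e1, e2] using b2 z

lemma isCb2_cos (c θ : ℝ) : IsCb2 (fun t : ℝ => cos (c * t + θ)) := by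
  have h0 : ∀ x : ℝ, HasDerivAt (fun t : ℝ => c * t + θ) c x := fun x => by
    simpa using ((hasDerivAt_id x).const_mul c).add_const θ
  refine isCb2_of_hasDerivAt (f' := fun t => -(c * sin (c * t + θ)))
    (f'' := fun t => -(c * (c * cos (c * t + θ)))) (M := 1 + |c| + |c| * |c|) ?_ ?_ ?_ ?_ ?_ ?_
  · intro x
    exact (h0 x).cos.congr_deriv (by ring)
  · intro x
    exact ((h0 x).sin.const_mul c).neg.congr_deriv (by ring)
  · fun_prop
  · intro x
    have := abs_cos_le_one (c * x + θ)
    nlinarith [abs_nonneg c]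
  · intro x
    rw [abs_neg, abs_mul]
    have := mul_le_mul_of_nonneg_left (abs_sin_le_one (c * x + θ)) (abs_nonneg c)
    nlinarith [abs_nonneg c]
  · intro x
    rw [abs_neg, abs_mul, abs_mul]
    have := mul_le_mul_of_nonneg_left (abs_cos_le_one (c * x + θ)) (mul_nonneg (abs_nonneg c) (abs_nonneg c))
    nlinarith [abs_nonneg c]

lemma isCb2_cos_clm (L : E →L[ℝ] ℝ) (θ : ℝ) : IsCb2 (fun z => cos (L z + θ)) := by
  simpa using (isCb2_cos 1 θ).comp_clm L

end BoundedC2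

section Generator

variable {d : ℕ}

/-- The rescaled coordinates `(q, p) ↦ (q + p / γ, p / γ)`. -/
def Zmap (γ : ℝ) : Phase d →L[ℝ] Phase d :=
  ContinuousLinearMap.prod (ContinuousLinearMap.fst ℝ (Fin d → ℝ) (Fin d → ℝ)
      + γ⁻¹ • ContinuousLinearMap.snd ℝ (Fin d → ℝ) (Fin d → ℝ))
    (γ⁻¹ • ContinuousLinearMap.snd ℝ (Fin d → ℝ) (Fin d → ℝ))

lemma Zmap_fst (γ : ℝ) (x : Phase d) : (Zmap γ x).1 = x.1 + γ⁻¹ • x.2 := rfl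

lemma Zmap_snd (γ : ℝ) (x : Phase d) : (Zmap γ x).2 = γ⁻¹ • x.2 := rfl

lemma Zmap_fst_eq_xiGamma (γ : ℝ) (x : Phase d) : (Zmap γ x).1 = xiGamma γ x := by
  ext i
  simp [Zmap_fst, xiGamma, div_eq_inv_mul]

/-- The direction `∂_{q_i} + ∂_{p_i}`. -/
def dirD (i : Fin d) : Phase d := dirQ i + dirP i

lemma Zmap_dirQ (γ : ℝ) (i : Fin d) : Zmap γ (dirQ i) = dirQ i := by
  ext j <;> simp [Zmap_fst, Zmap_snd, dirQ]

lemma Zmap_dirP (γ : ℝ) (i : Fin d) : Zmap γ (dirP i) = γ⁻¹ • dirD i := by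
  ext j <;> simp [Zmap_fst, Zmap_snd, dirQ, dirP, dirD]

lemma norm_fst_le_Zmap (γ : ℝ) (x : Phase d) : ‖x.1‖ ≤ 2 * ‖Zmap γ x‖ := by
  have h : x.1 = (Zmap γ x).1 - (Zmap γ x).2 := by simp [Zmap_fst, Zmap_snd]
  calc ‖x.1‖ = ‖(Zmap γ x).1 - (Zmap γ x).2‖ := by rw [← h]
    _ ≤ ‖(Zmap γ x).1‖ + ‖(Zmap γ x).2‖ := norm_sub_le _ _
    _ ≤ ‖Zmap γ x‖ + ‖Zmap γ x‖ := add_le_add (norm_fst_le _) (norm_snd_le _)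
    _ = _ := by ring

/-- The total force in direction `i`. -/
def forceZ (V ψ : (Fin d → ℝ) → ℝ) (ν : Measure (Phase d)) (q : Fin d → ℝ) (i : Fin d) : ℝ :=
  fderiv ℝ V q (Pi.single i 1) + convGradPsi ψ ν q i

/-- Second derivative of `Φ` in the directions `u`, `v`. -/
def secD (Φ : Phase d → ℝ) (z u v : Phase d) : ℝ := fderiv ℝ (fderiv ℝ Φ) z v u

/-- The friction term `∑ P_i ∂_{P_i} Φ` in rescaled coordinates. -/
def fricZ (Φ : Phase d → ℝ) (z : Phase d) : ℝ := ∑ i, z.2 i * fderiv ℝ Φ z (dirP i)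

/-- The carré du champ in rescaled coordinates. -/
def carreZ (Φ : Phase d → ℝ) (z : Phase d) : ℝ := ∑ i, (fderiv ℝ Φ z (dirD i)) ^ 2

/-- The second order part of the generator in rescaled coordinates. -/
def laplZ (Φ : Phase d → ℝ) (z : Phase d) : ℝ := ∑ i, secD Φ z (dirD i) (dirD i)

/-- The generator acting on `Φ ∘ Zmap γ`. -/
def genZ (m γ : ℝ) (V ψ : (Fin d → ℝ) → ℝ) (ν : Measure (Phase d)) (Φ : Phase d → ℝ)
    (x : Phase d) : ℝ :=
  -(∑ i, forceZ V ψ ν x.1 i * fderiv ℝ Φ (Zmap γ x) (dirD i))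
    - γ ^ 2 / m * fricZ Φ (Zmap γ x) + laplZ Φ (Zmap γ x)

/-- The test function `η(t) Φ(Z x)`. -/
def tensorZ (γ : ℝ) (η : ℝ → ℝ) (Φ : Phase d → ℝ) (w : ℝ × Phase d) : ℝ :=
  η w.1 * Φ (Zmap γ w.2)

variable {γ : ℝ} {η : ℝ → ℝ} {Φ : Phase d → ℝ}

lemma isCb2_tensorZ (hη : IsCb2 η) (hΦ : IsCb2 Φ) : IsCb2 (tensorZ γ η Φ) :=
  (hη.comp_clm (ContinuousLinearMap.fst ℝ ℝ (Phase d))).mul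
    (hΦ.comp_clm ((Zmap γ).comp (ContinuousLinearMap.snd ℝ ℝ (Phase d))))

lemma fderiv_tensorZ (hη : Differentiable ℝ η) (hΦ : Differentiable ℝ Φ) (t τ : ℝ)
    (x u : Phase d) :
    fderiv ℝ (tensorZ γ η Φ) (t, x) (τ, u) =
      τ * deriv η t * Φ (Zmap γ x) + η t * fderiv ℝ Φ (Zmap γ x) (Zmap γ u) := by
  have h1 : HasFDerivAt (fun w : ℝ × Phase d => η w.1)
      ((fderiv ℝ η t).comp (ContinuousLinearMap.fst ℝ ℝ (Phase d))) (t, x) :=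
    (hη t).hasFDerivAt.comp (t, x) (hasFDerivAt_fst (p := (t, x)))
  have h2 : HasFDerivAt (fun w : ℝ × Phase d => Φ (Zmap γ w.2))
      ((fderiv ℝ Φ (Zmap γ x)).comp ((Zmap γ).comp (ContinuousLinearMap.snd ℝ ℝ (Phase d))))
      (t, x) :=
    (hΦ (Zmap γ x)).hasFDerivAt.comp (t, x)
      ((Zmap γ).comp (ContinuousLinearMap.snd ℝ ℝ (Phase d))).hasFDerivAt
  have h3 := (h1.mul h2).fderiv
  have h4 : fderiv ℝ (tensorZ γ η Φ) (t, x) = _ := h3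
  rw [h4]
  have h5 : fderiv ℝ η t τ = τ * deriv η t := by
    rw [← fderiv_apply_one_eq_deriv]
    simp
  simp [h5]
  ring

lemma tder_tensorZ (hη : Differentiable ℝ η) (hΦ : Differentiable ℝ Φ) (t : ℝ) (x : Phase d) :
    tder (tensorZ γ η Φ) (t, x) = deriv η t * Φ (Zmap γ x) := by
  simp [tder, fderiv_tensorZ hη hΦ]

lemma qderT_tensorZ (hη : Differentiable ℝ η) (hΦ : Differentiable ℝ Φ) (t : ℝ) (x : Phase d)
    (i : Fin d) :
    qderT (tensorZ γ η Φ) (t, x) i = η t * fderiv ℝ Φ (Zmap γ x) (dirQ i) := by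
  simp [qderT, fderiv_tensorZ hη hΦ, Zmap_dirQ]

lemma pderT_tensorZ (hη : Differentiable ℝ η) (hΦ : Differentiable ℝ Φ) (t : ℝ) (x : Phase d)
    (i : Fin d) :
    pderT (tensorZ γ η Φ) (t, x) i = η t * (γ⁻¹ * fderiv ℝ Φ (Zmap γ x) (dirD i)) := by
  simp [pderT, fderiv_tensorZ hη hΦ, Zmap_dirP]

lemma laplPT_tensorZ (hη : Differentiable ℝ η) (hΦ : ContDiff ℝ 2 Φ) (t : ℝ) (x : Phase d) :
    laplPT (tensorZ γ η Φ) (t, x) = η t * (γ⁻¹ ^ 2 * laplZ Φ (Zmap γ x)) := by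
  have hΦ1 : Differentiable ℝ Φ := hΦ.differentiable (by norm_num)
  have hΦ2 : Differentiable ℝ (fderiv ℝ Φ) :=
    (hΦ.fderiv_right (m := 1) (by norm_num)).differentiable (by norm_num)
  unfold laplPT laplZ
  rw [Finset.mul_sum, Finset.mul_sum]
  refine Finset.sum_congr rfl fun i _ => ?_
  have e : (fun w => pderT (tensorZ γ η Φ) w i) =
      tensorZ γ η (fun z => γ⁻¹ * fderiv ℝ Φ z (dirD i)) := by
    ext w
    exact pderT_tensorZ hη hΦ1 w.1 w.2 i
  have hd : Differentiable ℝ (fun z => γ⁻¹ * fderiv ℝ Φ z (dirD i)) := by fun_prop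
  rw [e, fderiv_tensorZ hη hd, Zmap_dirP]
  have h2 : fderiv ℝ (fun z => γ⁻¹ * fderiv ℝ Φ z (dirD i)) (Zmap γ x) =
      γ⁻¹ • (fderiv ℝ (fderiv ℝ Φ) (Zmap γ x)).flip (dirD i) := by
    rw [fderiv_const_mul (by fun_prop)]
    congr 1
    refine ContinuousLinearMap.ext fun v => ?_
    rw [fderiv_clm_apply (hΦ2 _) (by fun_prop)]
    simp
  rw [h2]
  simp only [zero_mul, secD, map_smul, _root_.smul_apply,
    ContinuousLinearMap.flip_apply, smul_eq_mul, zero_add]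
  ring

lemma Lop_tensorZ {m : ℝ} (hγ : γ ≠ 0) {V ψ : (Fin d → ℝ) → ℝ} {ν : Measure (Phase d)}
    (hη : Differentiable ℝ η) (hΦ : ContDiff ℝ 2 Φ) (t : ℝ) (x : Phase d) :
    Lop m γ V ψ ν (tensorZ γ η Φ) (t, x) = η t * genZ m γ V ψ ν Φ x := by
  have hΦ1 : Differentiable ℝ Φ := hΦ.differentiable (by norm_num)
  unfold Lop genZ fricZ
  simp only [qderT_tensorZ hη hΦ1, pderT_tensorZ hη hΦ1, laplPT_tensorZ hη hΦ]
  have h1 : ∀ i, x.2 i = γ * (Zmap γ x).2 i := by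
    intro i; simp [Zmap_snd, hγ]
  have h2 : ∀ i, fderiv ℝ Φ (Zmap γ x) (dirD i) =
      fderiv ℝ Φ (Zmap γ x) (dirQ i) + fderiv ℝ Φ (Zmap γ x) (dirP i) := by
    intro i; rw [dirD, map_add]
  have e1 : γ * ((∑ i, x.2 i / m * (η t * fderiv ℝ Φ (Zmap γ x) (dirQ i)))
      - ∑ i, (fderiv ℝ V x.1 (Pi.single i 1) + convGradPsi ψ ν x.1 i) *
        (η t * (γ⁻¹ * fderiv ℝ Φ (Zmap γ x) (dirD i))))
      - γ ^ 2 * ∑ i, x.2 i / m * (η t * (γ⁻¹ * fderiv ℝ Φ (Zmap γ x) (dirD i))) =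
      η t * (-(∑ i, forceZ V ψ ν x.1 i * fderiv ℝ Φ (Zmap γ x) (dirD i))
        - γ ^ 2 / m * ∑ i, (Zmap γ x).2 i * fderiv ℝ Φ (Zmap γ x) (dirP i)) := by
    simp only [mul_sub, Finset.mul_sum, ← Finset.sum_neg_distrib, ← Finset.sum_sub_distrib]
    refine Finset.sum_congr rfl fun i _ => ?_
    rw [h1 i, h2 i, forceZ]
    field_simp
    ring
  have e2 : γ ^ 2 * (η t * (γ⁻¹ ^ 2 * laplZ Φ (Zmap γ x))) = η t * laplZ Φ (Zmap γ x) := by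
    field_simp
  rw [e2]
  linarith [e1]

lemma sum_pderT_sq_tensorZ (hη : Differentiable ℝ η) (hΦ : Differentiable ℝ Φ) (t : ℝ)
    (x : Phase d) :
    ∑ i, (pderT (tensorZ γ η Φ) (t, x) i) ^ 2 =
      η t ^ 2 * γ⁻¹ ^ 2 * carreZ Φ (Zmap γ x) := by
  simp only [pderT_tensorZ hη hΦ, carreZ, Finset.mul_sum]
  refine Finset.sum_congr rfl fun i _ => ?_
  ring

/-- Curves with bounded rate and bounded initial entropy. -/
structure GoodCurve (d : ℕ) (m γ T : ℝ) (V ψ : (Fin d → ℝ) → ℝ) (C : ℝ)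
    (ρ : ℝ → ProbabilityMeasure (Phase d)) : Prop where
  cont : ContinuousOn ρ (Icc 0 T)
  rate : RateI m γ T V ψ ρ ≤ ENNReal.ofReal C
  ent : relEntDV (ρ 0 : Measure (Phase d)) (gibbs d m V) ≤ ENNReal.ofReal C

lemma GoodCurve.rate_tensor {m T C : ℝ} (hγ : γ ≠ 0) (hC : 0 ≤ C) {V ψ : (Fin d → ℝ) → ℝ}
    {ρ : ℝ → ProbabilityMeasure (Phase d)} (hρ : GoodCurve d m γ T V ψ C ρ)
    (hη : IsCb2 η) (hΦ : IsCb2 Φ) :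
    η T * (∫ x, Φ (Zmap γ x) ∂(ρ T : Measure (Phase d)))
      - η 0 * (∫ x, Φ (Zmap γ x) ∂(ρ 0 : Measure (Phase d)))
      - (∫ t in Icc (0 : ℝ) T, (∫ x, (deriv η t * Φ (Zmap γ x)
          + η t * genZ m γ V ψ (ρ t : Measure (Phase d)) Φ x) ∂(ρ t : Measure (Phase d))))
      - 1 / 2 * ∫ t in Icc (0 : ℝ) T, η t ^ 2 *
          (∫ x, carreZ Φ (Zmap γ x) ∂(ρ t : Measure (Phase d))) ≤ C := by
  have h := (le_iSup (fun f : {f : ℝ × Phase d → ℝ // IsCb2 f} => ENNReal.ofReal (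
      (∫ x, f.1 (T, x) ∂(ρ T : Measure (Phase d)))
      - (∫ x, f.1 (0, x) ∂(ρ 0 : Measure (Phase d)))
      - (∫ t in Icc (0 : ℝ) T,
          (∫ x, (tder f.1 (t, x) + Lop m γ V ψ (ρ t : Measure (Phase d)) f.1 (t, x))
            ∂(ρ t : Measure (Phase d))))
      - γ ^ 2 / 2 * ∫ t in Icc (0 : ℝ) T,
          (∫ x, (∑ i, (pderT f.1 (t, x) i) ^ 2) ∂(ρ t : Measure (Phase d)))))
      ⟨tensorZ γ η Φ, isCb2_tensorZ hη hΦ⟩).trans hρ.rate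
  rw [ENNReal.ofReal_le_ofReal_iff hC] at h
  have hη1 : Differentiable ℝ η := hη.1.differentiable (by norm_num)
  have hΦ1 : Differentiable ℝ Φ := hΦ.1.differentiable (by norm_num)
  simp only [tder_tensorZ hη1 hΦ1, Lop_tensorZ hγ hη1 hΦ.1, sum_pderT_sq_tensorZ hη1 hΦ1,
    tensorZ, integral_const_mul] at h
  refine le_trans (le_of_eq ?_) h
  have e : ∀ t : ℝ, η t ^ 2 * γ⁻¹ ^ 2 * (∫ x, carreZ Φ (Zmap γ x) ∂(ρ t : Measure (Phase d))) =
      γ⁻¹ ^ 2 * (η t ^ 2 * ∫ x, carreZ Φ (Zmap γ x) ∂(ρ t : Measure (Phase d))) := by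
    intro t; ring
  simp only [e, integral_const_mul]
  field_simp

end Generator

section Ramp

lemma deriv_smoothTransition_of_nonpos {x : ℝ} (hx : x ≤ 0) : deriv smoothTransition x = 0 := by
  apply IsLocalMin.deriv_eq_zero
  refine Filter.Eventually.of_forall fun y => ?_
  rw [smoothTransition.zero_of_nonpos hx]
  exact smoothTransition.nonneg y

lemma deriv_smoothTransition_of_one_le {x : ℝ} (hx : 1 ≤ x) : deriv smoothTransition x = 0 := by
  apply IsLocalMax.deriv_eq_zero
  refine Filter.Eventually.of_forall fun y => ?_
  rw [smoothTransition.one_of_one_le hx]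
  exact smoothTransition.le_one y

lemma continuous_deriv_smoothTransition : Continuous (deriv smoothTransition) :=
  (smoothTransition.contDiff (n := 1)).continuous_deriv le_rfl

lemma differentiable_smoothTransition : Differentiable ℝ smoothTransition :=
  (smoothTransition.contDiff (n := 1)).differentiable one_ne_zero

lemma smoothTransition_monotone : Monotone smoothTransition := by
  intro x y hxy
  unfold smoothTransition
  have h1 := expNegInvGlue.monotone hxy
  have h2 := expNegInvGlue.monotone (sub_le_sub_left hxy 1)
  have hx := smoothTransition.pos_denom x
  have hy := smoothTransition.pos_denom y
  rw [div_le_div_iff₀ hx hy]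
  nlinarith [expNegInvGlue.nonneg x, expNegInvGlue.nonneg y, expNegInvGlue.nonneg (1 - x),
    expNegInvGlue.nonneg (1 - y)]

lemma integral_deriv_smoothTransition_mul {w : ℝ → ℝ} (hw : Continuous w) {A B : ℝ}
    (hA : A ≤ 0) (hB : 1 ≤ B) :
    ∫ s in A..B, deriv smoothTransition s * w s =
      ∫ s in (0 : ℝ)..1, deriv smoothTransition s * w s := by
  have hc : Continuous fun s => deriv smoothTransition s * w s :=
    continuous_deriv_smoothTransition.mul hw
  have h1 : ∫ s in A..0, deriv smoothTransition s * w s = 0 := by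
    rw [intervalIntegral.integral_congr (g := fun _ => 0)]
    · simp
    · intro s hs
      rw [uIcc_of_le hA] at hs
      simp [deriv_smoothTransition_of_nonpos hs.2]
  have h2 : ∫ s in (1 : ℝ)..B, deriv smoothTransition s * w s = 0 := by
    rw [intervalIntegral.integral_congr (g := fun _ => 0)]
    · simp
    · intro s hs
      rw [uIcc_of_le hB] at hs
      simp [deriv_smoothTransition_of_one_le hs.1]
  rw [← intervalIntegral.integral_add_adjacent_intervals (b := 0) (hc.intervalIntegrable _ _)
    (hc.intervalIntegrable _ _), ← intervalIntegral.integral_add_adjacent_intervals (b := 1)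
    (hc.intervalIntegrable 0 1) (hc.intervalIntegrable _ _), h1, h2]
  ring

lemma integral_ramp {w : ℝ → ℝ} (hw : Continuous w) {a ε T : ℝ} (ha : 0 ≤ a) (hε : 0 < ε)
    (haT : a + ε ≤ T) :
    ∫ t in (0 : ℝ)..T, deriv smoothTransition ((t - a) / ε) / ε * w t =
      ∫ s in (0 : ℝ)..1, deriv smoothTransition s * w (a + ε * s) := by
  have hc : Continuous fun s => w (a + ε * s) := by fun_prop
  rw [← integral_deriv_smoothTransition_mul hc (A := (0 - a) / ε) (B := (T - a) / ε)
    (div_nonpos_of_nonpos_of_nonneg (by linarith) hε.le)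
    ((one_le_div hε).2 (by linarith))]
  have h := intervalIntegral.integral_comp_div_sub (a := 0) (b := T)
    (fun s => deriv smoothTransition s * w (a + ε * s)) hε.ne' (a / ε)
  rw [← sub_div, ← sub_div, smul_eq_mul] at h
  have h' : ∫ s in (0 - a) / ε..(T - a) / ε, deriv smoothTransition s * w (a + ε * s) =
      ε⁻¹ * ∫ t in (0 : ℝ)..T, deriv smoothTransition (t / ε - a / ε) *
        w (a + ε * (t / ε - a / ε)) := by
    rw [h]; field_simp
  rw [h', ← intervalIntegral.integral_const_mul]
  refine intervalIntegral.integral_congr fun t _ => ?_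
  have e : a + ε * (t / ε - a / ε) = t := by field_simp; ring
  rw [e, ← sub_div]
  ring

/-- The smoothed indicator of `[a, b]`. -/
def rampFn (a b ε t : ℝ) : ℝ := smoothTransition ((t - a) / ε) - smoothTransition ((t - b) / ε)

lemma hasDerivAt_rampFn (a b ε t : ℝ) :
    HasDerivAt (rampFn a b ε) (deriv smoothTransition ((t - a) / ε) / ε
      - deriv smoothTransition ((t - b) / ε) / ε) t := by
  have h : ∀ c : ℝ, HasDerivAt (fun t => smoothTransition ((t - c) / ε))
      (deriv smoothTransition ((t - c) / ε) / ε) t := by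
    intro c
    have h1 : HasDerivAt (fun t : ℝ => (t - c) / ε) (1 / ε) t :=
      ((hasDerivAt_id t).sub_const c).div_const ε
    have h2 := (differentiable_smoothTransition ((t - c) / ε)).hasDerivAt.comp t h1
    exact h2.congr_deriv (by ring)
  exact (h a).sub (h b)

lemma isCb2_rampFn {a b ε : ℝ} (hab : a ≤ b) (hε : 0 < ε) : IsCb2 (rampFn a b ε) := by
  apply isCb2_of_hasCompactSupport
  · unfold rampFn
    exact (smoothTransition.contDiff.comp (by fun_prop)).sub
      (smoothTransition.contDiff.comp (by fun_prop))
  · refine HasCompactSupport.intro (isCompact_Icc (a := a) (b := b + ε)) fun t ht => ?_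
    rw [mem_Icc, not_and_or, not_le, not_le] at ht
    unfold rampFn
    rcases ht with ht | ht
    · rw [smoothTransition.zero_of_nonpos, smoothTransition.zero_of_nonpos, sub_zero]
      · exact div_nonpos_of_nonpos_of_nonneg (by linarith) hε.le
      · exact div_nonpos_of_nonpos_of_nonneg (by linarith) hε.le
    · rw [smoothTransition.one_of_one_le, smoothTransition.one_of_one_le, sub_self]
      · exact (one_le_div hε).2 (by linarith)
      · exact (one_le_div hε).2 (by linarith)

lemma ramp_of_continuous {m u : ℝ → ℝ} {T C : ℝ} (hm : Continuous m)
    (hu : Continuous u)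
    (h : ∀ η : ℝ → ℝ, IsCb2 η → (∀ t, 0 ≤ η t ∧ η t ≤ 1) →
      η T * m T - η 0 * m 0 - (∫ t in (0 : ℝ)..T, deriv η t * m t)
        + ∫ t in (0 : ℝ)..T, η t * u t ≤ C)
    {a b : ℝ} (ha : 0 ≤ a) (hab : a ≤ b) (hb : b ≤ T) :
    m b - m a + ∫ t in a..b, u t ≤ C := by
  set U : ℝ → ℝ := fun t => ∫ s in (0 : ℝ)..t, u s with hU
  have hUd : ∀ t, HasDerivAt U (u t) t := fun t =>
    intervalIntegral.integral_hasDerivAt_right (hu.intervalIntegrable _ _)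
      (hu.stronglyMeasurableAtFilter _ _) hu.continuousAt
  have hUc : Continuous U := continuous_iff_continuousAt.2 fun t => (hUd t).continuousAt
  set w : ℝ → ℝ := fun t => m t + U t with hw
  have hwc : Continuous w := hm.add hUc
  have key : ∀ a b : ℝ, 0 ≤ a → a ≤ b → b < T → w b - w a ≤ C := by
    intro a b ha hab hb
    have hlim : Tendsto (fun ε : ℝ => ∫ s in (0 : ℝ)..1,
        deriv smoothTransition s * (w (b + ε * s) - w (a + ε * s))) (𝓝[>] 0)
        (𝓝 (w b - w a)) := by
      have hcont : Continuous (fun ε : ℝ => ∫ s in (0 : ℝ)..1,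
          deriv smoothTransition s * (w (b + ε * s) - w (a + ε * s))) := by
        apply intervalIntegral.continuous_parametric_intervalIntegral_of_continuous'
        have := continuous_deriv_smoothTransition
        unfold Function.uncurry
        fun_prop
      have h0 := hcont.tendsto 0
      have e0 : ∫ s in (0 : ℝ)..1, deriv smoothTransition s * (w (b + 0 * s) - w (a + 0 * s)) =
          w b - w a := by
        simp only [zero_mul, add_zero]
        rw [intervalIntegral.integral_mul_const, intervalIntegral.integral_deriv_eq_sub
          (fun x _ => differentiable_smoothTransition x)
          (continuous_deriv_smoothTransition.intervalIntegrable _ _),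
          smoothTransition.one, smoothTransition.zero]
        ring
      rw [e0] at h0
      exact h0.mono_left nhdsWithin_le_nhds
    refine le_of_tendsto hlim ?_
    have hev : ∀ᶠ ε : ℝ in 𝓝[>] 0, ε ∈ Ioo 0 (T - b) :=
      Ioo_mem_nhdsGT (by linarith)
    filter_upwards [hev] with ε hε
    have hε0 : 0 < ε := hε.1
    have hεT : b + ε ≤ T := by linarith [hε.2]
    have h1 := h (rampFn a b ε) (isCb2_rampFn hab hε0) (fun t => by
      constructor
      · unfold rampFn
        have : (t - b) / ε ≤ (t - a) / ε := by gcongr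
        linarith [smoothTransition_monotone this]
      · unfold rampFn
        linarith [smoothTransition.le_one ((t - a) / ε), smoothTransition.nonneg ((t - b) / ε)])
    have e0 : rampFn a b ε 0 = 0 := by
      unfold rampFn
      rw [smoothTransition.zero_of_nonpos, smoothTransition.zero_of_nonpos, sub_zero]
      · exact div_nonpos_of_nonpos_of_nonneg (by linarith) hε0.le
      · exact div_nonpos_of_nonpos_of_nonneg (by linarith) hε0.le
    have eT : rampFn a b ε T = 0 := by
      unfold rampFn
      rw [smoothTransition.one_of_one_le, smoothTransition.one_of_one_le, sub_self]
      · exact (one_le_div hε0).2 (by linarith)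
      · exact (one_le_div hε0).2 (by linarith)
    have hd : deriv (rampFn a b ε) = fun t => deriv smoothTransition ((t - a) / ε) / ε
        - deriv smoothTransition ((t - b) / ε) / ε := funext fun t =>
      (hasDerivAt_rampFn a b ε t).deriv
    have hdc : Continuous (deriv (rampFn a b ε)) := by
      rw [hd]
      have := continuous_deriv_smoothTransition
      fun_prop
    have hrc : Continuous (rampFn a b ε) := (isCb2_rampFn hab hε0).1.continuous
    have ibp := intervalIntegral.integral_mul_deriv_eq_deriv_mul (a := 0) (b := T)
      (u := rampFn a b ε) (v := U) (u' := deriv (rampFn a b ε)) (v' := u)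
      (fun t _ => by rw [hd]; exact hasDerivAt_rampFn a b ε t) (fun t _ => hUd t)
      (hdc.intervalIntegrable _ _) (hu.intervalIntegrable _ _)
    rw [ibp, e0, eT] at h1
    have h2 : ∫ t in (0 : ℝ)..T, deriv (rampFn a b ε) t * w t =
        (∫ t in (0 : ℝ)..T, deriv (rampFn a b ε) t * m t)
          + ∫ t in (0 : ℝ)..T, deriv (rampFn a b ε) t * U t := by
      rw [← intervalIntegral.integral_add
        (Continuous.intervalIntegrable (by fun_prop) _ _)
        (Continuous.intervalIntegrable (by fun_prop) _ _)]
      simp only [hw, mul_add]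
    have hcd := continuous_deriv_smoothTransition
    have h3 : ∫ t in (0 : ℝ)..T, deriv (rampFn a b ε) t * w t =
        (∫ s in (0 : ℝ)..1, deriv smoothTransition s * w (a + ε * s))
          - ∫ s in (0 : ℝ)..1, deriv smoothTransition s * w (b + ε * s) := by
      rw [← integral_ramp hwc ha hε0 (by linarith : a + ε ≤ T),
        ← integral_ramp hwc (by linarith) hε0 hεT, ← intervalIntegral.integral_sub
        (Continuous.intervalIntegrable (by fun_prop) _ _)
        (Continuous.intervalIntegrable (by fun_prop) _ _)]
      simp only [hd, sub_mul]
    have h4 : ∫ s in (0 : ℝ)..1, deriv smoothTransition s * (w (b + ε * s) - w (a + ε * s)) =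
        (∫ s in (0 : ℝ)..1, deriv smoothTransition s * w (b + ε * s))
          - ∫ s in (0 : ℝ)..1, deriv smoothTransition s * w (a + ε * s) := by
      rw [← intervalIntegral.integral_sub
        (Continuous.intervalIntegrable (by fun_prop) _ _)
        (Continuous.intervalIntegrable (by fun_prop) _ _)]
      simp only [mul_sub]
    linarith
  have hsub : m b - m a + ∫ t in a..b, u t = w b - w a := by
    have : ∫ t in a..b, u t = U b - U a :=
      (intervalIntegral.integral_interval_sub_left (hu.intervalIntegrable _ _)
        (hu.intervalIntegrable _ _)).symm
    rw [this, hw]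
    ring
  rw [hsub]
  rcases hb.lt_or_eq with hb | hb
  · exact key a b ha hab hb
  rcases hab.lt_or_eq with hab | hab
  · have hlim : Tendsto (fun c => w c - w a) (𝓝[<] b) (𝓝 (w b - w a)) :=
      ((hwc.tendsto b).sub_const _).mono_left nhdsWithin_le_nhds
    refine le_of_tendsto hlim ?_
    filter_upwards [Ioo_mem_nhdsLT hab] with c hc
    exact key a c ha hc.1.le (hb ▸ hc.2)
  · have h0 := h (fun _ => 0) (isCb2_of_hasCompactSupport contDiff_const HasCompactSupport.zero) (fun _ => by simp)
    simp only [zero_mul, sub_self, deriv_const, intervalIntegral.integral_zero, add_zero] at h0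
    rw [hab, sub_self]
    exact h0

lemma ramp_of_continuousOn {m u : ℝ → ℝ} {T C : ℝ} (hT : 0 ≤ T) (hm : ContinuousOn m (Icc 0 T))
    (hu : ContinuousOn u (Icc 0 T))
    (h : ∀ η : ℝ → ℝ, IsCb2 η → (∀ t, 0 ≤ η t ∧ η t ≤ 1) →
      η T * m T - η 0 * m 0 - (∫ t in (0 : ℝ)..T, deriv η t * m t)
        + ∫ t in (0 : ℝ)..T, η t * u t ≤ C)
    {a b : ℝ} (ha : 0 ≤ a) (hab : a ≤ b) (hb : b ≤ T) :
    m b - m a + ∫ t in a..b, u t ≤ C := by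
  have ext : ∀ f : ℝ → ℝ, ContinuousOn f (Icc 0 T) →
      ∃ g : ℝ → ℝ, Continuous g ∧ ∀ t ∈ Icc 0 T, g t = f t := fun f hf =>
    ⟨IccExtend hT ((Icc 0 T).domRestrict f), (continuousOn_iff_continuous_domRestrict.1 hf).Icc_extend',
      fun t ht => by rw [IccExtend_of_mem hT _ ht]; rfl⟩
  obtain ⟨m', hm', em⟩ := ext m hm
  obtain ⟨u', hu', eu⟩ := ext u hu
  have h' := ramp_of_continuous (T := T) (C := C) hm' hu' (fun η hη hη1 => by
    have := h η hη hη1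
    rw [em T ⟨hT, le_rfl⟩, em 0 ⟨le_rfl, hT⟩]
    have e1 : ∫ t in (0 : ℝ)..T, deriv η t * m' t = ∫ t in (0 : ℝ)..T, deriv η t * m t :=
      intervalIntegral.integral_congr fun t ht => by
        rw [uIcc_of_le hT] at ht
        simp only [em t ht]
    have e2 : ∫ t in (0 : ℝ)..T, η t * u' t = ∫ t in (0 : ℝ)..T, η t * u t :=
      intervalIntegral.integral_congr fun t ht => by
        rw [uIcc_of_le hT] at ht
        simp only [eu t ht]
    rw [e1, e2]
    exact this) ha hab hb
  rw [em b ⟨by linarith, hb⟩, em a ⟨ha, by linarith⟩] at h'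
  have e2 : ∫ t in a..b, u' t = ∫ t in a..b, u t :=
    intervalIntegral.integral_congr fun t ht => by
      rw [uIcc_of_le hab] at ht
      exact eu t ⟨ha.trans ht.1, ht.2.trans hb⟩
  rwa [e2] at h'

end Ramp

section Means

lemma abs_integral_le_of_bdd {X : Type*} [MeasurableSpace X] {h : X → ℝ} {B : ℝ}
    (hb : ∀ x, |h x| ≤ B) (ν : Measure X) [IsProbabilityMeasure ν] : |∫ x, h x ∂ν| ≤ B := by
  have := norm_integral_le_of_norm_le_const (μ := ν) (f := h) (C := B)
    (Filter.Eventually.of_forall hb)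
  simpa using this

variable {X : Type*} [TopologicalSpace X] [MeasurableSpace X] [OpensMeasurableSpace X]

lemma integrable_of_continuous_of_bdd {h : X → ℝ} (hc : Continuous h) {B : ℝ}
    (hb : ∀ x, |h x| ≤ B) (ν : Measure X) [IsFiniteMeasure ν] : Integrable h ν :=
  Integrable.of_bound hc.aestronglyMeasurable B (Filter.Eventually.of_forall hb)

lemma continuous_integral_probabilityMeasure {h : X → ℝ} (hc : Continuous h) {B : ℝ}
    (hb : ∀ x, |h x| ≤ B) :
    Continuous fun ν : ProbabilityMeasure X => ∫ x, h x ∂(ν : Measure X) := by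
  rw [continuous_iff_continuousAt]
  intro ν
  have := ProbabilityMeasure.tendsto_iff_forall_integral_tendsto.1
    (tendsto_id (α := ProbabilityMeasure X) (x := 𝓝 ν))
    (BoundedContinuousFunction.ofNormedAddCommGroup h hc B hb)
  exact this

end Means

section RateInequality

variable {d : ℕ}

/-- Functions of class `C²` whose derivatives decay at infinity. -/
structure Decay (M : ℝ) (Φ : Phase d → ℝ) : Prop where
  smooth : ContDiff ℝ 2 Φ
  bdd : ∃ B, ∀ z, |Φ z| ≤ B
  grad : ∀ z, (1 + ‖z‖) * ‖fderiv ℝ Φ z‖ ≤ M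
  hess : ∀ z, ‖fderiv ℝ (fderiv ℝ Φ) z‖ ≤ M

variable {M : ℝ} {Φ : Phase d → ℝ}

lemma Decay.nonneg (h : Decay M Φ) : 0 ≤ M := (ContinuousLinearMap.opNorm_nonneg _).trans (h.hess 0)

lemma Decay.norm_fderiv_le (h : Decay M Φ) (z : Phase d) : ‖fderiv ℝ Φ z‖ ≤ M := by
  nlinarith [h.grad z, norm_nonneg z, norm_nonneg (fderiv ℝ Φ z)]

lemma Decay.isCb2 (h : Decay M Φ) : IsCb2 Φ := by
  obtain ⟨B, hB⟩ := h.bdd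
  exact ⟨h.smooth, max B M, fun z => ⟨(hB z).trans (le_max_left _ _),
    (h.norm_fderiv_le z).trans (le_max_right _ _), (h.hess z).trans (le_max_right _ _)⟩⟩

lemma Decay.differentiable (h : Decay M Φ) : Differentiable ℝ Φ :=
  h.smooth.differentiable (by norm_num)

lemma Decay.continuous_fderiv (h : Decay M Φ) : Continuous (fderiv ℝ Φ) :=
  h.smooth.continuous_fderiv (by norm_num)

lemma Decay.continuous_hess (h : Decay M Φ) : Continuous (fderiv ℝ (fderiv ℝ Φ)) :=
  (h.smooth.fderiv_right (m := 1) (by norm_num)).continuous_fderiv one_ne_zero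

lemma norm_single_one_le (i : Fin d) : ‖(Pi.single i 1 : Fin d → ℝ)‖ ≤ 1 := by
  refine (pi_norm_le_iff_of_nonneg zero_le_one).2 fun j => ?_
  by_cases h : j = i
  · subst h; simp
  · simp [h]

lemma norm_dirP_le (i : Fin d) : ‖(dirP i : Phase d)‖ ≤ 1 := by
  simp [dirP, Prod.norm_def, norm_single_one_le]

lemma norm_dirD_le (i : Fin d) : ‖(dirD i : Phase d)‖ ≤ 1 := by
  simp [dirD, dirP, dirQ, Prod.norm_def, norm_single_one_le]

lemma abs_clm_apply_le {E : Type*} [NormedAddCommGroup E] [NormedSpace ℝ E] (L : E →L[ℝ] ℝ)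
    {u : E} (hu : ‖u‖ ≤ 1) : |L u| ≤ ‖L‖ :=
  (L.le_opNorm u).trans (mul_le_of_le_one_right (norm_nonneg _) hu)

lemma abs_secD_le (Φ : Phase d → ℝ) (z : Phase d) {u v : Phase d} (hu : ‖u‖ ≤ 1)
    (hv : ‖v‖ ≤ 1) : |secD Φ z u v| ≤ ‖fderiv ℝ (fderiv ℝ Φ) z‖ := by
  refine (abs_clm_apply_le _ hu).trans ?_
  exact ((fderiv ℝ (fderiv ℝ Φ) z).le_opNorm v).trans
    (mul_le_of_le_one_right (norm_nonneg _) hv)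

lemma abs_laplZ_le (Φ : Phase d → ℝ) (z : Phase d) :
    |laplZ Φ z| ≤ d * ‖fderiv ℝ (fderiv ℝ Φ) z‖ := by
  refine (Finset.abs_sum_le_sum_abs _ _).trans ?_
  refine (Finset.sum_le_sum fun i _ => abs_secD_le Φ z (norm_dirD_le i) (norm_dirD_le i)).trans ?_
  simp

lemma Decay.abs_fricZ_le (h : Decay M Φ) (z : Phase d) : |fricZ Φ z| ≤ d * M := by
  refine (Finset.abs_sum_le_sum_abs _ _).trans ?_
  have : ∀ i ∈ (Finset.univ : Finset (Fin d)), |z.2 i * fderiv ℝ Φ z (dirP i)| ≤ M := by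
    intro i _
    rw [abs_mul]
    have h1 : |z.2 i| ≤ 1 + ‖z‖ := by
      have := (norm_le_pi_norm z.2 i).trans (norm_snd_le z)
      rw [Real.norm_eq_abs] at this
      linarith
    exact (mul_le_mul h1 (abs_clm_apply_le _ (norm_dirP_le i)) (abs_nonneg _)
      (by positivity)).trans (h.grad z)
  refine (Finset.sum_le_sum this).trans ?_
  simp

lemma carreZ_nonneg (Φ : Phase d → ℝ) (z : Phase d) : 0 ≤ carreZ Φ z :=
  Finset.sum_nonneg fun _ _ => sq_nonneg _

lemma abs_carreZ_le (Φ : Phase d → ℝ) (z : Phase d) :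
    |carreZ Φ z| ≤ d * ‖fderiv ℝ Φ z‖ ^ 2 := by
  rw [abs_of_nonneg (carreZ_nonneg Φ z)]
  have : ∀ i ∈ (Finset.univ : Finset (Fin d)),
      (fderiv ℝ Φ z (dirD i)) ^ 2 ≤ ‖fderiv ℝ Φ z‖ ^ 2 := by
    intro i _
    rw [← sq_abs]
    exact pow_le_pow_left₀ (abs_nonneg _) (abs_clm_apply_le _ (norm_dirD_le i)) 2
  refine (Finset.sum_le_sum this).trans ?_
  simp

lemma Decay.abs_carreZ_le (h : Decay M Φ) (z : Phase d) : |carreZ Φ z| ≤ d * M ^ 2 := by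
  refine (_root_.abs_carreZ_le Φ z).trans ?_
  have := h.norm_fderiv_le z
  gcongr

lemma Decay.continuous_fricZ (h : Decay M Φ) : Continuous (fricZ Φ) := by
  have := h.continuous_fderiv
  unfold fricZ
  fun_prop

lemma Decay.continuous_carreZ (h : Decay M Φ) : Continuous (carreZ Φ) := by
  have := h.continuous_fderiv
  unfold carreZ
  fun_prop

lemma Decay.continuous_laplZ (h : Decay M Φ) : Continuous (laplZ Φ) := by
  have := h.continuous_hess
  unfold laplZ secD
  fun_prop

/-- A constant controlling the force fields. -/
def ForceBound (A : ℝ) (V ψ : (Fin d → ℝ) → ℝ) : Prop :=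
  0 ≤ A ∧ ContDiff ℝ 2 V ∧ ContDiff ℝ 2 ψ ∧
    (∀ q i, |fderiv ℝ V q (Pi.single i 1)| ≤ A * (1 + ‖q‖)) ∧
    (∀ q i, |fderiv ℝ ψ q (Pi.single i 1)| ≤ A)

lemma PotentialHyp.exists_forceBound {m : ℝ} {V ψ : (Fin d → ℝ) → ℝ}
    (hyp : PotentialHyp d m V ψ) : ∃ A, ForceBound A V ψ := by
  obtain ⟨K, hK⟩ := hyp.V_hess_bdd
  obtain ⟨L, hL⟩ := hyp.ψ_deriv_bdd
  have hK0 : 0 ≤ K := (ContinuousLinearMap.opNorm_nonneg _).trans (hK 0)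
  have hL0 : 0 ≤ L := (norm_nonneg _).trans (hL 0).1
  have hV : Differentiable ℝ (fderiv ℝ V) :=
    (hyp.V_smooth.fderiv_right (m := 1) (by norm_num)).differentiable one_ne_zero
  have hgrow : ∀ q, ‖fderiv ℝ V q‖ ≤ ‖fderiv ℝ V 0‖ + K * ‖q‖ := by
    intro q
    have h := Convex.norm_image_sub_le_of_norm_fderiv_le (𝕜 := ℝ) (f := fderiv ℝ V) (C := K)
      (s := univ) (fun x _ => hV x) (fun x _ => hK x) convex_univ (mem_univ 0) (mem_univ q)
    rw [sub_zero] at h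
    have := norm_sub_norm_le (fderiv ℝ V q) (fderiv ℝ V 0)
    linarith
  refine ⟨‖fderiv ℝ V 0‖ + K + L, by positivity, hyp.V_smooth, hyp.ψ_smooth, ?_, ?_⟩
  · intro q i
    refine (abs_clm_apply_le _ (norm_single_one_le i)).trans ((hgrow q).trans ?_)
    nlinarith [norm_nonneg q, norm_nonneg (fderiv ℝ V 0)]
  · intro q i
    refine (abs_clm_apply_le _ (norm_single_one_le i)).trans ((hL q).1.trans ?_)
    nlinarith [norm_nonneg (fderiv ℝ V 0)]

variable {A m γ T C : ℝ} {V ψ : (Fin d → ℝ) → ℝ}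

/-- The slow part of the generator. -/
def slowZ (γ : ℝ) (V ψ : (Fin d → ℝ) → ℝ) (ν : Measure (Phase d)) (Φ : Phase d → ℝ)
    (x : Phase d) : ℝ :=
  -(∑ i, forceZ V ψ ν x.1 i * fderiv ℝ Φ (Zmap γ x) (dirD i)) + laplZ Φ (Zmap γ x)

lemma genZ_eq_slowZ (ν : Measure (Phase d)) (Φ : Phase d → ℝ) (x : Phase d) :
    genZ m γ V ψ ν Φ x = slowZ γ V ψ ν Φ x - γ ^ 2 / m * fricZ Φ (Zmap γ x) := by
  unfold genZ slowZ; ring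

lemma ForceBound.abs_forceZ_le (hA : ForceBound A V ψ) (ν : Measure (Phase d))
    [IsProbabilityMeasure ν] (q : Fin d → ℝ) (i : Fin d) :
    |forceZ V ψ ν q i| ≤ 2 * A * (1 + ‖q‖) := by
  have h1 := hA.2.2.2.1 q i
  have h2 : |convGradPsi ψ ν q i| ≤ A := abs_integral_le_of_bdd (fun y => hA.2.2.2.2 _ i) ν
  have h3 := abs_add_le (fderiv ℝ V q (Pi.single i 1)) (convGradPsi ψ ν q i)
  have h0 := hA.1
  unfold forceZ
  nlinarith [norm_nonneg q]

lemma ForceBound.abs_slowZ_le (hA : ForceBound A V ψ) (ν : Measure (Phase d))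
    [IsProbabilityMeasure ν] (Φ : Phase d → ℝ) (x : Phase d) :
    |slowZ γ V ψ ν Φ x| ≤ d * (4 * A + 1) * ((1 + ‖Zmap γ x‖) * ‖fderiv ℝ Φ (Zmap γ x)‖
      + ‖fderiv ℝ (fderiv ℝ Φ) (Zmap γ x)‖) := by
  set z := Zmap γ x with hz
  have hq := norm_fst_le_Zmap γ x
  rw [← hz] at hq
  have h0 := hA.1
  have h1 : |∑ i, forceZ V ψ ν x.1 i * fderiv ℝ Φ z (dirD i)| ≤
      d * (4 * A * (1 + ‖z‖) * ‖fderiv ℝ Φ z‖) := by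
    refine (Finset.abs_sum_le_sum_abs _ _).trans ?_
    have : ∀ i ∈ (Finset.univ : Finset (Fin d)),
        |forceZ V ψ ν x.1 i * fderiv ℝ Φ z (dirD i)| ≤
          4 * A * (1 + ‖z‖) * ‖fderiv ℝ Φ z‖ := by
      intro i _
      rw [abs_mul]
      have hf : |forceZ V ψ ν x.1 i| ≤ 4 * A * (1 + ‖z‖) :=
        (hA.abs_forceZ_le ν x.1 i).trans (by nlinarith [norm_nonneg z])
      exact mul_le_mul hf (abs_clm_apply_le _ (norm_dirD_le i)) (abs_nonneg _) (by positivity)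
    refine (Finset.sum_le_sum this).trans ?_
    simp
  have h2 := abs_laplZ_le Φ z
  have h3 : |slowZ γ V ψ ν Φ x| ≤ |∑ i, forceZ V ψ ν x.1 i * fderiv ℝ Φ z (dirD i)|
      + |laplZ Φ z| := by
    unfold slowZ
    rw [← abs_neg (∑ i, _)]
    exact abs_add_le _ _
  have hd : (0 : ℝ) ≤ d := Nat.cast_nonneg d
  have p1 : 0 ≤ (1 + ‖z‖) * ‖fderiv ℝ Φ z‖ := by positivity
  have p2 : 0 ≤ ‖fderiv ℝ (fderiv ℝ Φ) z‖ := ContinuousLinearMap.opNorm_nonneg _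
  have p3 : 0 ≤ d * ((1 + ‖z‖) * ‖fderiv ℝ Φ z‖) := by positivity
  have p4 : 0 ≤ d * (A * ‖fderiv ℝ (fderiv ℝ Φ) z‖) := by positivity
  nlinarith

/-- The interaction part of the generator as a function of two phase space points. -/
def pairZ (γ : ℝ) (ψ : (Fin d → ℝ) → ℝ) (Φ : Phase d → ℝ) (w : Phase d × Phase d) : ℝ :=
  ∑ i, fderiv ℝ ψ (w.1.1 - w.2.1) (Pi.single i 1) * fderiv ℝ Φ (Zmap γ w.1) (dirD i)

/-- The generator without the interaction. -/
def freeZ (m γ : ℝ) (V : (Fin d → ℝ) → ℝ) (Φ : Phase d → ℝ) (x : Phase d) : ℝ :=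
  -(∑ i, fderiv ℝ V x.1 (Pi.single i 1) * fderiv ℝ Φ (Zmap γ x) (dirD i))
    - γ ^ 2 / m * fricZ Φ (Zmap γ x) + laplZ Φ (Zmap γ x)

lemma ForceBound.continuous_fderiv_snd (hA : ForceBound A V ψ) : Continuous (fderiv ℝ ψ) :=
  hA.2.2.1.continuous_fderiv (by norm_num)

lemma ForceBound.continuous_fderiv_fst (hA : ForceBound A V ψ) : Continuous (fderiv ℝ V) :=
  hA.2.1.continuous_fderiv (by norm_num)

lemma genZ_eq_freeZ (hA : ForceBound A V ψ) (ν : Measure (Phase d)) [IsProbabilityMeasure ν]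
    (Φ : Phase d → ℝ) (x : Phase d) :
    genZ m γ V ψ ν Φ x = freeZ m γ V Φ x - ∫ y, pairZ γ ψ Φ (x, y) ∂ν := by
  have hψ := hA.continuous_fderiv_snd
  have h1 : ∫ y, pairZ γ ψ Φ (x, y) ∂ν =
      ∑ i, convGradPsi ψ ν x.1 i * fderiv ℝ Φ (Zmap γ x) (dirD i) := by
    unfold pairZ
    dsimp only
    rw [integral_finsetSum]
    · refine Finset.sum_congr rfl fun i _ => ?_
      rw [integral_mul_const]
      rfl
    · intro i _
      refine Integrable.mul_const ?_ _
      exact integrable_of_continuous_of_bdd (by fun_prop) (fun y => hA.2.2.2.2 _ i) ν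
  rw [h1]
  unfold genZ freeZ forceZ
  simp only [add_mul, Finset.sum_add_distrib]
  ring

lemma Decay.continuous_freeZ (h : Decay M Φ) (hA : ForceBound A V ψ) :
    Continuous (freeZ m γ V Φ) := by
  have h1 := hA.continuous_fderiv_fst
  have h2 := h.continuous_fderiv
  have h3 := h.continuous_fricZ
  have h4 := h.continuous_laplZ
  unfold freeZ
  fun_prop

lemma Decay.continuous_pairZ (h : Decay M Φ) (hA : ForceBound A V ψ) :
    Continuous (pairZ γ ψ Φ) := by
  have h1 := hA.continuous_fderiv_snd
  have h2 := h.continuous_fderiv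
  unfold pairZ
  fun_prop

lemma Decay.abs_pairZ_le (h : Decay M Φ) (hA : ForceBound A V ψ) (w : Phase d × Phase d) :
    |pairZ γ ψ Φ w| ≤ d * (A * M) := by
  refine (Finset.abs_sum_le_sum_abs _ _).trans ?_
  have : ∀ i ∈ (Finset.univ : Finset (Fin d)),
      |fderiv ℝ ψ (w.1.1 - w.2.1) (Pi.single i 1) * fderiv ℝ Φ (Zmap γ w.1) (dirD i)| ≤
        A * M := by
    intro i _
    rw [abs_mul]
    exact mul_le_mul (hA.2.2.2.2 _ i) ((abs_clm_apply_le _ (norm_dirD_le i)).trans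
      (h.norm_fderiv_le _)) (abs_nonneg _) hA.1
  refine (Finset.sum_le_sum this).trans ?_
  simp

lemma Decay.exists_freeZ_bdd (h : Decay M Φ) (hA : ForceBound A V ψ) (m γ : ℝ) :
    ∃ B, ∀ x, |freeZ m γ V Φ x| ≤ B := by
  refine ⟨d * (4 * A + 1) * (M + M) + |γ ^ 2 / m| * (d * M) + d * (A * M), fun x => ?_⟩
  have e := genZ_eq_freeZ (m := m) (γ := γ) hA (Measure.dirac x) Φ x
  rw [genZ_eq_slowZ] at e
  have h1 := hA.abs_slowZ_le (γ := γ) (Measure.dirac x) Φ x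
  have h2 := h.abs_fricZ_le (Zmap γ x)
  have h3 : |∫ y, pairZ γ ψ Φ (x, y) ∂(Measure.dirac x)| ≤ d * (A * M) :=
    abs_integral_le_of_bdd (fun y => h.abs_pairZ_le hA _) _
  have h4 : freeZ m γ V Φ x = slowZ γ V ψ (Measure.dirac x) Φ x
      + -(γ ^ 2 / m * fricZ Φ (Zmap γ x)) + ∫ y, pairZ γ ψ Φ (x, y) ∂(Measure.dirac x) := by
    linarith
  rw [h4]
  refine (abs_add_le _ _).trans (add_le_add ((abs_add_le _ _).trans (add_le_add ?_ ?_)) h3)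
  · refine h1.trans ?_
    have := hA.1
    gcongr
    · exact h.grad _
    · exact h.hess _
  · rw [abs_neg, abs_mul]
    gcongr

/-- Average of `Φ ∘ Zmap γ`. -/
def meanZ (γ : ℝ) (ρ : ℝ → ProbabilityMeasure (Phase d)) (Φ : Phase d → ℝ) (t : ℝ) : ℝ :=
  ∫ x, Φ (Zmap γ x) ∂(ρ t : Measure (Phase d))

/-- Average of the generator. -/
def meanGen (m γ : ℝ) (V ψ : (Fin d → ℝ) → ℝ) (ρ : ℝ → ProbabilityMeasure (Phase d))
    (Φ : Phase d → ℝ) (t : ℝ) : ℝ :=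
  ∫ x, genZ m γ V ψ (ρ t : Measure (Phase d)) Φ x ∂(ρ t : Measure (Phase d))

lemma Decay.integrable_genZ (h : Decay M Φ) (hA : ForceBound A V ψ) (ν : Measure (Phase d))
    [IsProbabilityMeasure ν] : Integrable (genZ m γ V ψ ν Φ) ν := by
  obtain ⟨B, hB⟩ := h.exists_freeZ_bdd hA m γ
  have h1 := integrable_of_continuous_of_bdd (h.continuous_freeZ (m := m) (γ := γ) hA) hB ν
  have h2 := integrable_of_continuous_of_bdd (h.continuous_pairZ (γ := γ) hA)
    (h.abs_pairZ_le hA) (ν.prod ν)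
  refine (h1.sub h2.integral_prod_left).congr (Filter.Eventually.of_forall fun x => ?_)
  simp only [Pi.sub_apply]
  rw [genZ_eq_freeZ hA]

lemma Decay.integral_genZ (h : Decay M Φ) (hA : ForceBound A V ψ) (ν : Measure (Phase d))
    [IsProbabilityMeasure ν] :
    ∫ x, genZ m γ V ψ ν Φ x ∂ν =
      (∫ x, freeZ m γ V Φ x ∂ν) - ∫ w, pairZ γ ψ Φ w ∂(ν.prod ν) := by
  obtain ⟨B, hB⟩ := h.exists_freeZ_bdd hA m γ
  have h1 := integrable_of_continuous_of_bdd (h.continuous_freeZ (m := m) (γ := γ) hA) hB ν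
  have h2 := integrable_of_continuous_of_bdd (h.continuous_pairZ (γ := γ) hA)
    (h.abs_pairZ_le hA) (ν.prod ν)
  rw [integral_prod _ h2, ← integral_sub h1 h2.integral_prod_left]
  simp only [genZ_eq_freeZ hA]

lemma Decay.continuousOn_meanGen (h : Decay M Φ) (hA : ForceBound A V ψ)
    {ρ : ℝ → ProbabilityMeasure (Phase d)} {S : Set ℝ} (hρ : ContinuousOn ρ S) :
    ContinuousOn (meanGen m γ V ψ ρ Φ) S := by
  obtain ⟨B, hB⟩ := h.exists_freeZ_bdd hA m γ
  have h1 := (continuous_integral_probabilityMeasure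
    (h.continuous_freeZ (m := m) (γ := γ) hA) hB).comp_continuousOn hρ
  have hp : Continuous fun ν : ProbabilityMeasure (Phase d) => ν.prod ν :=
    ProbabilityMeasure.continuous_prod.comp (continuous_id.prodMk continuous_id)
  have h2 := ((continuous_integral_probabilityMeasure (h.continuous_pairZ (γ := γ) hA)
    (h.abs_pairZ_le hA)).comp hp).comp_continuousOn hρ
  refine (h1.sub h2).congr fun t _ => ?_
  rw [meanGen, h.integral_genZ hA]
  simp [Function.comp]

lemma continuousOn_meanZ {h : Phase d → ℝ} (hc : Continuous h) {B : ℝ} (hb : ∀ z, |h z| ≤ B)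
    {ρ : ℝ → ProbabilityMeasure (Phase d)} {S : Set ℝ} (hρ : ContinuousOn ρ S) :
    ContinuousOn (meanZ γ ρ h) S :=
  (continuous_integral_probabilityMeasure (h := fun x => h (Zmap γ x)) (by fun_prop)
    (fun x => hb _)).comp_continuousOn hρ

lemma abs_meanZ_le {h : Phase d → ℝ} {B : ℝ} (hb : ∀ z, |h z| ≤ B)
    (ρ : ℝ → ProbabilityMeasure (Phase d)) (t : ℝ) : |meanZ γ ρ h t| ≤ B :=
  abs_integral_le_of_bdd (fun _ => hb _) _

lemma GoodCurve.rate_interval (hγ : γ ≠ 0) (hC : 0 ≤ C) (hT : 0 ≤ T) (hA : ForceBound A V ψ)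
    {ρ : ℝ → ProbabilityMeasure (Phase d)} (hρ : GoodCurve d m γ T V ψ C ρ)
    {η : ℝ → ℝ} (hη : IsCb2 η) (hΦ : Decay M Φ) :
    η T * meanZ γ ρ Φ T - η 0 * meanZ γ ρ Φ 0
      - (∫ t in (0 : ℝ)..T, deriv η t * meanZ γ ρ Φ t)
      - (∫ t in (0 : ℝ)..T, η t * meanGen m γ V ψ ρ Φ t)
      - 1 / 2 * (∫ t in (0 : ℝ)..T, η t ^ 2 * meanZ γ ρ (carreZ Φ) t) ≤ C := by
  have h := hρ.rate_tensor hγ hC hη hΦ.isCb2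
  rw [integral_Icc_eq_integral_Ioc, ← intervalIntegral.integral_of_le hT,
    integral_Icc_eq_integral_Ioc, ← intervalIntegral.integral_of_le hT] at h
  obtain ⟨B, hB⟩ := hΦ.bdd
  have hc := hΦ.smooth.continuous
  have e1 : ∀ t, (∫ x, (deriv η t * Φ (Zmap γ x)
          + η t * genZ m γ V ψ (ρ t : Measure (Phase d)) Φ x) ∂(ρ t : Measure (Phase d))) =
      deriv η t * meanZ γ ρ Φ t + η t * meanGen m γ V ψ ρ Φ t := by
    intro t
    rw [integral_add, integral_const_mul, integral_const_mul]
    · rfl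
    · exact (integrable_of_continuous_of_bdd (h := fun x => Φ (Zmap γ x)) (by fun_prop)
        (fun x => hB _) _).const_mul _
    · exact (hΦ.integrable_genZ hA _).const_mul _
  simp only [e1] at h
  have hηc : Continuous η := hη.1.continuous
  have hηd : Continuous (deriv η) := hη.1.continuous_deriv (by norm_num)
  have hm := continuousOn_meanZ (γ := γ) hc hB hρ.cont
  have hg := hΦ.continuousOn_meanGen (m := m) (γ := γ) hA hρ.cont
  rw [intervalIntegral.integral_add] at h
  · change η T * meanZ γ ρ Φ T - η 0 * meanZ γ ρ Φ 0 - _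
      - 1 / 2 * (∫ t in (0 : ℝ)..T, η t ^ 2 * meanZ γ ρ (carreZ Φ) t) ≤ C at h
    linarith
  · exact ContinuousOn.intervalIntegrable_of_Icc hT (hηd.continuousOn.mul hm)
  · exact ContinuousOn.intervalIntegrable_of_Icc hT (hηc.continuousOn.mul hg)

lemma Decay.abs_slowZ_le (h : Decay M Φ) (hA : ForceBound A V ψ) (ν : Measure (Phase d))
    [IsProbabilityMeasure ν] (x : Phase d) :
    |slowZ γ V ψ ν Φ x| ≤ d * (4 * A + 1) * (2 * M) := by
  refine (hA.abs_slowZ_le ν Φ x).trans ?_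
  have := hA.1
  rw [two_mul]
  gcongr
  · exact h.grad _
  · exact h.hess _

lemma Decay.meanGen_le (h : Decay M Φ) (hA : ForceBound A V ψ)
    (ρ : ℝ → ProbabilityMeasure (Phase d)) (t : ℝ) :
    |meanGen m γ V ψ ρ Φ t + γ ^ 2 / m * meanZ γ ρ (fricZ Φ) t| ≤ d * (4 * A + 1) * (2 * M) := by
  have h1 : Integrable (fun x => γ ^ 2 / m * fricZ Φ (Zmap γ x)) (ρ t : Measure (Phase d)) :=
    (integrable_of_continuous_of_bdd (h := fun x => fricZ Φ (Zmap γ x))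
      (h.continuous_fricZ.comp (Zmap γ).continuous) (fun x => h.abs_fricZ_le _) _).const_mul _
  unfold meanGen meanZ
  rw [← integral_const_mul, ← integral_add (h.integrable_genZ hA _) h1]
  refine abs_integral_le_of_bdd (fun x => ?_) _
  rw [genZ_eq_slowZ, sub_add_cancel]
  exact h.abs_slowZ_le hA _ x

lemma GoodCurve.increment_le (hγ : γ ≠ 0) (hC : 0 ≤ C) (hT : 0 ≤ T) (hA : ForceBound A V ψ)
    {ρ : ℝ → ProbabilityMeasure (Phase d)} (hρ : GoodCurve d m γ T V ψ C ρ)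
    (hΦ : Decay M Φ) {a b : ℝ} (ha : 0 ≤ a) (hab : a ≤ b) (hb : b ≤ T) :
    meanZ γ ρ Φ b - meanZ γ ρ Φ a
      + γ ^ 2 / m * (∫ t in a..b, meanZ γ ρ (fricZ Φ) t) ≤
      C + (b - a) * (d * (4 * A + 1) * 2 * (M + M ^ 2)) := by
  obtain ⟨B, hB⟩ := hΦ.bdd
  have hm := continuousOn_meanZ (γ := γ) hΦ.smooth.continuous hB hρ.cont
  have hg := hΦ.continuousOn_meanGen (m := m) (γ := γ) hA hρ.cont
  have hcr := continuousOn_meanZ (γ := γ) hΦ.continuous_carreZ hΦ.abs_carreZ_le hρ.cont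
  have hfr := continuousOn_meanZ (γ := γ) hΦ.continuous_fricZ hΦ.abs_fricZ_le hρ.cont
  set u : ℝ → ℝ := fun t => -meanGen m γ V ψ ρ Φ t - 1 / 2 * meanZ γ ρ (carreZ Φ) t with hu
  have huc : ContinuousOn u (Icc 0 T) := hg.neg.sub (hcr.const_mul _ )
  have key := ramp_of_continuousOn (m := meanZ γ ρ Φ) (u := u) (C := C) hT hm huc (by
    intro η hη hη1
    have h := hρ.rate_interval hγ hC hT hA hη hΦ
    have hηc : Continuous η := hη.1.continuous
    have e : ∫ t in (0 : ℝ)..T, η t * u t ≤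
        ∫ t in (0 : ℝ)..T, (-(η t * meanGen m γ V ψ ρ Φ t)
          - 1 / 2 * (η t ^ 2 * meanZ γ ρ (carreZ Φ) t)) := by
      apply intervalIntegral.integral_mono_on hT
      · exact ContinuousOn.intervalIntegrable_of_Icc hT (hηc.continuousOn.mul huc)
      · exact ContinuousOn.intervalIntegrable_of_Icc hT
          ((hηc.continuousOn.mul hg).neg.sub
            (((hηc.pow 2).continuousOn.mul hcr).const_mul _))
      · intro t _
        have hcn : 0 ≤ meanZ γ ρ (carreZ Φ) t := integral_nonneg fun x => carreZ_nonneg _ _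
        have : η t ^ 2 ≤ η t := by nlinarith [hη1 t]
        simp only [hu]
        nlinarith
    rw [intervalIntegral.integral_sub, intervalIntegral.integral_neg,
      intervalIntegral.integral_const_mul] at e
    · linarith
    · exact ContinuousOn.intervalIntegrable_of_Icc hT (hηc.continuousOn.mul hg).neg
    · exact ContinuousOn.intervalIntegrable_of_Icc hT
        (((hηc.pow 2).continuousOn.mul hcr).const_mul _)) ha hab hb
  have hsub : Icc a b ⊆ Icc 0 T := Icc_subset_Icc ha hb
  have hlow : ∫ t in a..b, (γ ^ 2 / m * meanZ γ ρ (fricZ Φ) t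
      - d * (4 * A + 1) * 2 * (M + M ^ 2)) ≤ ∫ t in a..b, u t := by
    apply intervalIntegral.integral_mono_on hab
    · exact ContinuousOn.intervalIntegrable_of_Icc hab
        (((hfr.const_mul _).sub continuousOn_const).mono hsub)
    · exact ContinuousOn.intervalIntegrable_of_Icc hab (huc.mono hsub)
    · intro t _
      have h1 := abs_le.1 (hΦ.meanGen_le (m := m) (γ := γ) hA ρ t)
      have h2 := abs_le.1 (abs_meanZ_le (γ := γ) hΦ.abs_carreZ_le ρ t)
      have h3 : 0 ≤ d * A * M ^ 2 := by have := hA.1; positivity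
      have h4 : 0 ≤ d * M ^ 2 := by positivity
      simp only [hu]
      nlinarith
  rw [intervalIntegral.integral_sub, intervalIntegral.integral_const_mul,
    intervalIntegral.integral_const, smul_eq_mul] at hlow
  · linarith
  · exact ContinuousOn.intervalIntegrable_of_Icc hab ((hfr.const_mul _).mono hsub)
  · exact intervalIntegrable_const

end RateInequality

section Entropy

variable {d : ℕ}

lemma integrable_exp_neg_sum_sq {m : ℝ} (hm : 0 < m) :
    Integrable (fun p : Fin d → ℝ => exp (-((∑ i, (p i) ^ 2) / (2 * m)))) volume := by
  have h : Integrable (fun p : Fin d → ℝ => ∏ i, exp (-(1 / (2 * m)) * (p i) ^ 2)) volume :=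
    Integrable.fintype_prod (fun _ => integrable_exp_neg_mul_sq (by positivity))
  refine h.congr (Filter.Eventually.of_forall fun p => ?_)
  simp only
  rw [← Real.exp_sum, ← Finset.mul_sum]
  congr 1
  ring

lemma PotentialHyp.integrable_exp_neg_Hfun {m : ℝ} {V ψ : (Fin d → ℝ) → ℝ}
    (hyp : PotentialHyp d m V ψ) :
    Integrable (fun x : Phase d => exp (-(Hfun m V x))) volume := by
  have h := hyp.V_exp_int.mul_prod (integrable_exp_neg_sum_sq (d := d) hyp.hm)
  rw [← Measure.volume_eq_prod] at h
  refine h.congr (Filter.Eventually.of_forall fun x => ?_)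
  simp only [Hfun]
  rw [← Real.exp_add]
  congr 1
  ring

lemma PotentialHyp.isProbabilityMeasure_gibbs {m : ℝ} {V ψ : (Fin d → ℝ) → ℝ}
    (hyp : PotentialHyp d m V ψ) : IsProbabilityMeasure (gibbs d m V) := by
  have hi := hyp.integrable_exp_neg_Hfun
  have hpos : 0 < gibbsZ d m V := integral_exp_pos hi
  constructor
  rw [gibbs, Measure.smul_apply, withDensity_apply _ MeasurableSet.univ, Measure.restrict_univ,
    ← ofReal_integral_eq_lintegral_ofReal hi
      (Filter.Eventually.of_forall fun x => (Real.exp_pos _).le)]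
  exact ENNReal.inv_mul_cancel (by simpa using hpos) ENNReal.ofReal_ne_top

lemma exists_testFn_of_entropy (ζ : Measure (Phase d)) [IsProbabilityMeasure ζ] {lam C : ℝ}
    (hlam : 0 ≤ lam) (hC : 0 ≤ C) :
    ∃ R > 0, ∃ κ : Phase d → ℝ, Continuous κ ∧ (∀ x, 0 ≤ κ x ∧ κ x ≤ 1) ∧
      (∀ x, R < ‖x‖ → κ x = 0) ∧
      ∀ ν : ProbabilityMeasure (Phase d), relEntDV (ν : Measure (Phase d)) ζ ≤ ENNReal.ofReal C →
        lam * (∫ x, (1 - κ x) ∂(ν : Measure (Phase d))) ≤ C + log 2 := by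
  obtain ⟨K, hK, hKζ⟩ := isTightMeasureSet_iff_exists_isCompact_measure_compl_le.1
    (isTightMeasureSet_singleton (μ := ζ)) (ENNReal.ofReal (exp (-lam)))
    (by simpa using Real.exp_pos _)
  obtain ⟨r, hr⟩ := hK.isBounded.subset_closedBall (0 : Phase d)
  let bump : ContDiffBump (0 : Phase d) := ⟨|r| + 1, |r| + 2, by positivity, by linarith⟩
  have hsm : ContDiff ℝ (⊤ : ℕ∞) (fun x => -(lam * bump x)) :=
    ((bump.contDiff (n := (⊤ : ℕ∞))).const_smul lam).neg
  have hcs : HasCompactSupport (fun x => -(lam * bump x)) := by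
    have := bump.hasCompactSupport
    exact (this.mul_left (f := fun _ => lam)).neg
  refine ⟨|r| + 2, by positivity, bump, bump.continuous, fun x => ⟨bump.nonneg, bump.le_one⟩,
    fun x hx => bump.zero_of_le_dist (by simpa using hx.le), fun ν hν => ?_⟩
  have h := (le_iSup (fun φ : {φ : Phase d → ℝ // IsTestFn φ} =>
    ENNReal.ofReal ((∫ x, φ.1 x ∂(ν : Measure (Phase d)))
      - Real.log (∫ x, Real.exp (φ.1 x) ∂ζ))) ⟨_, hsm, hcs⟩).trans hν
  rw [ENNReal.ofReal_le_ofReal_iff hC] at h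
  simp only [integral_neg, integral_const_mul] at h
  have hone : ∀ x ∈ K, bump x = 1 := fun x hx =>
    bump.one_of_mem_closedBall (Metric.closedBall_subset_closedBall
      (by linarith [le_abs_self r]) (hr hx))
  have hKr : ζ.real Kᶜ ≤ exp (-lam) := by
    have := hKζ ζ (mem_singleton _)
    exact ENNReal.toReal_le_of_le_ofReal (Real.exp_pos _).le this
  have h_int : ∫ x, exp (-(lam * bump x)) ∂ζ ≤ 2 * exp (-lam) := by
    have hmeas : MeasurableSet Kᶜ := hK.isClosed.measurableSet.compl
    have hle : ∀ x, exp (-(lam * bump x)) ≤ exp (-lam) + Kᶜ.indicator (fun _ => (1 : ℝ)) x := by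
      intro x
      by_cases hx : x ∈ K
      · rw [hone x hx, mul_one]
        simp [hx]
      · have h1 : exp (-(lam * bump x)) ≤ 1 := by
          rw [Real.exp_le_one_iff]
          have := mul_nonneg hlam (bump.nonneg (x := x))
          linarith
        have h2 : Kᶜ.indicator (fun _ => (1 : ℝ)) x = 1 := by simp [hx]
        rw [h2]
        linarith [Real.exp_pos (-lam)]
    have hi1 : Integrable (fun x => exp (-(lam * bump x))) ζ := by
      refine integrable_of_continuous_of_bdd (B := 1) ?_ ?_ ζ
      · have := bump.continuous
        fun_prop
      · intro x
        rw [Real.abs_exp, Real.exp_le_one_iff]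
        have := mul_nonneg hlam (bump.nonneg (x := x))
        linarith
    have hi2 : Integrable (Kᶜ.indicator (fun _ => (1 : ℝ))) ζ :=
      (integrable_const _).indicator hmeas
    refine (integral_mono hi1 ((integrable_const _).add hi2) hle).trans ?_
    simp only [Pi.add_apply]
    rw [integral_add (integrable_const _) hi2, integral_indicator_const _ hmeas]
    simp only [integral_const, probReal_univ, smul_eq_mul, one_mul, mul_one]
    linarith
  have hpos : 0 < ∫ x, exp (-(lam * bump x)) ∂ζ := by
    apply integral_exp_pos
    refine integrable_of_continuous_of_bdd (B := 1) ?_ ?_ ζ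
    · have := bump.continuous
      fun_prop
    · intro x
      rw [Real.abs_exp, Real.exp_le_one_iff]
      have := mul_nonneg hlam (bump.nonneg (x := x))
      linarith
  have hlog := Real.log_le_log hpos h_int
  rw [Real.log_mul (by norm_num) (Real.exp_pos _).ne', Real.log_exp] at hlog
  have hib : Integrable (fun x => bump x) (ν : Measure (Phase d)) :=
    integrable_of_continuous_of_bdd (B := 1) bump.continuous (fun x => by
      rw [abs_of_nonneg bump.nonneg]; exact bump.le_one) _
  rw [integral_sub (integrable_const _) hib]
  simp only [integral_const, probReal_univ, smul_eq_mul, mul_one]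
  linarith

end Entropy

section Lyapunov

variable {d : ℕ}

/-- The Euclidean bilinear form on phase space. -/
def euclB : Phase d →L[ℝ] Phase d →L[ℝ] ℝ :=
  ∑ i, ((((ContinuousLinearMap.proj i).comp
      (ContinuousLinearMap.fst ℝ (Fin d → ℝ) (Fin d → ℝ)) : Phase d →L[ℝ] ℝ).smulRight
      ((ContinuousLinearMap.proj i).comp
        (ContinuousLinearMap.fst ℝ (Fin d → ℝ) (Fin d → ℝ)) : Phase d →L[ℝ] ℝ))
    + (((ContinuousLinearMap.proj i).comp
      (ContinuousLinearMap.snd ℝ (Fin d → ℝ) (Fin d → ℝ)) : Phase d →L[ℝ] ℝ).smulRight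
      ((ContinuousLinearMap.proj i).comp
        (ContinuousLinearMap.snd ℝ (Fin d → ℝ) (Fin d → ℝ)) : Phase d →L[ℝ] ℝ)))

lemma euclB_apply (z u : Phase d) : euclB z u = ∑ i, (z.1 i * u.1 i + z.2 i * u.2 i) := by
  simp [euclB]

/-- The weight `1 + |Q|² + |P|²`. -/
def wtN (z : Phase d) : ℝ := 1 + euclB z z

lemma wtN_eq (z : Phase d) : wtN z = 1 + ∑ i, ((z.1 i) ^ 2 + (z.2 i) ^ 2) := by
  simp [wtN, euclB_apply, sq]

lemma one_le_wtN (z : Phase d) : 1 ≤ wtN z := by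
  rw [wtN_eq]
  have : 0 ≤ ∑ i, ((z.1 i) ^ 2 + (z.2 i) ^ 2) := Finset.sum_nonneg fun i _ => by positivity
  linarith

lemma wtN_pos (z : Phase d) : 0 < wtN z := zero_lt_one.trans_le (one_le_wtN z)

lemma norm_sq_le_wtN (z : Phase d) : 1 + ‖z‖ ^ 2 ≤ wtN z := by
  rw [wtN_eq]
  have hs : ∀ i, (z.1 i) ^ 2 + (z.2 i) ^ 2 ≤ ∑ i, ((z.1 i) ^ 2 + (z.2 i) ^ 2) := fun i =>
    Finset.single_le_sum (f := fun i => (z.1 i) ^ 2 + (z.2 i) ^ 2)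
      (fun i _ => by positivity) (Finset.mem_univ i)
  have h0 : 0 ≤ ∑ i, ((z.1 i) ^ 2 + (z.2 i) ^ 2) := Finset.sum_nonneg fun i _ => by positivity
  have h : ‖z‖ ≤ √(∑ i, ((z.1 i) ^ 2 + (z.2 i) ^ 2)) := by
    rw [Prod.norm_def, max_le_iff]
    constructor
    · refine (pi_norm_le_iff_of_nonneg (Real.sqrt_nonneg _)).2 fun i => Real.abs_le_sqrt ?_
      linarith [hs i, sq_nonneg (z.2 i)]
    · refine (pi_norm_le_iff_of_nonneg (Real.sqrt_nonneg _)).2 fun i => Real.abs_le_sqrt ?_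
      linarith [hs i, sq_nonneg (z.1 i)]
  have := (Real.le_sqrt (norm_nonneg _) h0).1 h
  linarith

lemma abs_fst_le_norm (z : Phase d) (i : Fin d) : |z.1 i| ≤ ‖z‖ :=
  (norm_le_pi_norm z.1 i).trans (norm_fst_le z)

lemma abs_snd_le_norm (z : Phase d) (i : Fin d) : |z.2 i| ≤ ‖z‖ :=
  (norm_le_pi_norm z.2 i).trans (norm_snd_le z)

lemma wtN_le (z : Phase d) : wtN z ≤ 1 + 2 * d * ‖z‖ ^ 2 := by
  rw [wtN_eq]
  have : ∀ i ∈ (Finset.univ : Finset (Fin d)), (z.1 i) ^ 2 + (z.2 i) ^ 2 ≤ 2 * ‖z‖ ^ 2 := by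
    intro i _
    have h1 := pow_le_pow_left₀ (abs_nonneg _) (abs_fst_le_norm z i) 2
    have h2 := pow_le_pow_left₀ (abs_nonneg _) (abs_snd_le_norm z i) 2
    rw [sq_abs] at h1 h2
    linarith
  have := Finset.sum_le_sum this
  simp only [Finset.sum_const, Finset.card_univ, Fintype.card_fin, nsmul_eq_mul] at this
  linarith

lemma norm_euclB_apply_le (z : Phase d) : ‖euclB z‖ ≤ 2 * d * ‖z‖ := by
  refine ContinuousLinearMap.opNorm_le_bound _ (by positivity) fun u => ?_
  rw [euclB_apply, Real.norm_eq_abs]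
  refine (Finset.abs_sum_le_sum_abs _ _).trans ?_
  have : ∀ i ∈ (Finset.univ : Finset (Fin d)),
      |z.1 i * u.1 i + z.2 i * u.2 i| ≤ 2 * (‖z‖ * ‖u‖) := by
    intro i _
    refine (abs_add_le _ _).trans ?_
    rw [abs_mul, abs_mul]
    have h1 := mul_le_mul (abs_fst_le_norm z i) (abs_fst_le_norm u i) (abs_nonneg _)
      (norm_nonneg _)
    have h2 := mul_le_mul (abs_snd_le_norm z i) (abs_snd_le_norm u i) (abs_nonneg _)
      (norm_nonneg _)
    linarith
  refine (Finset.sum_le_sum this).trans (le_of_eq ?_)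
  simp only [Finset.sum_const, Finset.card_univ, Fintype.card_fin, nsmul_eq_mul]
  ring

lemma hasFDerivAt_wtN (z : Phase d) : HasFDerivAt wtN ((2 : ℝ) • euclB z) z := by
  have h := ((euclB (d := d)).hasFDerivAt (x := z)).clm_apply (hasFDerivAt_id z)
  refine (h.const_add 1).congr_fderiv (ContinuousLinearMap.ext fun u => ?_)
  simp only [_root_.add_apply, ContinuousLinearMap.comp_apply,
    ContinuousLinearMap.flip_apply, _root_.smul_apply, smul_eq_mul, id, euclB_apply,
    ContinuousLinearMap.id_apply, Finset.mul_sum, ← Finset.sum_add_distrib]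
  refine Finset.sum_congr rfl fun i _ => ?_
  ring

lemma contDiff_wtN {n : WithTop ℕ∞} : ContDiff ℝ n (wtN : Phase d → ℝ) := by
  unfold wtN
  exact contDiff_const.add ((euclB (d := d)).contDiff.clm_apply contDiff_id)

/-- The Lyapunov functions `1 - N^{-a}`. -/
def lyap (a : ℝ) (z : Phase d) : ℝ := 1 - wtN z ^ (-a)

lemma contDiff_lyap (a : ℝ) {n : WithTop ℕ∞} : ContDiff ℝ n (lyap a : Phase d → ℝ) := by
  unfold lyap
  exact contDiff_const.sub (contDiff_wtN.rpow_const_of_ne fun z => (wtN_pos z).ne')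

lemma hasFDerivAt_wtN_rpow (s : ℝ) (z : Phase d) :
    HasFDerivAt (fun z : Phase d => wtN z ^ s) ((s * wtN z ^ (s - 1)) • ((2 : ℝ) • euclB z)) z :=
  (hasFDerivAt_wtN z).rpow_const (Or.inl (wtN_pos z).ne')

lemma hasFDerivAt_lyap (a : ℝ) (z : Phase d) :
    HasFDerivAt (lyap a) ((2 * a * wtN z ^ (-a - 1)) • euclB z) z := by
  refine ((hasFDerivAt_wtN_rpow (-a) z).const_sub 1).congr_fderiv ?_
  rw [smul_smul, ← neg_smul]
  congr 1
  ring

lemma fderiv_lyap (a : ℝ) :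
    fderiv ℝ (lyap a : Phase d → ℝ) = fun z => (2 * a * wtN z ^ (-a - 1)) • euclB z :=
  funext fun z => (hasFDerivAt_lyap a z).fderiv

lemma fderiv_fderiv_lyap_apply (a : ℝ) (z v : Phase d) :
    fderiv ℝ (fderiv ℝ (lyap a)) z v = (2 * a * wtN z ^ (-a - 1)) • euclB v
      + (2 * a * ((-a - 1) * wtN z ^ (-a - 1 - 1) * (2 * euclB z v))) • euclB z := by
  have h1 := (hasFDerivAt_wtN_rpow (-a - 1) z).const_mul (2 * a)
  have h2 := h1.smul ((euclB (d := d)).hasFDerivAt (x := z))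
  rw [fderiv_lyap]
  refine (DFunLike.congr_fun h2.fderiv v).trans ?_
  simp only [_root_.add_apply, _root_.smul_apply, ContinuousLinearMap.smulRight_apply,
    smul_eq_mul, mul_assoc]

lemma wtN_rpow_neg_le_one {a : ℝ} (ha : 0 ≤ a) (z : Phase d) : wtN z ^ (-a) ≤ 1 :=
  Real.rpow_le_one_of_one_le_of_nonpos (one_le_wtN z) (by linarith)

lemma lyap_nonneg {a : ℝ} (ha : 0 ≤ a) (z : Phase d) : 0 ≤ lyap a z := by
  have := wtN_rpow_neg_le_one ha z
  unfold lyap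
  linarith

lemma lyap_le_one (a : ℝ) (z : Phase d) : lyap a z ≤ 1 := by
  have := Real.rpow_nonneg (wtN_pos z).le (-a)
  unfold lyap
  linarith

lemma lyap_le_mul {a : ℝ} (ha : 0 ≤ a) (z : Phase d) : lyap a z ≤ a * (wtN z - 1) := by
  unfold lyap
  rw [Real.rpow_def_of_pos (wtN_pos z)]
  have h1 := Real.add_one_le_exp (log (wtN z) * -a)
  have h2 := Real.log_le_sub_one_of_pos (wtN_pos z)
  nlinarith

lemma wtN_rpow_le {a : ℝ} (ha : 0 ≤ a) (z : Phase d) : wtN z ^ (-a - 1) ≤ (wtN z)⁻¹ := by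
  rw [← Real.rpow_neg_one]
  exact Real.rpow_le_rpow_of_exponent_le (one_le_wtN z) (by linarith)

lemma wtN_rpow_le' {a : ℝ} (ha : 0 ≤ a) (z : Phase d) :
    wtN z ^ (-a - 1 - 1) ≤ (wtN z)⁻¹ := by
  rw [← Real.rpow_neg_one]
  exact Real.rpow_le_rpow_of_exponent_le (one_le_wtN z) (by linarith)

lemma decay_lyap {a : ℝ} (ha : 0 ≤ a) (ha1 : a ≤ 1) :
    Decay (a * (8 * d + 32 * d ^ 2)) (lyap a : Phase d → ℝ) := by
  have hd : (0 : ℝ) ≤ d := Nat.cast_nonneg d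
  refine ⟨contDiff_lyap a, ⟨1, fun z => ?_⟩, fun z => ?_, fun z => ?_⟩
  · rw [abs_of_nonneg (lyap_nonneg ha z)]
    exact lyap_le_one a z
  · rw [fderiv_lyap]
    have hN := wtN_pos z
    have h1 : (1 + ‖z‖) * ‖z‖ ≤ 2 * wtN z := by
      have := norm_sq_le_wtN z
      nlinarith [norm_nonneg z, sq_nonneg (‖z‖ - 1)]
    have h2 : 0 ≤ wtN z ^ (-a - 1) := Real.rpow_nonneg hN.le _
    rw [norm_smul, Real.norm_eq_abs, abs_of_nonneg (by positivity)]
    calc (1 + ‖z‖) * (2 * a * wtN z ^ (-a - 1) * ‖euclB z‖)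
        ≤ (1 + ‖z‖) * (2 * a * (wtN z)⁻¹ * (2 * d * ‖z‖)) := by
          have := wtN_rpow_le ha z
          have := norm_euclB_apply_le z
          gcongr
      _ = (4 * a * d * (wtN z)⁻¹) * ((1 + ‖z‖) * ‖z‖) := by ring
      _ ≤ (4 * a * d * (wtN z)⁻¹) * (2 * wtN z) := by gcongr
      _ = a * (8 * d) := by field_simp; ring
      _ ≤ _ := by gcongr; nlinarith
  · refine ContinuousLinearMap.opNorm_le_bound _ (by positivity) fun v => ?_
    rw [fderiv_fderiv_lyap_apply]
    have hN := wtN_pos z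
    have h2 : 0 ≤ wtN z ^ (-a - 1) := Real.rpow_nonneg hN.le _
    have h3 : 0 ≤ wtN z ^ (-a - 1 - 1) := Real.rpow_nonneg hN.le _
    have b1 : ‖(2 * a * wtN z ^ (-a - 1)) • euclB v‖ ≤ 4 * a * d * ‖v‖ := by
      rw [norm_smul, Real.norm_eq_abs, abs_of_nonneg (by positivity)]
      have h4 : wtN z ^ (-a - 1) ≤ 1 :=
        (wtN_rpow_le ha z).trans (inv_le_one_of_one_le₀ (one_le_wtN z))
      calc 2 * a * wtN z ^ (-a - 1) * ‖euclB v‖ ≤ 2 * a * 1 * (2 * d * ‖v‖) := by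
            have := norm_euclB_apply_le v
            gcongr
        _ = _ := by ring
    have b2 : ‖(2 * a * ((-a - 1) * wtN z ^ (-a - 1 - 1) * (2 * euclB z v))) • euclB z‖ ≤
        32 * a * d ^ 2 * ‖v‖ := by
      rw [norm_smul, Real.norm_eq_abs]
      have h5 : |2 * a * ((-a - 1) * wtN z ^ (-a - 1 - 1) * (2 * euclB z v))| =
          4 * a * (a + 1) * wtN z ^ (-a - 1 - 1) * |euclB z v| := by
        have : 2 * a * ((-a - 1) * wtN z ^ (-a - 1 - 1) * (2 * euclB z v)) =
          -(4 * a * (a + 1) * wtN z ^ (-a - 1 - 1) * euclB z v) := by ring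
        rw [this, abs_neg, abs_mul, abs_of_nonneg (by positivity)]
      rw [h5]
      have h6 : |euclB z v| ≤ 2 * d * ‖z‖ * ‖v‖ :=
        ((euclB z).le_opNorm v).trans (by have := norm_euclB_apply_le z; gcongr)
      have h7 : ‖z‖ ^ 2 ≤ wtN z := by linarith [norm_sq_le_wtN z]
      calc 4 * a * (a + 1) * wtN z ^ (-a - 1 - 1) * |euclB z v| * ‖euclB z‖
          ≤ 4 * a * (1 + 1) * (wtN z)⁻¹ * (2 * d * ‖z‖ * ‖v‖) * (2 * d * ‖z‖) := by
            have := wtN_rpow_le' ha z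
            have := norm_euclB_apply_le z
            gcongr
        _ = 32 * a * d ^ 2 * ‖v‖ * ((wtN z)⁻¹ * ‖z‖ ^ 2) := by ring
        _ ≤ 32 * a * d ^ 2 * ‖v‖ * ((wtN z)⁻¹ * wtN z) := by gcongr
        _ = _ := by rw [inv_mul_cancel₀ hN.ne', mul_one]
    refine (norm_add_le _ _).trans ((add_le_add b1 b2).trans ?_)
    have : 0 ≤ a * d * ‖v‖ := by positivity
    nlinarith

/-- The dissipation density of `lyap a`. -/
lemma fricZ_lyap (a : ℝ) (z : Phase d) :
    fricZ (lyap a) z = 2 * a * wtN z ^ (-a - 1) * ∑ i, (z.2 i) ^ 2 := by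
  unfold fricZ
  rw [fderiv_lyap, Finset.mul_sum]
  refine Finset.sum_congr rfl fun i _ => ?_
  have : euclB z (dirP i) = z.2 i := by
    rw [euclB_apply]
    simp [dirP, Pi.single_apply]
  simp only [_root_.smul_apply, smul_eq_mul, this]
  ring

lemma fricZ_lyap_nonneg {a : ℝ} (ha : 0 ≤ a) (z : Phase d) : 0 ≤ fricZ (lyap a) z := by
  rw [fricZ_lyap]
  have := Real.rpow_nonneg (wtN_pos z).le (-a - 1)
  have : 0 ≤ ∑ i, (z.2 i) ^ 2 := Finset.sum_nonneg fun i _ => sq_nonneg _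
  positivity

lemma Decay.const_mul {M : ℝ} {Φ : Phase d → ℝ} (h : Decay M Φ) (c : ℝ) :
    Decay (|c| * M) (fun z => c * Φ z) := by
  have e1 : fderiv ℝ (fun z => c * Φ z) = fun z => c • fderiv ℝ Φ z := funext fun z =>
    fderiv_const_mul (h.differentiable z) c
  have hd : Differentiable ℝ (fderiv ℝ Φ) :=
    (h.smooth.fderiv_right (m := 1) (by norm_num)).differentiable one_ne_zero
  obtain ⟨B, hB⟩ := h.bdd
  refine ⟨contDiff_const.mul h.smooth, ⟨|c| * B, fun z => ?_⟩, fun z => ?_, fun z => ?_⟩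
  · rw [abs_mul]
    exact mul_le_mul_of_nonneg_left (hB z) (abs_nonneg c)
  · rw [e1, norm_smul, Real.norm_eq_abs]
    have := mul_le_mul_of_nonneg_left (h.grad z) (abs_nonneg c)
    linarith
  · have e2 : fderiv ℝ (fun z => c • fderiv ℝ Φ z) z = c • fderiv ℝ (fderiv ℝ Φ) z :=
      fderiv_const_smul (hd z) c
    rw [e1, e2]
    refine (ContinuousLinearMap.opNorm_smul_le _ _).trans ?_
    rw [Real.norm_eq_abs]
    exact mul_le_mul_of_nonneg_left (h.hess z) (abs_nonneg c)

lemma fricZ_const_mul {Φ : Phase d → ℝ} (h : Differentiable ℝ Φ) (c : ℝ) (z : Phase d) :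
    fricZ (fun z => c * Φ z) z = c * fricZ Φ z := by
  unfold fricZ
  rw [fderiv_const_mul (h z) c, Finset.mul_sum]
  refine Finset.sum_congr rfl fun i _ => ?_
  simp only [_root_.smul_apply, smul_eq_mul]
  ring

variable {m T C A : ℝ} {V ψ : (Fin d → ℝ) → ℝ}

lemma meanZ_const_mul (γ : ℝ) (ρ : ℝ → ProbabilityMeasure (Phase d)) (c : ℝ) (Φ : Phase d → ℝ)
    (t : ℝ) : meanZ γ ρ (fun z => c * Φ z) t = c * meanZ γ ρ Φ t :=
  integral_const_mul _ _

lemma norm_Zmap_le {γ : ℝ} (hγ : 1 ≤ γ) (x : Phase d) : ‖Zmap γ x‖ ≤ 2 * ‖x‖ := by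
  have h1 : ‖γ⁻¹ • x.2‖ ≤ ‖x‖ := by
    rw [norm_smul, Real.norm_eq_abs, abs_of_nonneg (by positivity)]
    exact (mul_le_of_le_one_left (norm_nonneg _) (inv_le_one_of_one_le₀ hγ)).trans (norm_snd_le x)
  rw [Prod.norm_def, max_le_iff]
  constructor
  · rw [Zmap_fst]
    refine (norm_add_le _ _).trans ?_
    linarith [norm_fst_le x]
  · rw [Zmap_snd]
    linarith [norm_nonneg x]

lemma meanZ_lyap_zero_le {κ : Phase d → ℝ} {a R γ : ℝ} (ha : 0 ≤ a) (ha1 : a ≤ 1) (hγ : 1 ≤ γ)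
    (hκc : Continuous κ) (hκ01 : ∀ x, 0 ≤ κ x ∧ κ x ≤ 1) (hκR : ∀ x, R < ‖x‖ → κ x = 0)
    (ρ : ℝ → ProbabilityMeasure (Phase d)) :
    meanZ γ ρ (lyap a) 0 ≤
      (∫ x, (1 - κ x) ∂(ρ 0 : Measure (Phase d))) + a * (8 * d * R ^ 2) := by
  have hd : (0 : ℝ) ≤ d := Nat.cast_nonneg d
  have hint1 : Integrable (fun x => 1 - κ x) (ρ 0 : Measure (Phase d)) :=
    integrable_of_continuous_of_bdd (B := 1) (by fun_prop) (fun x => by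
      rw [abs_le]; constructor <;> linarith [(hκ01 x).1, (hκ01 x).2]) _
  have hpt : ∀ x, lyap a (Zmap γ x) ≤ (1 - κ x) + a * (8 * d * R ^ 2) := by
    intro x
    by_cases hx : R < ‖x‖
    · rw [hκR x hx]
      have : 0 ≤ a * (8 * d * R ^ 2) := by positivity
      linarith [lyap_le_one a (Zmap γ x)]
    · have h1 := lyap_le_mul ha (Zmap γ x)
      have h2 := wtN_le (Zmap γ x)
      have h3 : ‖Zmap γ x‖ ≤ 2 * R := (norm_Zmap_le hγ x).trans (by linarith)
      have h4 : a * (wtN (Zmap γ x) - 1) ≤ a * (8 * d * R ^ 2) := by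
        gcongr
        have h5 : ‖Zmap γ x‖ ^ 2 ≤ (2 * R) ^ 2 := by gcongr
        have h6 : 2 * (d : ℝ) * ‖Zmap γ x‖ ^ 2 ≤ 2 * d * (2 * R) ^ 2 := by gcongr
        linarith
      linarith [(hκ01 x).2]
  have hli : Integrable (fun x => lyap a (Zmap γ x)) (ρ 0 : Measure (Phase d)) := by
    obtain ⟨B, hB⟩ := (decay_lyap (d := d) ha ha1).bdd
    exact integrable_of_continuous_of_bdd
      ((decay_lyap ha ha1).smooth.continuous.comp (Zmap γ).continuous) (fun x => hB _) _
  refine (integral_mono hli (hint1.add (integrable_const _)) hpt).trans (le_of_eq ?_)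
  simp only [Pi.add_apply]
  rw [integral_add hint1 (integrable_const _)]
  simp

lemma GoodCurve.lyap_increment {γ a lam : ℝ} {ρ : ℝ → ProbabilityMeasure (Phase d)}
    (hρ : GoodCurve d m γ T V ψ C ρ) (hγ : γ ≠ 0) (hC : 0 ≤ C) (hT : 0 ≤ T)
    (hA : ForceBound A V ψ) (ha : 0 ≤ a) (ha1 : a ≤ 1) (hlam : 0 < lam)
    (hal : a * (lam * (8 * d + 32 * d ^ 2)) ≤ 1) {t : ℝ} (ht : t ∈ Icc 0 T) :
    lam * meanZ γ ρ (lyap a) t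
      + γ ^ 2 / m * (lam * ∫ s in (0 : ℝ)..t, meanZ γ ρ (fricZ (lyap a)) s)
      ≤ lam * meanZ γ ρ (lyap a) 0 + C + T * (d * (4 * A + 1) * 2 * 2) := by
  have hdec := decay_lyap (d := d) ha ha1
  have hA0 := hA.1
  have hd : (0 : ℝ) ≤ d := Nat.cast_nonneg d
  have h := hρ.increment_le hγ hC hT hA (hdec.const_mul lam) le_rfl ht.1 ht.2
  simp only [meanZ_const_mul,
    show fricZ (fun z => lam * lyap a z) = fun z : Phase d => lam * fricZ (lyap a) z from
      funext fun z => fricZ_const_mul hdec.differentiable lam z,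
    intervalIntegral.integral_const_mul] at h
  rw [abs_of_pos hlam] at h
  generalize hMd : lam * (a * (8 * d + 32 * d ^ 2)) = M at h
  have hM : M ≤ 1 := by rw [← hMd]; linarith
  have hM0 : 0 ≤ M := by rw [← hMd]; positivity
  have hMM : M + M ^ 2 ≤ 2 := by nlinarith
  have h5 : (t - 0) * (d * (4 * A + 1) * 2 * (M + M ^ 2)) ≤ T * (d * (4 * A + 1) * 2 * 2) := by
    have := ht.2
    have := ht.1
    have : t - 0 ≤ T := by linarith
    gcongr
  linarith

/-- Uniform tightness and dissipation estimates. -/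
lemma exists_lyap_le (hyp : PotentialHyp d m V ψ) (hC : 0 ≤ C) (hT : 0 ≤ T) {ε : ℝ} (hε : 0 < ε) :
    ∃ a, 0 < a ∧ a ≤ 1 ∧ ∀ γ ≥ 1, ∀ ρ : ℝ → ProbabilityMeasure (Phase d),
      GoodCurve d m γ T V ψ C ρ →
      (∀ t ∈ Icc 0 T, meanZ γ ρ (lyap a) t ≤ ε) ∧
      γ ^ 2 * (∫ t in (0 : ℝ)..T, meanZ γ ρ (fricZ (lyap a)) t) ≤ ε := by
  obtain ⟨A, hA⟩ := hyp.exists_forceBound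
  have hm := hyp.hm
  have hA0 := hA.1
  have hd : (0 : ℝ) ≤ d := Nat.cast_nonneg d
  obtain ⟨K, hK⟩ : ∃ K, K = 2 * C + log 2 + 1 + T * (d * (4 * A + 1) * 2 * 2) := ⟨_, rfl⟩
  have hK0 : 0 < K := by
    have := Real.log_nonneg (by norm_num : (1 : ℝ) ≤ 2)
    rw [hK]
    positivity
  obtain ⟨lam, hlam⟩ : ∃ lam, lam = K * (1 + m) / ε := ⟨_, rfl⟩
  have hlam0 : 0 < lam := by rw [hlam]; positivity
  have hlamε : lam * ε = K * (1 + m) := by rw [hlam]; field_simp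
  have := hyp.isProbabilityMeasure_gibbs
  obtain ⟨R, hR, κ, hκc, hκ01, hκR, hκent⟩ := exists_testFn_of_entropy (gibbs d m V) hlam0.le hC
  have p1 : 0 ≤ lam * (8 * d + 32 * d ^ 2) := by positivity
  have p2 : 0 ≤ lam * (8 * d * R ^ 2) := by positivity
  obtain ⟨D, hD⟩ : ∃ D, D = 1 + lam * (8 * d + 32 * d ^ 2) + lam * (8 * d * R ^ 2) := ⟨_, rfl⟩
  have hD0 : 0 < D := by linarith
  have hle : ∀ s, s ≤ D → D⁻¹ * s ≤ 1 := by
    intro s hs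
    rw [inv_mul_eq_div]
    exact (div_le_one hD0).2 hs
  have ha1 : D⁻¹ ≤ 1 := by simpa using hle 1 (by linarith)
  have ha2 := hle (lam * (8 * d + 32 * d ^ 2)) (by linarith)
  have ha3 := hle (lam * (8 * d * R ^ 2)) (by linarith)
  have ha0 : 0 < D⁻¹ := inv_pos.2 hD0
  refine ⟨D⁻¹, ha0, ha1, fun γ hγ ρ hρ => ?_⟩
  generalize D⁻¹ = a at ha0 ha1 ha2 ha3
  have hγ0 : γ ≠ 0 := by positivity
  have hinit : lam * meanZ γ ρ (lyap a) 0 ≤ C + log 2 + 1 := by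
    have h1 := mul_le_mul_of_nonneg_left
      (meanZ_lyap_zero_le ha0.le ha1 hγ hκc hκ01 hκR ρ) hlam0.le
    have h2 := hκent (ρ 0) hρ.ent
    linarith
  have hfr0 : ∀ t, 0 ≤ meanZ γ ρ (fricZ (lyap a)) t := fun t =>
    integral_nonneg fun x => fricZ_lyap_nonneg ha0.le _
  have main : ∀ t ∈ Icc 0 T, lam * meanZ γ ρ (lyap a) t
      + γ ^ 2 / m * (lam * ∫ s in (0 : ℝ)..t, meanZ γ ρ (fricZ (lyap a)) s) ≤ K := by
    intro t ht
    have h := hρ.lyap_increment hγ0 hC hT hA ha0.le ha1 hlam0 ha2 ht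
    linarith
  have hKm : K ≤ K * (1 + m) ∧ m * K ≤ K * (1 + m) := by
    have := mul_pos hK0 hm
    constructor <;> linarith
  constructor
  · intro t ht
    have h1 := main t ht
    have h2 : 0 ≤ ∫ s in (0 : ℝ)..t, meanZ γ ρ (fricZ (lyap a)) s :=
      intervalIntegral.integral_nonneg ht.1 fun s _ => hfr0 s
    have h3 : 0 ≤ γ ^ 2 / m * (lam * ∫ s in (0 : ℝ)..t, meanZ γ ρ (fricZ (lyap a)) s) := by
      positivity
    exact le_of_mul_le_mul_left (by linarith [hKm.1]) hlam0
  · have h1 := main T ⟨hT, le_rfl⟩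
    have h2 : 0 ≤ meanZ γ ρ (lyap a) T := integral_nonneg fun x => lyap_nonneg ha0.le _
    have h2' := mul_nonneg hlam0.le h2
    have h3 : γ ^ 2 / m * (lam * ∫ s in (0 : ℝ)..T, meanZ γ ρ (fricZ (lyap a)) s) ≤ K := by
      linarith
    have h4 : lam * (γ ^ 2 * ∫ s in (0 : ℝ)..T, meanZ γ ρ (fricZ (lyap a)) s) =
        m * (γ ^ 2 / m * (lam * ∫ s in (0 : ℝ)..T, meanZ γ ρ (fricZ (lyap a)) s)) := by
      field_simp
    have h5 := mul_le_mul_of_nonneg_left h3 hm.le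
    exact le_of_mul_le_mul_left (by linarith [hKm.2]) hlam0

end Lyapunov

section Cutoff

variable {d : ℕ}

lemma exists_decay_of_hasCompactSupport {Φ : Phase d → ℝ} (hc : ContDiff ℝ 2 Φ)
    (hs : HasCompactSupport Φ) : ∃ M, Decay M Φ := by
  obtain ⟨B, hB⟩ := (isCb2_of_hasCompactSupport hc hs).2
  have hd : Continuous (fderiv ℝ Φ) := hc.continuous_fderiv (by norm_num)
  have hs' : HasCompactSupport fun z => ‖fderiv ℝ Φ z‖ := (hs.fderiv (𝕜 := ℝ)).norm
  obtain ⟨M, hM⟩ := HasCompactSupport.exists_bound_of_continuous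
    (f := fun z => (1 + ‖z‖) * ‖fderiv ℝ Φ z‖) (hs'.mul_left (f := fun z => 1 + ‖z‖))
    (by fun_prop)
  refine ⟨max M B, hc, ⟨B, fun z => (hB z).1⟩, fun z => ?_,
    fun z => (hB z).2.2.trans (le_max_right _ _)⟩
  exact ((le_abs_self _).trans (hM z)).trans (le_max_left _ _)

/-- A smooth cutoff built from a Lyapunov function. -/
def cutZ (a : ℝ) (z : Phase d) : ℝ := smoothTransition (3 - 4 * lyap a z)

lemma cutZ_nonneg (a : ℝ) (z : Phase d) : 0 ≤ cutZ a z := smoothTransition.nonneg _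

lemma cutZ_le_one (a : ℝ) (z : Phase d) : cutZ a z ≤ 1 := smoothTransition.le_one _

lemma one_sub_cutZ_le {a : ℝ} (ha : 0 ≤ a) (z : Phase d) : 1 - cutZ a z ≤ 2 * lyap a z := by
  by_cases h : lyap a z ≤ 1 / 2
  · rw [cutZ, smoothTransition.one_of_one_le (by linarith)]
    linarith [lyap_nonneg ha z]
  · linarith [cutZ_nonneg a z]

lemma contDiff_cutZ (a : ℝ) : ContDiff ℝ 2 (cutZ a : Phase d → ℝ) :=
  smoothTransition.contDiff.comp (contDiff_const.sub (contDiff_const.mul (contDiff_lyap a)))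

lemma wtN_lt_of_lyap_lt {a c : ℝ} (ha : 0 < a) (hc : c < 1) {z : Phase d} (h : lyap a z < c) :
    wtN z < (1 - c) ^ (-a⁻¹) := by
  have h1 : 1 - c < wtN z ^ (-a) := by unfold lyap at h; linarith
  have h2 := Real.rpow_lt_rpow_of_neg (by linarith) h1 (neg_lt_zero.2 (inv_pos.2 ha))
  rwa [← Real.rpow_mul (wtN_pos z).le, neg_mul_neg, mul_inv_cancel₀ ha.ne', Real.rpow_one] at h2

lemma hasCompactSupport_cutZ {a : ℝ} (ha : 0 < a) :
    HasCompactSupport (cutZ a : Phase d → ℝ) := by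
  refine HasCompactSupport.intro
    (isCompact_closedBall (0 : Phase d) (1 + (1 - 3 / 4 : ℝ) ^ (-a⁻¹))) fun z hz => ?_
  by_contra h
  apply hz
  have h1 : lyap a z < 3 / 4 := by
    by_contra h2
    exact h (smoothTransition.zero_of_nonpos (by linarith))
  have h3 := wtN_lt_of_lyap_lt ha (by norm_num) h1
  have h4 := norm_sq_le_wtN z
  rw [mem_closedBall_zero_iff]
  nlinarith [norm_nonneg z]

lemma fderiv_cutZ (a : ℝ) (z : Phase d) :
    fderiv ℝ (cutZ a) z =
      (-4 * deriv smoothTransition (3 - 4 * lyap a z)) • fderiv ℝ (lyap a) z := by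
  have h1 := (((hasFDerivAt_lyap a z).differentiableAt.hasFDerivAt).const_mul 4).const_sub 3
  have h2 := (differentiable_smoothTransition (3 - 4 * lyap a z)).hasDerivAt.comp_hasFDerivAt z h1
  refine h2.fderiv.trans (ContinuousLinearMap.ext fun v => ?_)
  simp only [_root_.smul_apply, _root_.neg_apply, smul_eq_mul]
  ring

lemma fricZ_mul {f h : Phase d → ℝ} (hf : Differentiable ℝ f) (hh : Differentiable ℝ h)
    (z : Phase d) : fricZ (fun z => f z * h z) z = f z * fricZ h z + h z * fricZ f z := by
  unfold fricZ
  rw [fderiv_fun_mul (hf z) (hh z), Finset.mul_sum, Finset.mul_sum, ← Finset.sum_add_distrib]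
  refine Finset.sum_congr rfl fun i _ => ?_
  simp only [_root_.add_apply, _root_.smul_apply, smul_eq_mul]
  ring

lemma fderiv_comp_fst {g : (Fin d → ℝ) → ℝ} (hg : Differentiable ℝ g) (z u : Phase d) :
    fderiv ℝ (fun z : Phase d => g z.1) z u = fderiv ℝ g z.1 u.1 := by
  have h := (hg z.1).hasFDerivAt.comp z (hasFDerivAt_fst (p := z) (𝕜 := ℝ))
  exact DFunLike.congr_fun h.fderiv u

lemma fricZ_comp_fst {g : (Fin d → ℝ) → ℝ} (hg : Differentiable ℝ g) (z : Phase d) :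
    fricZ (fun z : Phase d => g z.1) z = 0 := by
  unfold fricZ
  simp [fderiv_comp_fst hg, dirP]

lemma fricZ_cutZ (a : ℝ) (z : Phase d) :
    fricZ (cutZ a) z = -4 * deriv smoothTransition (3 - 4 * lyap a z) * fricZ (lyap a) z := by
  unfold fricZ
  rw [fderiv_cutZ, Finset.mul_sum]
  refine Finset.sum_congr rfl fun i _ => ?_
  simp only [_root_.smul_apply, smul_eq_mul]
  ring

lemma exists_deriv_smoothTransition_bound : ∃ c, 0 ≤ c ∧ ∀ x, |deriv smoothTransition x| ≤ c := by
  obtain ⟨c, hc⟩ := (isCompact_Icc (a := (0 : ℝ)) (b := 1)).exists_bound_of_continuousOn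
    continuous_deriv_smoothTransition.continuousOn
  refine ⟨max c 0, le_max_right _ _, fun x => ?_⟩
  by_cases h0 : x ≤ 0
  · simp [deriv_smoothTransition_of_nonpos h0]
  · by_cases h1 : 1 ≤ x
    · simp [deriv_smoothTransition_of_one_le h1]
    · push Not at h0 h1
      exact (hc x ⟨h0.le, h1.le⟩).trans (le_max_left _ _)

/-- The localisation of a function of the first variable. -/
def locZ (a : ℝ) (g : (Fin d → ℝ) → ℝ) (z : Phase d) : ℝ := g z.1 * cutZ a z

lemma contDiff_locZ (a : ℝ) {g : (Fin d → ℝ) → ℝ} (hg : ContDiff ℝ 2 g) :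
    ContDiff ℝ 2 (locZ a g) :=
  (hg.comp contDiff_fst).mul (contDiff_cutZ a)

lemma hasCompactSupport_locZ {a : ℝ} (ha : 0 < a) (g : (Fin d → ℝ) → ℝ) :
    HasCompactSupport (locZ a g) :=
  HasCompactSupport.mul_left (f := fun z : Phase d => g z.1) (hasCompactSupport_cutZ ha)

lemma exists_decay_locZ {a : ℝ} (ha : 0 < a) {g : (Fin d → ℝ) → ℝ} (hg : ContDiff ℝ 2 g) :
    ∃ M, Decay M (locZ a g) :=
  exists_decay_of_hasCompactSupport (contDiff_locZ a hg) (hasCompactSupport_locZ ha g)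

lemma abs_locZ_le (a : ℝ) {g : (Fin d → ℝ) → ℝ} {B : ℝ} (hB : ∀ q, |g q| ≤ B) (z : Phase d) :
    |locZ a g z| ≤ B := by
  rw [locZ, abs_mul, abs_of_nonneg (cutZ_nonneg a z)]
  exact (mul_le_of_le_one_right (abs_nonneg _) (cutZ_le_one a z)).trans (hB _)

lemma abs_sub_locZ_le {a : ℝ} (ha : 0 ≤ a) {g : (Fin d → ℝ) → ℝ} {B : ℝ} (hB : ∀ q, |g q| ≤ B)
    (z : Phase d) : |g z.1 - locZ a g z| ≤ 2 * B * lyap a z := by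
  have h : g z.1 - locZ a g z = g z.1 * (1 - cutZ a z) := by rw [locZ]; ring
  rw [h, abs_mul, abs_of_nonneg (by linarith [cutZ_le_one a z] : 0 ≤ 1 - cutZ a z)]
  calc |g z.1| * (1 - cutZ a z) ≤ B * (2 * lyap a z) :=
        mul_le_mul (hB _) (one_sub_cutZ_le ha z) (by linarith [cutZ_le_one a z])
          ((abs_nonneg _).trans (hB z.1))
    _ = _ := by ring

lemma abs_fricZ_locZ_le {a : ℝ} (ha : 0 ≤ a) {g : (Fin d → ℝ) → ℝ} (hg : ContDiff ℝ 2 g)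
    {B c : ℝ} (hB : ∀ q, |g q| ≤ B) (hc : ∀ x, |deriv smoothTransition x| ≤ c) (z : Phase d) :
    |fricZ (locZ a g) z| ≤ 4 * c * B * fricZ (lyap a) z := by
  have hg1 : Differentiable ℝ g := hg.differentiable (by norm_num)
  have h : fricZ (locZ a g) z = g z.1 * fricZ (cutZ a) z + cutZ a z * 0 := by
    rw [← fricZ_comp_fst hg1 z]
    exact fricZ_mul (f := fun z : Phase d => g z.1) (by fun_prop)
      ((contDiff_cutZ a).differentiable (by norm_num)) z
  rw [h, mul_zero, add_zero, fricZ_cutZ, abs_mul, abs_mul, abs_mul, abs_neg,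
    abs_of_nonneg (fricZ_lyap_nonneg ha z), abs_of_nonneg (by norm_num : (0 : ℝ) ≤ 4)]
  have h0 := (abs_nonneg _).trans (hB z.1)
  have h1 := fricZ_lyap_nonneg ha z
  calc |g z.1| * (4 * |deriv smoothTransition (3 - 4 * lyap a z)| * fricZ (lyap a) z)
      ≤ B * (4 * c * fricZ (lyap a) z) := by
        gcongr
        · exact hB _
        · exact hc _
    _ = _ := by ring

end Cutoff

section Equicontinuity

variable {d : ℕ} {m γ T C A a : ℝ} {V ψ : (Fin d → ℝ) → ℝ} {ρ : ℝ → ProbabilityMeasure (Phase d)}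

lemma abs_meanZ_le_of_abs_le {f g : Phase d → ℝ} {Bg : ℝ} (hg : Continuous g)
    (hBg : ∀ z, |g z| ≤ Bg) (h : ∀ z, |f z| ≤ g z) (t : ℝ) :
    |meanZ γ ρ f t| ≤ meanZ γ ρ g t :=
  norm_integral_le_of_norm_le (f := fun x => f (Zmap γ x)) (μ := (ρ t : Measure (Phase d)))
    (integrable_of_continuous_of_bdd (h := fun x => g (Zmap γ x)) (by fun_prop)
      (fun x => hBg _) _) (Filter.Eventually.of_forall fun x => h _)

lemma meanZ_sub {f g : Phase d → ℝ} {Bf Bg : ℝ} (hf : Continuous f) (hg : Continuous g)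
    (hBf : ∀ z, |f z| ≤ Bf) (hBg : ∀ z, |g z| ≤ Bg) (t : ℝ) :
    meanZ γ ρ (fun z => f z - g z) t = meanZ γ ρ f t - meanZ γ ρ g t :=
  integral_sub (integrable_of_continuous_of_bdd (h := fun x => f (Zmap γ x)) (by fun_prop)
      (fun x => hBf _) _)
    (integrable_of_continuous_of_bdd (h := fun x => g (Zmap γ x)) (by fun_prop)
      (fun x => hBg _) _)

lemma abs_lyap_le_one (ha : 0 ≤ a) (z : Phase d) : |lyap a z| ≤ 1 := by
  rw [abs_of_nonneg (lyap_nonneg ha z)]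
  exact lyap_le_one a z

lemma abs_meanZ_sub_locZ_le (ha : 0 ≤ a) {g : (Fin d → ℝ) → ℝ} (hg : Continuous g) {B : ℝ}
    (hB : ∀ q, |g q| ≤ B) (t : ℝ) :
    |meanZ γ ρ (fun z => g z.1) t - meanZ γ ρ (locZ a g) t| ≤ 2 * B * meanZ γ ρ (lyap a) t := by
  have hc : Continuous (cutZ a : Phase d → ℝ) := (contDiff_cutZ a).continuous
  have hl : Continuous (lyap a : Phase d → ℝ) := (contDiff_lyap a (n := 0)).continuous
  have hcl : Continuous (locZ a g) := by unfold locZ; fun_prop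
  rw [← meanZ_sub (by fun_prop) hcl (fun z => hB _) (abs_locZ_le a hB), ← meanZ_const_mul]
  refine abs_meanZ_le_of_abs_le (Bg := 2 * B * 1) (by fun_prop) (fun z => ?_)
    (fun z => abs_sub_locZ_le ha hB z) t
  have := (abs_nonneg _).trans (hB 0)
  rw [abs_mul, abs_of_nonneg (by positivity : 0 ≤ 2 * B)]
  have := abs_lyap_le_one ha z
  gcongr

lemma GoodCurve.locZ_increment_le (hρ : GoodCurve d m γ T V ψ C ρ) (hγ : γ ≠ 0) (hm : 0 < m)
    (hC : 0 ≤ C) (hT : 0 ≤ T) (hA : ForceBound A V ψ) (ha : 0 < a) (ha1 : a ≤ 1)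
    {g : (Fin d → ℝ) → ℝ} (hg : ContDiff ℝ 2 g) {B c M α ε : ℝ} (hB : ∀ q, |g q| ≤ B)
    (hc : ∀ x, |deriv smoothTransition x| ≤ c) (hM : Decay M (locZ a g)) (hα : α ≠ 0)
    (hfr : γ ^ 2 * (∫ t in (0 : ℝ)..T, meanZ γ ρ (fricZ (lyap a)) t) ≤ ε)
    {s t : ℝ} (hs : 0 ≤ s) (hst : s ≤ t) (ht : t ≤ T) :
    α * (meanZ γ ρ (locZ a g) t - meanZ γ ρ (locZ a g) s) ≤
      C + (t - s) * (d * (4 * A + 1) * 2 * (|α| * M + (|α| * M) ^ 2))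
        + |α| * (4 * c * B / m * ε) := by
  have h := hρ.increment_le hγ hC hT hA (hM.const_mul α) hs hst ht
  simp only [meanZ_const_mul,
    show fricZ (fun z => α * locZ a g z) = fun z : Phase d => α * fricZ (locZ a g) z from
      funext fun z => fricZ_const_mul hM.differentiable α z,
    intervalIntegral.integral_const_mul] at h
  have hl := decay_lyap (d := d) ha.le ha1
  have hfc := continuousOn_meanZ (γ := γ) hl.continuous_fricZ hl.abs_fricZ_le hρ.cont
  have hsub : Icc s t ⊆ Icc 0 T := Icc_subset_Icc hs ht
  have hB0 := (abs_nonneg _).trans (hB 0)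
  have hc0 := (abs_nonneg _).trans (hc 0)
  have hfr0 : ∀ t, 0 ≤ meanZ γ ρ (fricZ (lyap a)) t := fun t =>
    integral_nonneg fun x => fricZ_lyap_nonneg ha.le _
  have h1 : |∫ t in s..t, meanZ γ ρ (fricZ (locZ a g)) t| ≤
      ∫ t in s..t, 4 * c * B * meanZ γ ρ (fricZ (lyap a)) t := by
    refine intervalIntegral.norm_integral_le_of_norm_le (μ := volume)
      (f := fun r => meanZ γ ρ (fricZ (locZ a g)) r) hst
      (Filter.Eventually.of_forall fun r _ => ?_)
      (ContinuousOn.intervalIntegrable_of_Icc hst ((hfc.mono hsub).const_mul _))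
    rw [← meanZ_const_mul]
    refine abs_meanZ_le_of_abs_le (Bg := 4 * c * B * (d * (a * (8 * d + 32 * d ^ 2)))) ?_
      (fun z => ?_) (fun z => abs_fricZ_locZ_le ha.le hg hB hc z) r
    · exact hl.continuous_fricZ.const_mul _
    · rw [abs_mul, abs_of_nonneg (by positivity : 0 ≤ 4 * c * B)]
      exact mul_le_mul_of_nonneg_left (hl.abs_fricZ_le z) (by positivity)
  rw [intervalIntegral.integral_const_mul] at h1
  have h2 : ∫ t in s..t, meanZ γ ρ (fricZ (lyap a)) t ≤
      ∫ t in (0 : ℝ)..T, meanZ γ ρ (fricZ (lyap a)) t :=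
    intervalIntegral.integral_mono_interval hs hst ht
      (Filter.Eventually.of_forall fun r => hfr0 r)
      (ContinuousOn.intervalIntegrable_of_Icc hT hfc)
  have h3 : -(γ ^ 2 / m * (α * ∫ t in s..t, meanZ γ ρ (fricZ (locZ a g)) t)) ≤
      |α| * (4 * c * B / m * ε) := by
    calc -(γ ^ 2 / m * (α * ∫ t in s..t, meanZ γ ρ (fricZ (locZ a g)) t))
        ≤ |γ ^ 2 / m * (α * ∫ t in s..t, meanZ γ ρ (fricZ (locZ a g)) t)| := neg_le_abs _
      _ = γ ^ 2 / m * (|α| * |∫ t in s..t, meanZ γ ρ (fricZ (locZ a g)) t|) := by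
        rw [abs_mul, abs_mul, abs_of_nonneg (by positivity : 0 ≤ γ ^ 2 / m)]
      _ ≤ γ ^ 2 / m * (|α| * (4 * c * B * ∫ t in (0 : ℝ)..T, meanZ γ ρ (fricZ (lyap a)) t)) := by
        have := h1.trans (mul_le_mul_of_nonneg_left h2 (by positivity : 0 ≤ 4 * c * B))
        gcongr
      _ = |α| * (4 * c * B / m * (γ ^ 2 * ∫ t in (0 : ℝ)..T, meanZ γ ρ (fricZ (lyap a)) t)) := by
        ring
      _ ≤ _ := by gcongr
  linarith

/-- Equicontinuity of the coarse-grained curves. -/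
lemma exists_equicontinuity (hyp : PotentialHyp d m V ψ) (hC : 0 ≤ C) (hT : 0 ≤ T)
    {g : (Fin d → ℝ) → ℝ} (hg : ContDiff ℝ 2 g) {B : ℝ} (hB : ∀ q, |g q| ≤ B) {ε : ℝ}
    (hε : 0 < ε) :
    ∃ δ > 0, ∀ γ ≥ 1, ∀ ρ : ℝ → ProbabilityMeasure (Phase d), GoodCurve d m γ T V ψ C ρ →
      ∀ s ∈ Icc 0 T, ∀ t ∈ Icc 0 T, |s - t| ≤ δ →
        |meanZ γ ρ (fun z => g z.1) s - meanZ γ ρ (fun z => g z.1) t| ≤ ε := by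
  obtain ⟨A, hA⟩ := hyp.exists_forceBound
  have hm := hyp.hm
  have hA0 := hA.1
  have hB0 := (abs_nonneg _).trans (hB 0)
  obtain ⟨c, hc0, hc⟩ := exists_deriv_smoothTransition_bound
  obtain ⟨K, hK⟩ : ∃ K, K = 4 * B + 4 * c * B / m + 1 := ⟨_, rfl⟩
  have hK0 : 0 < K := by rw [hK]; positivity
  obtain ⟨a, ha, ha1, hE⟩ := exists_lyap_le hyp hC hT (ε := ε / 3 / K) (by positivity)
  obtain ⟨M, hM⟩ := exists_decay_locZ ha hg
  have hM0 := hM.nonneg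
  obtain ⟨α, hα⟩ : ∃ α, α = 3 * (C + 1) / ε := ⟨_, rfl⟩
  have hα0 : 0 < α := by rw [hα]; positivity
  have hαC : C ≤ α * (ε / 3) := by
    rw [hα]; field_simp; linarith
  obtain ⟨D, hD⟩ : ∃ D, D = d * (4 * A + 1) * 2 * (α * M + (α * M) ^ 2) := ⟨_, rfl⟩
  have hD0 : 0 ≤ D := by rw [hD]; positivity
  refine ⟨α * (ε / 3) / (D + 1), by positivity, fun γ hγ ρ hρ => ?_⟩
  obtain ⟨hE1, hE2⟩ := hE γ hγ ρ hρ
  have hγ0 : γ ≠ 0 := by positivity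
  have key : ∀ s t, 0 ≤ s → s ≤ t → t ≤ T → t - s ≤ α * (ε / 3) / (D + 1) →
      |meanZ γ ρ (fun z => g z.1) t - meanZ γ ρ (fun z => g z.1) s| ≤ ε := by
    intro s t hs hst ht hδ
    have hloc : |meanZ γ ρ (locZ a g) t - meanZ γ ρ (locZ a g) s| ≤
        2 * (ε / 3) + 4 * c * B / m * (ε / 3 / K) := by
      have h1 := hρ.locZ_increment_le hγ0 hm hC hT hA ha ha1 hg hB hc hM hα0.ne' hE2 hs hst ht
      have h2 := hρ.locZ_increment_le hγ0 hm hC hT hA ha ha1 hg hB hc hM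
        (neg_ne_zero.2 hα0.ne') hE2 hs hst ht
      rw [abs_neg] at h2
      rw [abs_of_pos hα0, ← hD] at h1 h2
      have h3 : (t - s) * D ≤ α * (ε / 3) := by
        calc (t - s) * D ≤ (t - s) * (D + 1) := by
              apply mul_le_mul_of_nonneg_left <;> linarith
          _ ≤ α * (ε / 3) := (le_div_iff₀ (by positivity)).1 hδ
      refine abs_le.2 ⟨?_, ?_⟩
      · refine le_of_mul_le_mul_left ?_ hα0
        linarith
      · refine le_of_mul_le_mul_left ?_ hα0
        linarith
    have h1 := abs_meanZ_sub_locZ_le (γ := γ) (ρ := ρ) ha.le hg.continuous hB t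
    have h2 := abs_meanZ_sub_locZ_le (γ := γ) (ρ := ρ) ha.le hg.continuous hB s
    have h3 := mul_le_mul_of_nonneg_left (hE1 t ⟨hs.trans hst, ht⟩) (by positivity : 0 ≤ 2 * B)
    have h4 := mul_le_mul_of_nonneg_left (hE1 s ⟨hs, hst.trans ht⟩) (by positivity : 0 ≤ 2 * B)
    have h5 : (4 * B + 4 * c * B / m) * (ε / 3 / K) ≤ ε / 3 := by
      calc _ ≤ K * (ε / 3 / K) := by gcongr; linarith
        _ = ε / 3 := by field_simp
    rw [abs_le] at *
    constructor <;> linarith [h1.1, h1.2, h2.1, h2.2, hloc.1, hloc.2]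
  intro s hs t ht hst
  rcases le_total s t with h | h
  · rw [abs_sub_comm]
    exact key s t hs.1 h ht.2 (by rw [abs_sub_comm] at hst; exact (le_abs_self _).trans hst)
  · exact key t s ht.1 h hs.2 ((le_abs_self _).trans hst)

lemma sum_sq_snd_le (ha : 0 < a) {z : Phase d} (h : lyap a z < 1 / 2) :
    ∑ i, (z.2 i) ^ 2 ≤
      (2 * a * ((1 - 1 / 2 : ℝ) ^ (-a⁻¹)) ^ (-a - 1))⁻¹ * fricZ (lyap a) z := by
  have h1 := wtN_lt_of_lyap_lt ha (by norm_num) h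
  have h2 : ((1 - 1 / 2 : ℝ) ^ (-a⁻¹)) ^ (-a - 1) ≤ wtN z ^ (-a - 1) :=
    Real.rpow_le_rpow_of_nonpos (wtN_pos z) h1.le (by linarith)
  have h3 : 0 < ((1 - 1 / 2 : ℝ) ^ (-a⁻¹)) ^ (-a - 1) :=
    Real.rpow_pos_of_pos (Real.rpow_pos_of_pos (by norm_num) _) _
  have h4 : 0 ≤ ∑ i, (z.2 i) ^ 2 := Finset.sum_nonneg fun i _ => sq_nonneg _
  rw [fricZ_lyap, inv_mul_eq_div, le_div_iff₀ (by positivity), mul_comm]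
  gcongr

lemma norm_snd_sq_le (z : Phase d) : ‖z.2‖ ^ 2 ≤ ∑ i, (z.2 i) ^ 2 := by
  have h0 : 0 ≤ ∑ i, (z.2 i) ^ 2 := Finset.sum_nonneg fun i _ => sq_nonneg _
  have h : ‖z.2‖ ≤ √(∑ i, (z.2 i) ^ 2) := by
    refine (pi_norm_le_iff_of_nonneg (Real.sqrt_nonneg _)).2 fun i => ?_
    refine Real.le_sqrt_of_sq_le ?_
    rw [Real.norm_eq_abs, sq_abs]
    exact Finset.single_le_sum (f := fun i => (z.2 i) ^ 2) (fun i _ => sq_nonneg _)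
      (Finset.mem_univ i)
  calc ‖z.2‖ ^ 2 ≤ √(∑ i, (z.2 i) ^ 2) ^ 2 := by gcongr
    _ = _ := Real.sq_sqrt h0

/-- Uniform control of the momentum on average in time. -/
lemma exists_momentum_le (hyp : PotentialHyp d m V ψ) (hC : 0 ≤ C) (hT : 0 ≤ T) {ε : ℝ}
    (hε : 0 < ε) :
    ∃ δ > 0, ∀ γ ≥ 1, ∀ ρ : ℝ → ProbabilityMeasure (Phase d), GoodCurve d m γ T V ψ C ρ →
      ∫ t in (0 : ℝ)..T, (∫ x, min 1 (δ * ‖x.2‖) ∂(ρ t : Measure (Phase d))) ≤ ε := by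
  obtain ⟨e, he⟩ : ∃ e, e = ε / (3 * T + 1) := ⟨_, rfl⟩
  have he0 : 0 < e := by rw [he]; positivity
  have heε : e * (3 * T + 1) = ε := by rw [he]; field_simp
  obtain ⟨a, ha, ha1, hE⟩ := exists_lyap_le hyp hC hT (ε := e) he0
  obtain ⟨c, hc⟩ : ∃ c, c = (2 * a * ((1 - 1 / 2 : ℝ) ^ (-a⁻¹)) ^ (-a - 1))⁻¹ := ⟨_, rfl⟩
  have hc0 : 0 < c := by
    have h3 : 0 < ((1 - 1 / 2 : ℝ) ^ (-a⁻¹)) ^ (-a - 1) :=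
      Real.rpow_pos_of_pos (Real.rpow_pos_of_pos (by norm_num) _) _
    rw [hc]; positivity
  obtain ⟨δ, hδ⟩ : ∃ δ, δ = √(e / c) := ⟨_, rfl⟩
  have hδ0 : 0 < δ := by rw [hδ]; exact Real.sqrt_pos.2 (by positivity)
  have hδ2 : δ ^ 2 * c = e := by
    rw [hδ, Real.sq_sqrt (by positivity)]; field_simp
  refine ⟨δ, hδ0, fun γ hγ ρ hρ => ?_⟩
  obtain ⟨hE1, hE2⟩ := hE γ hγ ρ hρ
  have hl := decay_lyap (d := d) ha.le ha1
  have hγ0 : 0 < γ := by positivity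
  have hpt : ∀ x : Phase d, min 1 (δ * ‖x.2‖) ≤
      2 * lyap a (Zmap γ x) + (e + γ ^ 2 * fricZ (lyap a) (Zmap γ x)) := by
    intro x
    have hfr := fricZ_lyap_nonneg ha.le (Zmap γ x)
    by_cases h : lyap a (Zmap γ x) < 1 / 2
    · have h1 := (norm_snd_sq_le _).trans (sum_sq_snd_le ha h)
      rw [← hc, Zmap_snd, norm_smul, Real.norm_eq_abs, abs_of_pos (inv_pos.2 hγ0), mul_pow] at h1
      have h2 : ‖x.2‖ ^ 2 ≤ γ ^ 2 * (c * fricZ (lyap a) (Zmap γ x)) := by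
        calc ‖x.2‖ ^ 2 = γ ^ 2 * (γ⁻¹ ^ 2 * ‖x.2‖ ^ 2) := by field_simp
          _ ≤ _ := by gcongr
      have h3 : (δ * ‖x.2‖) ^ 2 ≤ e * (γ ^ 2 * fricZ (lyap a) (Zmap γ x)) := by
        calc (δ * ‖x.2‖) ^ 2 = δ ^ 2 * ‖x.2‖ ^ 2 := by ring
          _ ≤ δ ^ 2 * (γ ^ 2 * (c * fricZ (lyap a) (Zmap γ x))) := by gcongr
          _ = (δ ^ 2 * c) * (γ ^ 2 * fricZ (lyap a) (Zmap γ x)) := by ring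
          _ = _ := by rw [hδ2]
      have h4 := lyap_nonneg ha.le (Zmap γ x)
      have h5 : 0 ≤ γ ^ 2 * fricZ (lyap a) (Zmap γ x) := by positivity
      have h6 : δ * ‖x.2‖ ≤ e + γ ^ 2 * fricZ (lyap a) (Zmap γ x) := by
        refine abs_le_of_sq_le_sq' ?_ (by positivity) |>.2
        nlinarith
      exact (min_le_right _ _).trans (by linarith)
    · have : 0 ≤ γ ^ 2 * fricZ (lyap a) (Zmap γ x) := by positivity
      exact (min_le_left _ _).trans (by linarith)
  have hmb : ∀ x : Phase d, |min 1 (δ * ‖x.2‖)| ≤ 1 := fun x => by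
    rw [abs_of_nonneg (by positivity)]; exact min_le_left _ _
  have hmc : Continuous fun x : Phase d => min 1 (δ * ‖x.2‖) := by fun_prop
  have hlc := continuousOn_meanZ (γ := γ) hl.smooth.continuous (abs_lyap_le_one ha.le) hρ.cont
  have hfc := continuousOn_meanZ (γ := γ) hl.continuous_fricZ hl.abs_fricZ_le hρ.cont
  have i1 := ContinuousOn.intervalIntegrable_of_Icc (μ := volume) hT hlc
  have i2 := ContinuousOn.intervalIntegrable_of_Icc (μ := volume) hT hfc
  have hmain : ∀ t, (∫ x, min 1 (δ * ‖x.2‖) ∂(ρ t : Measure (Phase d))) ≤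
      2 * meanZ γ ρ (lyap a) t + (e + γ ^ 2 * meanZ γ ρ (fricZ (lyap a)) t) := by
    intro t
    have j1 : Integrable (fun x => lyap a (Zmap γ x)) (ρ t : Measure (Phase d)) :=
      integrable_of_continuous_of_bdd (hl.smooth.continuous.comp (Zmap γ).continuous)
        (fun x => abs_lyap_le_one ha.le _) _
    have j2 : Integrable (fun x => fricZ (lyap a) (Zmap γ x)) (ρ t : Measure (Phase d)) :=
      integrable_of_continuous_of_bdd (hl.continuous_fricZ.comp (Zmap γ).continuous)
        (fun x => hl.abs_fricZ_le _) _
    refine (integral_mono (integrable_of_continuous_of_bdd hmc hmb _)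
      ((j1.const_mul 2).add ((integrable_const e).add (j2.const_mul _))) hpt).trans (le_of_eq ?_)
    rw [integral_add' (j1.const_mul 2) ((integrable_const e).add (j2.const_mul _)),
      integral_add' (integrable_const e) (j2.const_mul _)]
    simp [integral_const_mul, meanZ]
  have hsum := intervalIntegral.integral_mono_on (μ := volume) hT
    (ContinuousOn.intervalIntegrable_of_Icc hT
      ((continuous_integral_probabilityMeasure hmc hmb).comp_continuousOn hρ.cont))
    ((i1.const_mul 2).add ((intervalIntegrable_const (c := e)).add (i2.const_mul (γ ^ 2))))
    (fun t _ => hmain t)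
  rw [intervalIntegral.integral_add (i1.const_mul 2)
      ((intervalIntegrable_const (c := e)).add (i2.const_mul (γ ^ 2))),
    intervalIntegral.integral_add (intervalIntegrable_const (c := e)) (i2.const_mul (γ ^ 2)),
    intervalIntegral.integral_const_mul, intervalIntegral.integral_const_mul,
    intervalIntegral.integral_const] at hsum
  have hlT : ∫ t in (0 : ℝ)..T, meanZ γ ρ (lyap a) t ≤ ∫ t in (0 : ℝ)..T, e :=
    intervalIntegral.integral_mono_on hT i1 intervalIntegrable_const hE1
  rw [intervalIntegral.integral_const] at hlT
  simp only [smul_eq_mul, sub_zero] at hsum hlT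
  simp only [Function.comp_def] at hsum
  linarith

end Equicontinuity

section Corrector

variable {d : ℕ}

lemma laplZ_mul {f h : Phase d → ℝ} (hf : ContDiff ℝ 2 f) (hh : ContDiff ℝ 2 h) (z : Phase d) :
    laplZ (fun z => f z * h z) z = f z * laplZ h z + h z * laplZ f z
      + 2 * ∑ i, fderiv ℝ f z (dirD i) * fderiv ℝ h z (dirD i) := by
  have hf1 : Differentiable ℝ f := hf.differentiable (by norm_num)
  have hh1 : Differentiable ℝ h := hh.differentiable (by norm_num)
  have hf2 : Differentiable ℝ (fderiv ℝ f) :=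
    (hf.fderiv_right (m := 1) (by norm_num)).differentiable (by norm_num)
  have hh2 : Differentiable ℝ (fderiv ℝ h) :=
    (hh.fderiv_right (m := 1) (by norm_num)).differentiable (by norm_num)
  have e1 : fderiv ℝ (fun z => f z * h z) = fun z => f z • fderiv ℝ h z + h z • fderiv ℝ f z :=
    funext fun z => fderiv_fun_mul (hf1 z) (hh1 z)
  have e2 := ((hf1 z).hasFDerivAt.smul (hh2 z).hasFDerivAt).add
    ((hh1 z).hasFDerivAt.smul (hf2 z).hasFDerivAt)
  have e3 : ∀ u : Phase d, secD (fun z => f z * h z) z u u =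
      f z * secD h z u u + h z * secD f z u u + 2 * (fderiv ℝ f z u * fderiv ℝ h z u) := by
    intro u
    unfold secD
    rw [e1]
    refine (DFunLike.congr_fun (DFunLike.congr_fun e2.fderiv u) u).trans ?_
    simp only [_root_.add_apply, _root_.smul_apply, ContinuousLinearMap.smulRight_apply,
      smul_eq_mul]
    ring
  unfold laplZ
  simp only [e3, Finset.sum_add_distrib, Finset.mul_sum]

/-- The linear functional `(q, p) ↦ l · p`. -/
def dotP (l : Fin d → ℝ) : Phase d →L[ℝ] ℝ :=
  ∑ i, l i • (ContinuousLinearMap.proj i).comp (ContinuousLinearMap.snd ℝ (Fin d → ℝ) (Fin d → ℝ))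

lemma dotP_apply (l : Fin d → ℝ) (x : Phase d) : dotP l x = ∑ i, l i * x.2 i := by
  simp [dotP]

lemma dotP_dirD (l : Fin d → ℝ) (i : Fin d) : dotP l (dirD i) = l i := by
  simp [dotP_apply, dirD, dirP, dirQ, Pi.single_apply]

lemma dotP_Zmap {γ : ℝ} (hγ : γ ≠ 0) (l : Fin d → ℝ) (x : Phase d) :
    γ * dotP l (Zmap γ x) = dotP l x := by
  simp only [dotP_apply, Zmap_snd, Finset.mul_sum, Pi.smul_apply, smul_eq_mul]
  refine Finset.sum_congr rfl fun i _ => ?_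
  field_simp

lemma abs_dotP_le (l : Fin d → ℝ) (x : Phase d) : |dotP l x| ≤ (∑ i, |l i|) * ‖x.2‖ := by
  rw [dotP_apply, Finset.sum_mul]
  refine (Finset.abs_sum_le_sum_abs _ _).trans (Finset.sum_le_sum fun i _ => ?_)
  rw [abs_mul]
  exact mul_le_mul_of_nonneg_left (norm_le_pi_norm x.2 i) (abs_nonneg _)

/-- A profile of the fast momentum variable in rescaled coordinates. -/
def fastZ (γ : ℝ) (l : Fin d → ℝ) (v : ℝ → ℝ) (z : Phase d) : ℝ := v (γ * dotP l z)

variable {γ : ℝ} {l : Fin d → ℝ} {v v' v'' : ℝ → ℝ}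

lemma hasFDerivAt_fastZ (h1 : ∀ y, HasDerivAt v (v' y) y) (z : Phase d) :
    HasFDerivAt (fastZ γ l v) ((v' (γ * dotP l z)) • (γ • dotP l)) z :=
  (h1 (γ * dotP l z)).comp_hasFDerivAt z ((dotP l).hasFDerivAt.const_mul γ)

lemma fderiv_fastZ (h1 : ∀ y, HasDerivAt v (v' y) y) :
    fderiv ℝ (fastZ γ l v) = fun z => (v' (γ * dotP l z)) • (γ • dotP l) :=
  funext fun z => (hasFDerivAt_fastZ h1 z).fderiv

lemma contDiff_fastZ (h1 : ∀ y, HasDerivAt v (v' y) y) (h2 : ∀ y, HasDerivAt v' (v'' y) y)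
    (h3 : Continuous v'') : ContDiff ℝ 2 (fastZ γ l v) :=
  (contDiff_two_of_hasDerivAt h1 h2 h3).comp (contDiff_const.mul (dotP l).contDiff)

lemma fricZ_fastZ (h1 : ∀ y, HasDerivAt v (v' y) y) (z : Phase d) :
    fricZ (fastZ γ l v) z = (γ * dotP l z) * v' (γ * dotP l z) := by
  unfold fricZ
  rw [fderiv_fastZ h1]
  have h : ∀ i, dotP l (dirP i) = l i := fun i => by
    simp [dotP_apply, dirP, Pi.single_apply]
  simp only [_root_.smul_apply, smul_eq_mul, h]
  rw [dotP_apply, Finset.mul_sum, Finset.sum_mul]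
  refine Finset.sum_congr rfl fun i _ => ?_
  ring

lemma laplZ_fastZ (h1 : ∀ y, HasDerivAt v (v' y) y) (h2 : ∀ y, HasDerivAt v' (v'' y) y)
    (z : Phase d) :
    laplZ (fastZ γ l v) z = γ ^ 2 * (∑ i, l i ^ 2) * v'' (γ * dotP l z) := by
  unfold laplZ secD
  rw [fderiv_fastZ h1]
  have e := (hasFDerivAt_fastZ (γ := γ) (l := l) h2 z).smul_const (γ • dotP l)
  have e' : ∀ u : Phase d, fderiv ℝ (fun z => (v' (γ * dotP l z)) • (γ • dotP l)) z u u =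
      v'' (γ * dotP l z) * (γ * dotP l u) * (γ * dotP l u) := fun u => by
    refine (DFunLike.congr_fun (DFunLike.congr_fun e.fderiv u) u).trans ?_
    simp only [_root_.smul_apply, ContinuousLinearMap.smulRight_apply, smul_eq_mul]
  simp only [e', dotP_dirD, Finset.mul_sum, Finset.sum_mul]
  refine Finset.sum_congr rfl fun i _ => ?_
  ring

lemma genZ_mul_fastZ {m : ℝ} {V ψ : (Fin d → ℝ) → ℝ} (hγ : γ ≠ 0)
    (ν : Measure (Phase d)) {G : Phase d → ℝ} (hG : ContDiff ℝ 2 G)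
    (h1 : ∀ y, HasDerivAt v (v' y) y) (h2 : ∀ y, HasDerivAt v' (v'' y) y) (h3 : Continuous v'')
    (x : Phase d) :
    genZ m γ V ψ ν (fun z => G z * fastZ γ l v z) x =
      γ ^ 2 * (G (Zmap γ x) * ((∑ i, l i ^ 2) * v'' (dotP l x) - dotP l x / m * v' (dotP l x)))
      + γ * v' (dotP l x) * (-(∑ i, l i * (forceZ V ψ ν x.1 i * G (Zmap γ x)))
          + 2 * ∑ i, l i * fderiv ℝ G (Zmap γ x) (dirD i))
      + v (dotP l x) * (slowZ γ V ψ ν G x - γ ^ 2 / m * fricZ G (Zmap γ x)) := by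
  have hG1 : Differentiable ℝ G := hG.differentiable (by norm_num)
  have hW := contDiff_fastZ (γ := γ) (l := l) h1 h2 h3
  have hW1 : Differentiable ℝ (fastZ γ l v) := hW.differentiable (by norm_num)
  have e1 : ∀ i : Fin d, fderiv ℝ (fun z => G z * fastZ γ l v z) (Zmap γ x) (dirD i) =
      G (Zmap γ x) * (v' (dotP l x) * (γ * l i))
        + v (dotP l x) * fderiv ℝ G (Zmap γ x) (dirD i) := by
    intro i
    rw [fderiv_fun_mul (hG1 _) (hW1 _), fderiv_fastZ h1]
    simp only [_root_.add_apply, _root_.smul_apply, smul_eq_mul, dotP_dirD,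
      dotP_Zmap hγ, fastZ]
  have e2 : ∀ i : Fin d, fderiv ℝ (fastZ γ l v) (Zmap γ x) (dirD i) =
      v' (dotP l x) * (γ * l i) := by
    intro i
    rw [fderiv_fastZ h1]
    simp only [_root_.smul_apply, smul_eq_mul, dotP_dirD, dotP_Zmap hγ]
  unfold genZ slowZ
  rw [laplZ_mul hG hW, fricZ_mul hG1 hW1, laplZ_fastZ h1 h2, fricZ_fastZ h1]
  simp only [e1, e2]
  simp only [fastZ, dotP_Zmap hγ]
  have s1 : ∑ i, forceZ V ψ ν x.1 i * (G (Zmap γ x) * (v' (dotP l x) * (γ * l i))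
        + v (dotP l x) * fderiv ℝ G (Zmap γ x) (dirD i)) =
      γ * v' (dotP l x) * (∑ i, l i * (forceZ V ψ ν x.1 i * G (Zmap γ x)))
        + v (dotP l x) * ∑ i, forceZ V ψ ν x.1 i * fderiv ℝ G (Zmap γ x) (dirD i) := by
    simp only [Finset.mul_sum, ← Finset.sum_add_distrib]
    exact Finset.sum_congr rfl fun i _ => by ring
  have s2 : ∑ i, fderiv ℝ G (Zmap γ x) (dirD i) * (v' (dotP l x) * (γ * l i)) =
      γ * v' (dotP l x) * ∑ i, l i * fderiv ℝ G (Zmap γ x) (dirD i) := by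
    simp only [Finset.mul_sum]
    exact Finset.sum_congr rfl fun i _ => by ring
  rw [s1, s2]
  ring

lemma carreZ_mul_fastZ_le (hγ : γ ≠ 0) {G : Phase d → ℝ} (hG : ContDiff ℝ 2 G)
    (h1 : ∀ y, HasDerivAt v (v' y) y) (h2 : ∀ y, HasDerivAt v' (v'' y) y) (h3 : Continuous v'')
    {B K M : ℝ} (hB : ∀ z, |G z| ≤ B) (hK : ∀ y, |v y| ≤ K) (hK' : ∀ y, |v' y| ≤ K)
    (hM : ∀ z, ‖fderiv ℝ G z‖ ≤ M) (x : Phase d) :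
    carreZ (fun z => G z * fastZ γ l v z) (Zmap γ x) ≤
      2 * γ ^ 2 * (B * K) ^ 2 * (∑ i, l i ^ 2) + 2 * d * (K * M) ^ 2 := by
  have hG1 : Differentiable ℝ G := hG.differentiable (by norm_num)
  have hW1 : Differentiable ℝ (fastZ γ l v) :=
    (contDiff_fastZ (γ := γ) (l := l) h1 h2 h3).differentiable (by norm_num)
  have hB0 := (abs_nonneg _).trans (hB 0)
  have hK0 := (abs_nonneg _).trans (hK 0)
  have e1 : ∀ i : Fin d, (fderiv ℝ (fun z => G z * fastZ γ l v z) (Zmap γ x) (dirD i)) ^ 2 ≤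
      2 * γ ^ 2 * (B * K) ^ 2 * l i ^ 2 + 2 * (K * M) ^ 2 := by
    intro i
    rw [fderiv_fun_mul (hG1 _) (hW1 _), fderiv_fastZ h1]
    simp only [_root_.add_apply, _root_.smul_apply, smul_eq_mul, dotP_dirD,
      dotP_Zmap hγ, fastZ]
    have p1 : (G (Zmap γ x) * v' (dotP l x)) ^ 2 ≤ (B * K) ^ 2 := by
      rw [← sq_abs, abs_mul]
      have := hB (Zmap γ x)
      have := hK' (dotP l x)
      gcongr
    have p2 : (v (dotP l x) * fderiv ℝ G (Zmap γ x) (dirD i)) ^ 2 ≤ (K * M) ^ 2 := by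
      rw [← sq_abs, abs_mul]
      have := hK (dotP l x)
      have := (abs_clm_apply_le (fderiv ℝ G (Zmap γ x)) (norm_dirD_le i)).trans (hM _)
      gcongr
    have p3 : (γ * l i) ^ 2 * (G (Zmap γ x) * v' (dotP l x)) ^ 2 ≤ (γ * l i) ^ 2 * (B * K) ^ 2 :=
      mul_le_mul_of_nonneg_left p1 (sq_nonneg _)
    have p4 := sq_nonneg (G (Zmap γ x) * (v' (dotP l x) * (γ * l i))
      - v (dotP l x) * fderiv ℝ G (Zmap γ x) (dirD i))
    nlinarith
  unfold carreZ
  refine (Finset.sum_le_sum fun i _ => e1 i).trans (le_of_eq ?_)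
  rw [Finset.sum_add_distrib, ← Finset.mul_sum]
  simp
  ring

end Corrector

section Averaging

variable {d : ℕ}

/-- A bounded solution `v` of the Ornstein–Uhlenbeck Poisson equation with right-hand side `u`. -/
structure Profile (m L K : ℝ) (v v' v'' u : ℝ → ℝ) : Prop where
  deriv_fst : ∀ y, HasDerivAt v (v' y) y
  deriv_snd : ∀ y, HasDerivAt v' (v'' y) y
  cont : Continuous v''
  bdd : ∀ y, |v y| ≤ K
  bdd' : ∀ y, |v' y| ≤ K
  bdd_rhs : ∀ y, |u y| ≤ K
  eqn : ∀ y, L * v'' y - y / m * v' y = u y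

namespace Profile

variable {m L K : ℝ} {v v' v'' u : ℝ → ℝ}

lemma nonneg (h : Profile m L K v v' v'' u) : 0 ≤ K := (abs_nonneg _).trans (h.bdd 0)

lemma neg (h : Profile m L K v v' v'' u) :
    Profile m L K (fun y => -v y) (fun y => -v' y) (fun y => -v'' y) (fun y => -u y) where
  deriv_fst y := (h.deriv_fst y).neg
  deriv_snd y := (h.deriv_snd y).neg
  cont := h.cont.neg
  bdd y := by rw [abs_neg]; exact h.bdd y
  bdd' y := by rw [abs_neg]; exact h.bdd' y
  bdd_rhs y := by rw [abs_neg]; exact h.bdd_rhs y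
  eqn y := by rw [← h.eqn]; ring

lemma continuous_snd (h : Profile m L K v v' v'' u) : Continuous v' :=
  continuous_iff_continuousAt.2 fun y => (h.deriv_snd y).continuousAt

lemma continuous_rhs (h : Profile m L K v v' v'' u) : Continuous u := by
  have e : u = fun y => L * v'' y - y / m * v' y := funext fun y => (h.eqn y).symm
  have h1 := h.cont
  have h2 := h.continuous_snd
  rw [e]
  fun_prop

end Profile

lemma exists_weight_mul_le {G : Phase d → ℝ} (hc : Continuous G) (hs : HasCompactSupport G) :
    ∃ B, ∀ z, (1 + ‖z‖) * |G z| ≤ B := by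
  obtain ⟨B, hB⟩ := (HasCompactSupport.mul_left (f := fun z : Phase d => 1 + ‖z‖)
    hs).exists_bound_of_continuous (by fun_prop)
  refine ⟨B, fun z => ?_⟩
  have := hB z
  rwa [Pi.mul_apply, norm_mul, Real.norm_eq_abs, Real.norm_eq_abs, abs_of_nonneg (by positivity)] at this

variable {m γ T C A a L K : ℝ} {V ψ : (Fin d → ℝ) → ℝ} {ρ : ℝ → ProbabilityMeasure (Phase d)}
  {v v' v'' u : ℝ → ℝ} {l : Fin d → ℝ}

lemma abs_genZ_mul_fastZ_sub_le (hγ : 1 ≤ γ) (hm : 0 < m) (hA : ForceBound A V ψ)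
    (ν : Measure (Phase d)) [IsProbabilityMeasure ν] (ha : 0 ≤ a)
    {g : (Fin d → ℝ) → ℝ} (hg : ContDiff ℝ 2 g) {B B' c M : ℝ} (hB : ∀ q, |g q| ≤ B)
    (hB' : ∀ z, (1 + ‖z‖) * |locZ a g z| ≤ B')
    (hc : ∀ x, |deriv smoothTransition x| ≤ c) (hM : Decay M (locZ a g))
    (h : Profile m (∑ i, l i ^ 2) K v v' v'' u) (x : Phase d) :
    |genZ m γ V ψ ν (fun z => locZ a g z * fastZ γ l (fun y => γ⁻¹ * v y) z) x
      - γ * (locZ a g (Zmap γ x) * u (dotP l x))| ≤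
      K * ((∑ i, |l i|) * (4 * A * B' + 2 * M)) + K * (d * (4 * A + 1) * (2 * M))
        + K * (4 * c * B) / m * (γ * fricZ (lyap a) (Zmap γ x)) := by
  have hγ0 : γ ≠ 0 := by linarith
  have hγp : 0 < γ := by linarith
  have hK := h.nonneg
  rw [genZ_mul_fastZ (v' := fun y => γ⁻¹ * v' y) (v'' := fun y => γ⁻¹ * v'' y) hγ0 ν
    (contDiff_locZ a hg) (fun y => (h.deriv_fst y).const_mul _)
    (fun y => (h.deriv_snd y).const_mul _) (continuous_const.mul h.cont) x, ← h.eqn]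
  obtain ⟨S, hS⟩ : ∃ S, S = -(∑ i, l i * (forceZ V ψ ν x.1 i * locZ a g (Zmap γ x)))
      + 2 * ∑ i, l i * fderiv ℝ (locZ a g) (Zmap γ x) (dirD i) := ⟨_, rfl⟩
  obtain ⟨R, hR⟩ : ∃ R, R = slowZ γ V ψ ν (locZ a g) x := ⟨_, rfl⟩
  obtain ⟨f, hf⟩ : ∃ f, f = fricZ (locZ a g) (Zmap γ x) := ⟨_, rfl⟩
  rw [← hS, ← hR, ← hf]
  have e : γ ^ 2 * (locZ a g (Zmap γ x) * ((∑ i, l i ^ 2) * (γ⁻¹ * v'' (dotP l x))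
        - dotP l x / m * (γ⁻¹ * v' (dotP l x))))
      + γ * (γ⁻¹ * v' (dotP l x)) * S + γ⁻¹ * v (dotP l x) * (R - γ ^ 2 / m * f)
      - γ * (locZ a g (Zmap γ x) * ((∑ i, l i ^ 2) * v'' (dotP l x)
        - dotP l x / m * v' (dotP l x))) =
      v' (dotP l x) * S + γ⁻¹ * v (dotP l x) * R - v (dotP l x) * (γ / m * f) := by
    field_simp
    ring
  rw [e]
  have hSb : |S| ≤ (∑ i, |l i|) * (4 * A * B' + 2 * M) := by
    have t1 : ∀ i ∈ (Finset.univ : Finset (Fin d)),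
        |l i * (forceZ V ψ ν x.1 i * locZ a g (Zmap γ x))| ≤ |l i| * (4 * A * B') := by
      intro i _
      rw [abs_mul, abs_mul]
      refine mul_le_mul_of_nonneg_left ?_ (abs_nonneg _)
      have h0 := hA.1
      calc |forceZ V ψ ν x.1 i| * |locZ a g (Zmap γ x)|
          ≤ (2 * A * (2 * (1 + ‖Zmap γ x‖))) * |locZ a g (Zmap γ x)| := by
            refine mul_le_mul_of_nonneg_right ((hA.abs_forceZ_le ν x.1 i).trans ?_) (abs_nonneg _)
            have := norm_fst_le_Zmap γ x
            gcongr
            linarith [norm_nonneg (Zmap γ x)]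
        _ = 4 * A * ((1 + ‖Zmap γ x‖) * |locZ a g (Zmap γ x)|) := by ring
        _ ≤ 4 * A * B' := mul_le_mul_of_nonneg_left (hB' _) (by linarith)
    have t2 : ∀ i ∈ (Finset.univ : Finset (Fin d)),
        |l i * fderiv ℝ (locZ a g) (Zmap γ x) (dirD i)| ≤ |l i| * M := by
      intro i _
      rw [abs_mul]
      exact mul_le_mul_of_nonneg_left ((abs_clm_apply_le _ (norm_dirD_le i)).trans
        (hM.norm_fderiv_le _)) (abs_nonneg _)
    have t3 := (Finset.abs_sum_le_sum_abs _ _).trans (Finset.sum_le_sum t1)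
    have t4 := (Finset.abs_sum_le_sum_abs _ _).trans (Finset.sum_le_sum t2)
    rw [← Finset.sum_mul] at t3 t4
    rw [hS]
    rw [abs_le] at t3 t4 ⊢
    constructor <;> nlinarith
  have hRb : |R| ≤ d * (4 * A + 1) * (2 * M) := hR ▸ hM.abs_slowZ_le hA ν x
  have hfb : |f| ≤ 4 * c * B * fricZ (lyap a) (Zmap γ x) :=
    hf ▸ abs_fricZ_locZ_le ha hg hB hc _
  have b1 : |v' (dotP l x) * S| ≤ K * ((∑ i, |l i|) * (4 * A * B' + 2 * M)) := by
    rw [abs_mul]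
    exact mul_le_mul (h.bdd' _) hSb (abs_nonneg _) hK
  have b2 : |γ⁻¹ * v (dotP l x) * R| ≤ K * (d * (4 * A + 1) * (2 * M)) := by
    rw [abs_mul, abs_mul, abs_of_pos (inv_pos.2 hγp)]
    refine mul_le_mul ?_ hRb (abs_nonneg _) hK
    calc γ⁻¹ * |v (dotP l x)| ≤ 1 * K :=
          mul_le_mul (inv_le_one_of_one_le₀ hγ) (h.bdd _) (abs_nonneg _) zero_le_one
      _ = K := one_mul K
  have b3 : |v (dotP l x) * (γ / m * f)| ≤
      K * (4 * c * B) / m * (γ * fricZ (lyap a) (Zmap γ x)) := by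
    rw [abs_mul, abs_mul, abs_of_pos (div_pos hγp hm)]
    calc |v (dotP l x)| * (γ / m * |f|)
        ≤ K * (γ / m * (4 * c * B * fricZ (lyap a) (Zmap γ x))) := by
          have := h.bdd (dotP l x)
          gcongr
      _ = _ := by ring
  calc |v' (dotP l x) * S + γ⁻¹ * v (dotP l x) * R - v (dotP l x) * (γ / m * f)|
      ≤ |v' (dotP l x) * S| + |γ⁻¹ * v (dotP l x) * R| + |v (dotP l x) * (γ / m * f)| :=
        (abs_sub _ _).trans (add_le_add_left (abs_add_le _ _) _)
    _ ≤ _ := by linarith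

/-- Average of an observable and a function of the fast momentum. -/
def meanFast (γ : ℝ) (ρ : ℝ → ProbabilityMeasure (Phase d)) (l : Fin d → ℝ) (G : Phase d → ℝ)
    (u : ℝ → ℝ) (t : ℝ) : ℝ :=
  ∫ x, G (Zmap γ x) * u (dotP l x) ∂(ρ t : Measure (Phase d))

lemma continuousOn_meanFast {G : Phase d → ℝ} (hG : Continuous G) (hu : Continuous u) {B : ℝ}
    (hB : ∀ z, |G z| ≤ B) (hK : ∀ y, |u y| ≤ K) {S : Set ℝ} (hρ : ContinuousOn ρ S) :
    ContinuousOn (meanFast γ ρ l G u) S :=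
  (continuous_integral_probabilityMeasure (h := fun x => G (Zmap γ x) * u (dotP l x))
    (B := B * K) (by fun_prop) (fun x => by
      rw [abs_mul]
      exact mul_le_mul (hB _) (hK _) (abs_nonneg _) ((abs_nonneg _).trans (hB 0)))).comp_continuousOn
    hρ

lemma GoodCurve.neg_integral_meanFast_le (hρ : GoodCurve d m γ T V ψ C ρ) (hγ : 1 ≤ γ)
    (hm : 0 < m) (hC : 0 ≤ C) (hT : 0 ≤ T) (hA : ForceBound A V ψ) (ha : 0 < a) (ha1 : a ≤ 1)
    {g : (Fin d → ℝ) → ℝ} (hg : ContDiff ℝ 2 g) {B B' c M N : ℝ} (hB : ∀ q, |g q| ≤ B)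
    (hB' : ∀ z, (1 + ‖z‖) * |locZ a g z| ≤ B')
    (hc : ∀ x, |deriv smoothTransition x| ≤ c) (hc0 : 0 ≤ c) (hM : Decay M (locZ a g))
    (hfr : γ ^ 2 * (∫ t in (0 : ℝ)..T, meanZ γ ρ (fricZ (lyap a)) t) ≤ 1)
    {η : ℝ → ℝ} (hη : IsCb2 η) (hN : ∀ t, |η t| ≤ N) (hN' : ∀ t, |deriv η t| ≤ N)
    (h : Profile m (∑ i, l i ^ 2) K v v' v'' u) :
    -(γ * ∫ t in (0 : ℝ)..T, η t * meanFast γ ρ l (locZ a g) u t) ≤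
      C + N * (B * K) * (2 + T)
        + T * (N ^ 2 * (2 * (B * K) ^ 2 * (∑ i, l i ^ 2) + 2 * d * (K * M) ^ 2))
        + N * (T * (K * ((∑ i, |l i|) * (4 * A * B' + 2 * M)) + K * (d * (4 * A + 1) * (2 * M)))
        + K * (4 * c * B) / m) := by
  have hγ0 : γ ≠ 0 := by linarith
  have hγp : 0 < γ := by linarith
  have hK := h.nonneg
  have hB0 := (abs_nonneg _).trans (hB 0)
  have hN0 := (abs_nonneg _).trans (hN 0)
  have hγi : γ⁻¹ ≤ 1 := inv_le_one_of_one_le₀ hγ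
  have hγi0 : 0 < γ⁻¹ := inv_pos.2 hγp
  have hv1 : ∀ y, HasDerivAt (fun y => γ⁻¹ * v y) (γ⁻¹ * v' y) y :=
    fun y => (h.deriv_fst y).const_mul _
  have hv2 : ∀ y, HasDerivAt (fun y => γ⁻¹ * v' y) (γ⁻¹ * v'' y) y :=
    fun y => (h.deriv_snd y).const_mul _
  have hv3 : Continuous fun y => γ⁻¹ * v'' y := continuous_const.mul h.cont
  obtain ⟨Φ, hΦe⟩ : ∃ Φ : Phase d → ℝ,
    Φ = fun z => locZ a g z * fastZ γ l (fun y => γ⁻¹ * v y) z := ⟨_, rfl⟩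
  have hΦs : ContDiff ℝ 2 Φ := by
    rw [hΦe]
    exact (contDiff_locZ a hg).mul (contDiff_fastZ hv1 hv2 hv3)
  have hΦc : HasCompactSupport Φ := by
    rw [hΦe]
    exact (hasCompactSupport_locZ ha g).mul_right (f' := fastZ γ l (fun y => γ⁻¹ * v y))
  obtain ⟨M', hΦ⟩ := exists_decay_of_hasCompactSupport hΦs hΦc
  have hsv : ∀ y, |γ⁻¹ * v y| ≤ γ⁻¹ * K := fun y => by
    rw [abs_mul, abs_of_pos hγi0]; exact mul_le_mul_of_nonneg_left (h.bdd y) hγi0.le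
  have hsv' : ∀ y, |γ⁻¹ * v' y| ≤ γ⁻¹ * K := fun y => by
    rw [abs_mul, abs_of_pos hγi0]; exact mul_le_mul_of_nonneg_left (h.bdd' y) hγi0.le
  have hΦb : ∀ z, |Φ z| ≤ B * K := fun z => by
    rw [hΦe, abs_mul]
    refine mul_le_mul (abs_locZ_le a hB z) ((hsv _).trans ?_) (abs_nonneg _) hB0
    exact mul_le_of_le_one_left hK hγi
  have hcar : ∀ x, carreZ Φ (Zmap γ x) ≤
      2 * (B * K) ^ 2 * (∑ i, l i ^ 2) + 2 * d * (K * M) ^ 2 := by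
    intro x
    have h1 := carreZ_mul_fastZ_le (l := l) hγ0 (contDiff_locZ a hg) hv1 hv2 hv3
      (abs_locZ_le a hB) hsv hsv' hM.norm_fderiv_le x
    rw [← hΦe] at h1
    refine h1.trans (add_le_add (le_of_eq ?_) ?_)
    · field_simp
    · have := hM.nonneg
      gcongr
      exact mul_le_of_le_one_left hK hγi
  have hrate := hρ.rate_interval hγ0 hC hT hA hη hΦ
  have hmc := continuousOn_meanZ (γ := γ) hΦ.smooth.continuous hΦb hρ.cont
  have hgc := hΦ.continuousOn_meanGen (m := m) (γ := γ) hA hρ.cont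
  have hcc := continuousOn_meanZ (γ := γ) hΦ.continuous_carreZ hΦ.abs_carreZ_le hρ.cont
  have hly := decay_lyap (d := d) ha.le ha1
  have hfc := continuousOn_meanZ (γ := γ) hly.continuous_fricZ hly.abs_fricZ_le hρ.cont
  have hlc : Continuous (locZ a g) := (contDiff_locZ a hg).continuous
  have hFc := continuousOn_meanFast (γ := γ) (l := l) hlc h.continuous_rhs (abs_locZ_le a hB)
    h.bdd_rhs hρ.cont
  have hηc : Continuous η := hη.1.continuous
  have hη'c : Continuous (deriv η) := hη.1.continuous_deriv (by norm_num)
  obtain ⟨D, hD⟩ : ∃ D, D = K * ((∑ i, |l i|) * (4 * A * B' + 2 * M))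
    + K * (d * (4 * A + 1) * (2 * M)) := ⟨_, rfl⟩
  obtain ⟨E, hE⟩ : ∃ E, E = K * (4 * c * B) / m := ⟨_, rfl⟩
  have hE0 : 0 ≤ E := by rw [hE]; positivity
  obtain ⟨Q, hQ⟩ : ∃ Q, Q = 2 * (B * K) ^ 2 * (∑ i, l i ^ 2) + 2 * d * (K * M) ^ 2 := ⟨_, rfl⟩
  have hQ0 : 0 ≤ Q := by
    rw [hQ]
    have : 0 ≤ ∑ i, l i ^ 2 := Finset.sum_nonneg fun i _ => sq_nonneg _
    positivity
  have hgen : ∀ t, |meanGen m γ V ψ ρ Φ t - γ * meanFast γ ρ l (locZ a g) u t| ≤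
      D + E * (γ * meanZ γ ρ (fricZ (lyap a)) t) := by
    intro t
    have hi1 := hΦ.integrable_genZ (m := m) (γ := γ) hA (ρ t : Measure (Phase d))
    have hi2 : Integrable (fun x => locZ a g (Zmap γ x) * u (dotP l x))
        (ρ t : Measure (Phase d)) := by
      have hu := h.continuous_rhs
      refine integrable_of_continuous_of_bdd (B := B * K) (by fun_prop) (fun x => ?_) _
      rw [abs_mul]
      exact mul_le_mul (abs_locZ_le a hB _) (h.bdd_rhs _) (abs_nonneg _) hB0
    have hi3 : Integrable (fun x => fricZ (lyap a) (Zmap γ x)) (ρ t : Measure (Phase d)) :=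
      integrable_of_continuous_of_bdd (h := fun x => fricZ (lyap a) (Zmap γ x))
        (hly.continuous_fricZ.comp (Zmap γ).continuous) (fun x => hly.abs_fricZ_le _) _
    have e1 : meanGen m γ V ψ ρ Φ t - γ * meanFast γ ρ l (locZ a g) u t =
        ∫ x, (genZ m γ V ψ (ρ t : Measure (Phase d)) Φ x
          - γ * (locZ a g (Zmap γ x) * u (dotP l x))) ∂(ρ t : Measure (Phase d)) := by
      rw [integral_sub hi1 (hi2.const_mul γ), integral_const_mul]
      rfl
    have e2 : D + E * (γ * meanZ γ ρ (fricZ (lyap a)) t) =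
        ∫ x, (D + E * (γ * fricZ (lyap a) (Zmap γ x))) ∂(ρ t : Measure (Phase d)) := by
      rw [integral_add (integrable_const _) ((hi3.const_mul γ).const_mul E),
        integral_const_mul, integral_const_mul]
      simp [meanZ]
    rw [e1, e2]
    refine norm_integral_le_of_norm_le (f := fun x => genZ m γ V ψ (ρ t : Measure (Phase d)) Φ x
          - γ * (locZ a g (Zmap γ x) * u (dotP l x))) (μ := (ρ t : Measure (Phase d)))
      ((integrable_const _).add ((hi3.const_mul γ).const_mul E))
      (Filter.Eventually.of_forall fun x => ?_)
    rw [Real.norm_eq_abs, hΦe, hD, hE]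
    exact abs_genZ_mul_fastZ_sub_le hγ hm hA _ ha.le hg hB hB' hc hM h x
  have huI : uIcc 0 T = Icc 0 T := uIcc_of_le hT
  have i1 : IntervalIntegrable (fun t => η t * meanGen m γ V ψ ρ Φ t) volume 0 T :=
    ContinuousOn.intervalIntegrable (by rw [huI]; exact hηc.continuousOn.mul hgc)
  have i2 : IntervalIntegrable (fun t => η t * meanFast γ ρ l (locZ a g) u t) volume 0 T :=
    ContinuousOn.intervalIntegrable (by rw [huI]; exact hηc.continuousOn.mul hFc)
  have i3 : IntervalIntegrable (fun t => meanZ γ ρ (fricZ (lyap a)) t) volume 0 T :=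
    ContinuousOn.intervalIntegrable (by rw [huI]; exact hfc)
  have i4 : IntervalIntegrable (fun t => N * (D + E * (γ * meanZ γ ρ (fricZ (lyap a)) t)))
      volume 0 T :=
    (intervalIntegrable_const.add ((i3.const_mul γ).const_mul E)).const_mul N
  have k1 : (∫ t in (0 : ℝ)..T, η t * meanGen m γ V ψ ρ Φ t)
      - γ * (∫ t in (0 : ℝ)..T, η t * meanFast γ ρ l (locZ a g) u t) ≤ N * (T * D + E) := by
    have e1 : (∫ t in (0 : ℝ)..T, η t * meanGen m γ V ψ ρ Φ t)
        - γ * (∫ t in (0 : ℝ)..T, η t * meanFast γ ρ l (locZ a g) u t) =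
        ∫ t in (0 : ℝ)..T, (η t * meanGen m γ V ψ ρ Φ t
          - γ * (η t * meanFast γ ρ l (locZ a g) u t)) := by
      rw [intervalIntegral.integral_sub i1 (i2.const_mul γ), intervalIntegral.integral_const_mul]
    have e2 : (∫ t in (0 : ℝ)..T, (η t * meanGen m γ V ψ ρ Φ t
          - γ * (η t * meanFast γ ρ l (locZ a g) u t))) ≤
        ∫ t in (0 : ℝ)..T, N * (D + E * (γ * meanZ γ ρ (fricZ (lyap a)) t)) := by
      refine intervalIntegral.integral_mono_on hT (i1.sub (i2.const_mul γ)) i4 fun t _ => ?_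
      have e3 : η t * meanGen m γ V ψ ρ Φ t - γ * (η t * meanFast γ ρ l (locZ a g) u t) =
        η t * (meanGen m γ V ψ ρ Φ t - γ * meanFast γ ρ l (locZ a g) u t) := by ring
      rw [e3]
      refine (le_abs_self _).trans ?_
      rw [abs_mul]
      exact mul_le_mul (hN t) (hgen t) (abs_nonneg _) hN0
    have e4 : (∫ t in (0 : ℝ)..T, N * (D + E * (γ * meanZ γ ρ (fricZ (lyap a)) t))) =
        N * (T * D + E * (γ * ∫ t in (0 : ℝ)..T, meanZ γ ρ (fricZ (lyap a)) t)) := by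
      rw [intervalIntegral.integral_const_mul, intervalIntegral.integral_add
        intervalIntegrable_const ((i3.const_mul γ).const_mul E),
        intervalIntegral.integral_const_mul, intervalIntegral.integral_const_mul]
      simp
    have e5 : γ * (∫ t in (0 : ℝ)..T, meanZ γ ρ (fricZ (lyap a)) t) ≤ 1 := by
      have h0 : 0 ≤ ∫ t in (0 : ℝ)..T, meanZ γ ρ (fricZ (lyap a)) t :=
        intervalIntegral.integral_nonneg hT fun t _ =>
          integral_nonneg fun x => fricZ_lyap_nonneg ha.le _
      refine le_trans ?_ hfr
      rw [sq, mul_assoc]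
      exact le_mul_of_one_le_left (mul_nonneg hγp.le h0) hγ
    rw [e1]
    refine e2.trans (e4.le.trans (mul_le_mul_of_nonneg_left ?_ hN0))
    have := mul_le_mul_of_nonneg_left e5 hE0
    linarith
  have k2 : |∫ t in (0 : ℝ)..T, deriv η t * meanZ γ ρ Φ t| ≤ N * (B * K) * T := by
    have := intervalIntegral.norm_integral_le_of_norm_le_const (a := 0) (b := T)
      (f := fun t => deriv η t * meanZ γ ρ Φ t) (C := N * (B * K)) fun t _ => by
        rw [norm_mul]
        exact mul_le_mul (hN' t) (abs_meanZ_le hΦb ρ t) (norm_nonneg _) hN0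
    rwa [sub_zero, abs_of_nonneg hT] at this
  have k3 : |∫ t in (0 : ℝ)..T, η t ^ 2 * meanZ γ ρ (carreZ Φ) t| ≤ N ^ 2 * Q * T := by
    have := intervalIntegral.norm_integral_le_of_norm_le_const (a := 0) (b := T)
      (f := fun t => η t ^ 2 * meanZ γ ρ (carreZ Φ) t) (C := N ^ 2 * Q) fun t _ => by
        rw [norm_mul]
        refine mul_le_mul ?_ (abs_integral_le_of_bdd (fun x => ?_) _) (norm_nonneg _)
          (sq_nonneg _)
        · rw [norm_pow]
          exact pow_le_pow_left₀ (norm_nonneg _) (hN t) 2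
        · rw [abs_of_nonneg (carreZ_nonneg _ _), hQ]
          exact hcar x
    rwa [sub_zero, abs_of_nonneg hT] at this
  have k4 : ∀ t, |η t * meanZ γ ρ Φ t| ≤ N * (B * K) := fun t => by
    rw [abs_mul]
    exact mul_le_mul (hN t) (abs_meanZ_le hΦb ρ t) (abs_nonneg _) hN0
  have k5 := abs_le.1 (k4 T)
  have k6 := abs_le.1 (k4 0)
  have k7 := abs_le.1 k2
  have k8 := abs_le.1 k3
  have k9 : 0 ≤ N ^ 2 * Q * T := by positivity
  rw [← hD, ← hE, ← hQ]
  nlinarith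

end Averaging

section OscillatoryProfile

lemma hasDerivAt_integral_oscillatory {b : ℝ → ℝ} (hb : Continuous b) {φ φ' : ℝ → ℝ}
    (hφ : ∀ x, HasDerivAt φ (φ' x) x) (hφ' : Continuous φ') (h1 : ∀ x, |φ' x| ≤ 1)
    (r θ y : ℝ) :
    HasDerivAt (fun y => ∫ s in r..1, b s * φ (s * y + θ))
      (∫ s in r..1, s * b s * φ' (s * y + θ)) y := by
  have hφc : Continuous φ := continuous_iff_continuousAt.2 fun x => (hφ x).continuousAt
  refine (intervalIntegral.hasDerivAt_integral_of_dominated_loc_of_deriv_le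
    (F := fun y s => b s * φ (s * y + θ)) (F' := fun y s => s * b s * φ' (s * y + θ))
    (bound := fun s => |s * b s|) (s := univ) univ_mem ?_ ?_ ?_ ?_ ?_ ?_).2
  · refine Filter.Eventually.of_forall fun y => Continuous.aestronglyMeasurable ?_
    fun_prop
  · refine Continuous.intervalIntegrable ?_ _ _
    fun_prop
  · refine Continuous.aestronglyMeasurable ?_
    fun_prop
  · refine Filter.Eventually.of_forall fun s _ y _ => ?_
    rw [norm_mul]
    exact mul_le_of_le_one_right (norm_nonneg _) (h1 _)
  · refine Continuous.intervalIntegrable ?_ _ _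
    fun_prop
  · refine Filter.Eventually.of_forall fun s _ y _ => ?_
    have := (((hφ (s * y + θ)).comp y (((hasDerivAt_id y).const_mul s).add_const θ))).const_mul
      (b s)
    exact this.congr_deriv (by ring)

lemma continuous_integral_oscillatory {b : ℝ → ℝ} (hb : Continuous b) (r θ : ℝ) :
    Continuous fun y => ∫ s in r..1, b s * cos (s * y + θ) :=
  intervalIntegral.continuous_parametric_intervalIntegral_of_continuous' (by fun_prop) _ _

lemma abs_integral_oscillatory_le {b φ : ℝ → ℝ} {r θ y B : ℝ} (hr : 0 ≤ r) (hr1 : r ≤ 1)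
    (hB0 : 0 ≤ B)
    (hB : ∀ s ∈ Icc r 1, |b s| ≤ B) (h1 : ∀ x, |φ x| ≤ 1) :
    |∫ s in r..1, b s * φ (s * y + θ)| ≤ B := by
  have := intervalIntegral.norm_integral_le_of_norm_le_const (a := r) (b := 1)
    (f := fun s => b s * φ (s * y + θ)) (C := B) fun s hs => by
      rw [uIoc_of_le hr1] at hs
      rw [norm_mul]
      exact (mul_le_of_le_one_right (norm_nonneg _) (h1 _)).trans (hB s ⟨hs.1.le, hs.2⟩)
  rw [Real.norm_eq_abs] at this
  refine this.trans (mul_le_of_le_one_right hB0 ?_)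
  rw [abs_of_nonneg (by linarith)]
  linarith

/-- The factor appearing in the Ornstein–Uhlenbeck flow of a plane wave. -/
def waveE (m L s : ℝ) : ℝ := Real.exp (m * L * s ^ 2 / 2)

lemma continuous_waveE (m L : ℝ) : Continuous (waveE m L) := by
  unfold waveE
  fun_prop

lemma waveE_pos (m L s : ℝ) : 0 < waveE m L s := Real.exp_pos _

lemma waveE_le {m L : ℝ} (hm : 0 ≤ m) (hL : 0 ≤ L) {s r : ℝ} (hs : 0 ≤ s) (hsr : s ≤ r) :
    waveE m L s ≤ waveE m L r := by
  unfold waveE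
  gcongr

lemma exists_profile {m L r : ℝ} (hm : 0 < m) (hL : 0 ≤ L) (hr : 0 < r) (hr1 : r ≤ 1) (θ : ℝ) :
    ∃ K v v' v'', Profile m L K v v' v''
      (fun y => waveE m L 1 * cos (y + θ) - waveE m L r * cos (r * y + θ)) := by
  obtain ⟨E, hE⟩ : ∃ E, E = waveE m L := ⟨_, rfl⟩
  have hEc : Continuous E := hE ▸ continuous_waveE m L
  have hE1 : ∀ s ∈ Icc r 1, |E s| ≤ E 1 := fun s hs => by
    rw [hE, abs_of_pos (waveE_pos _ _ _)]
    exact waveE_le hm.le hL (hr.le.trans hs.1) hs.2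
  have hE1' : 0 < E 1 := hE ▸ waveE_pos _ _ _
  have hEr : E r ≤ E 1 := (le_abs_self _).trans (hE1 r ⟨le_rfl, hr1⟩)
  have hEr0 : 0 < E r := hE ▸ waveE_pos _ _ _
  have hmr : ∀ s : ℝ, max s r ≠ 0 := fun s => (lt_of_lt_of_le hr (le_max_right _ _)).ne'
  have hbc : Continuous fun s => E s / max s r := hEc.div (by fun_prop) hmr
  have hEd : ∀ s, HasDerivAt E (m * L * s * E s) s := by
    intro s
    rw [hE]
    have := (((hasDerivAt_pow 2 s).const_mul (m * L)).div_const 2).exp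
    refine this.congr_deriv ?_
    simp [waveE]
    ring
  have eq1 : ∀ y, ∫ s in r..1, s * (E s / max s r) * -sin (s * y + θ) =
      -∫ s in r..1, E s * sin (s * y + θ) := by
    intro y
    rw [← intervalIntegral.integral_neg]
    refine intervalIntegral.integral_congr fun s hs => ?_
    rw [uIcc_of_le hr1] at hs
    have : s ≠ 0 := (hr.trans_le hs.1).ne'
    simp only [max_eq_left hs.1]
    field_simp
  refine ⟨m * (E 1 / r) + m * E 1 + 2 * E 1,
    fun y => -m * ∫ s in r..1, E s / max s r * cos (s * y + θ),
    fun y => m * ∫ s in r..1, E s * sin (s * y + θ),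
    fun y => m * ∫ s in r..1, s * E s * cos (s * y + θ), ?_⟩
  have b1 : ∀ y, |∫ s in r..1, E s / max s r * cos (s * y + θ)| ≤ E 1 / r := fun y =>
    abs_integral_oscillatory_le (b := fun s => E s / max s r) hr.le hr1 (by positivity)
      (fun s hs => by
        rw [abs_div, max_eq_left hs.1, abs_of_pos (hr.trans_le hs.1)]
        exact div_le_div₀ hE1'.le (hE1 s hs) hr hs.1) abs_cos_le_one
  have b2 : ∀ y, |∫ s in r..1, E s * sin (s * y + θ)| ≤ E 1 := fun y =>
    abs_integral_oscillatory_le hr.le hr1 hE1'.le hE1 abs_sin_le_one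
  constructor
  · intro y
    have := (hasDerivAt_integral_oscillatory hbc hasDerivAt_cos continuous_sin.neg
      (fun x => by rw [abs_neg]; exact abs_sin_le_one x) r θ y).const_mul (-m)
    refine this.congr_deriv ?_
    rw [eq1]
    ring
  · intro y
    exact (hasDerivAt_integral_oscillatory hEc hasDerivAt_sin continuous_cos
      abs_cos_le_one r θ y).const_mul m
  · exact continuous_const.mul (continuous_integral_oscillatory (by fun_prop) r θ)
  · intro y
    rw [abs_mul, abs_neg, abs_of_pos hm]
    have := mul_le_mul_of_nonneg_left (b1 y) hm.le
    nlinarith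
  · intro y
    rw [abs_mul, abs_of_pos hm]
    have := mul_le_mul_of_nonneg_left (b2 y) hm.le
    have : 0 ≤ m * (E 1 / r) := by positivity
    nlinarith
  · intro y
    rw [← hE]
    have t1 : |E 1 * cos (y + θ)| ≤ E 1 := by
      rw [abs_mul, abs_of_pos hE1']
      exact mul_le_of_le_one_right hE1'.le (abs_cos_le_one _)
    have t2 : |E r * cos (r * y + θ)| ≤ E 1 := by
      rw [abs_mul, abs_of_pos hEr0]
      exact (mul_le_of_le_one_right hEr0.le (abs_cos_le_one _)).trans hEr
    have t3 : 0 ≤ m * (E 1 / r) := by positivity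
    have t4 : 0 ≤ m * E 1 := by positivity
    rw [abs_le] at *
    constructor <;> linarith
  · intro y
    have hd : ∀ s, HasDerivAt (fun s => E s * cos (s * y + θ))
        (m * L * s * E s * cos (s * y + θ) - y * (E s * sin (s * y + θ))) s := by
      intro s
      have h1 : HasDerivAt (fun s => s * y + θ) y s :=
        (((hasDerivAt_id s).mul_const y).add_const θ).congr_deriv (one_mul y)
      exact ((hEd s).mul h1.cos).congr_deriv (by ring)
    have hF := intervalIntegral.integral_eq_sub_of_hasDerivAt (a := r) (b := 1)
      (fun s _ => hd s) (Continuous.intervalIntegrable (by fun_prop) _ _)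
    rw [intervalIntegral.integral_sub (Continuous.intervalIntegrable (by fun_prop) _ _)
      (Continuous.intervalIntegrable (by fun_prop) _ _), intervalIntegral.integral_const_mul] at hF
    have e1 : ∫ s in r..1, m * L * s * E s * cos (s * y + θ) =
        L * (m * ∫ s in r..1, s * E s * cos (s * y + θ)) := by
      rw [← intervalIntegral.integral_const_mul, ← intervalIntegral.integral_const_mul]
      exact intervalIntegral.integral_congr fun s _ => by ring
    rw [e1, one_mul] at hF
    have e2 : ∀ I : ℝ, y / m * (m * I) = y * I := fun I => by field_simp
    rw [← hE, ← hF, e2]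

end OscillatoryProfile

section GaussianAveraging

variable {d : ℕ} {m γ T C A a L K : ℝ} {V ψ : (Fin d → ℝ) → ℝ}
  {ρ : ℝ → ProbabilityMeasure (Phase d)} {v v' v'' u : ℝ → ℝ} {l : Fin d → ℝ}

lemma IsCb2.exists_bound {η : ℝ → ℝ} (hη : IsCb2 η) :
    ∃ N, 0 ≤ N ∧ (∀ t, |η t| ≤ N) ∧ ∀ t, |deriv η t| ≤ N := by
  obtain ⟨N, hN⟩ := hη.2
  refine ⟨N, (abs_nonneg _).trans (hN 0).1, fun t => (hN t).1, fun t => ?_⟩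
  rw [← Real.norm_eq_abs, norm_deriv_eq_norm_fderiv]
  exact (hN t).2.1

lemma exists_averaging (hyp : PotentialHyp d m V ψ) (hC : 0 ≤ C) (hT : 0 ≤ T) (ha : 0 < a)
    (ha1 : a ≤ 1) {g : (Fin d → ℝ) → ℝ} (hg : ContDiff ℝ 2 g) {B : ℝ} (hB : ∀ q, |g q| ≤ B)
    {η : ℝ → ℝ} (hη : IsCb2 η) (h : Profile m (∑ i, l i ^ 2) K v v' v'' u) :
    ∃ R, 0 ≤ R ∧ ∀ γ ≥ 1, ∀ ρ : ℝ → ProbabilityMeasure (Phase d), GoodCurve d m γ T V ψ C ρ →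
      γ ^ 2 * (∫ t in (0 : ℝ)..T, meanZ γ ρ (fricZ (lyap a)) t) ≤ 1 →
      |∫ t in (0 : ℝ)..T, η t * meanFast γ ρ l (locZ a g) u t| ≤ R / γ := by
  obtain ⟨A, hA⟩ := hyp.exists_forceBound
  obtain ⟨c, hc0, hc⟩ := exists_deriv_smoothTransition_bound
  obtain ⟨M, hM⟩ := exists_decay_locZ ha hg
  obtain ⟨B', hB'⟩ := exists_weight_mul_le (contDiff_locZ a hg).continuous
    (hasCompactSupport_locZ ha g)
  obtain ⟨N, -, hN, hN'⟩ := hη.exists_bound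
  obtain ⟨R, hR⟩ : ∃ R, R = C + N * (B * K) * (2 + T)
        + T * (N ^ 2 * (2 * (B * K) ^ 2 * (∑ i, l i ^ 2) + 2 * d * (K * M) ^ 2))
        + N * (T * (K * ((∑ i, |l i|) * (4 * A * B' + 2 * M)) + K * (d * (4 * A + 1) * (2 * M)))
        + K * (4 * c * B) / m) := ⟨_, rfl⟩
  refine ⟨|R|, abs_nonneg R, fun γ hγ ρ hρ hfr => ?_⟩
  have h1 := hρ.neg_integral_meanFast_le hγ hyp.hm hC hT hA ha ha1 hg hB hB' hc hc0 hM hfr hη hN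
    hN' h
  have h2 := hρ.neg_integral_meanFast_le hγ hyp.hm hC hT hA ha ha1 hg hB hB' hc hc0 hM hfr hη hN
    hN' h.neg
  have e : ∀ t, η t * meanFast γ ρ l (locZ a g) (fun y => -u y) t =
      -(η t * meanFast γ ρ l (locZ a g) u t) := fun t => by
    simp only [meanFast, mul_neg, integral_neg]
  simp only [e] at h2
  rw [intervalIntegral.integral_neg, mul_neg, neg_neg] at h2
  rw [← hR] at h1 h2
  rw [le_div_iff₀ (by linarith), mul_comm, ← abs_of_pos (by linarith : 0 < γ), ← abs_mul,
    abs_of_pos (by linarith : 0 < γ)]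
  exact (abs_le.2 ⟨by linarith, h2⟩).trans (le_abs_self R)

lemma abs_wave_sub_le {r y θ E : ℝ} (hE : 1 ≤ E) :
    |E * cos (r * y + θ) - cos θ| ≤ (E - 1) + 2 * min 1 |r * y| := by
  have h1 : |cos (r * y + θ) - cos θ| ≤ 2 * min 1 |r * y| := by
    rcases min_choice 1 |r * y| with h | h <;> rw [h]
    · have := abs_le.1 (abs_cos_le_one (r * y + θ))
      have := abs_le.1 (abs_cos_le_one θ)
      rw [abs_le]; constructor <;> linarith
    · have := abs_cos_sub_cos_le (r * y + θ) θ
      rw [add_sub_cancel_right] at this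
      linarith [abs_nonneg (r * y)]
  have h2 : |(E - 1) * cos (r * y + θ)| ≤ E - 1 := by
    rw [abs_mul, abs_of_nonneg (by linarith)]
    exact mul_le_of_le_one_right (by linarith) (abs_cos_le_one _)
  have e : E * cos (r * y + θ) - cos θ = (E - 1) * cos (r * y + θ)
      + (cos (r * y + θ) - cos θ) := by ring
  rw [e]
  exact (abs_add_le _ _).trans (add_le_add h2 h1)

lemma one_le_waveE {m L : ℝ} (hm : 0 ≤ m) (hL : 0 ≤ L) (s : ℝ) : 1 ≤ waveE m L s :=
  Real.one_le_exp (by positivity)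

lemma exists_gaussian_averaging (hyp : PotentialHyp d m V ψ) (hC : 0 ≤ C) (hT : 0 ≤ T)
    {g : (Fin d → ℝ) → ℝ} (hg : ContDiff ℝ 2 g) {B : ℝ} (hB : ∀ q, |g q| ≤ B)
    {η : ℝ → ℝ} (hη : IsCb2 η) (l : Fin d → ℝ) (θ : ℝ) {ε : ℝ} (hε : 0 < ε) :
    ∃ Γ : ℝ, 1 ≤ Γ ∧ ∀ γ ≥ Γ, ∀ ρ : ℝ → ProbabilityMeasure (Phase d),
      GoodCurve d m γ T V ψ C ρ →
      |∫ t in (0 : ℝ)..T, η t * meanFast γ ρ l (fun z => g z.1)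
        (fun y => cos (y + θ) - Real.exp (-(m * (∑ i, l i ^ 2) / 2)) * cos θ) t| ≤ ε := by
  obtain ⟨N, hN0, hN, -⟩ := hη.exists_bound
  have hB0 := (abs_nonneg _).trans (hB 0)
  have hm := hyp.hm
  obtain ⟨S, hS⟩ : ∃ S, S = ∑ i, l i ^ 2 := ⟨_, rfl⟩
  have hS0 : 0 ≤ S := hS ▸ Finset.sum_nonneg fun i _ => sq_nonneg _
  obtain ⟨lam, hlam⟩ : ∃ lam, lam = ∑ i, |l i| := ⟨_, rfl⟩
  have hlam0 : 0 ≤ lam := hlam ▸ Finset.sum_nonneg fun i _ => abs_nonneg _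
  obtain ⟨δ, hδ, hAV⟩ := exists_momentum_le hyp hC hT (ε := ε / (8 * (N * B + 1)))
    (by positivity)
  obtain ⟨r, hr, hr1, hrδ, hrE⟩ : ∃ r, 0 < r ∧ r ≤ 1 ∧ r * lam ≤ δ ∧
      waveE m S r - 1 ≤ ε / (4 * (N * T * B + 1)) := by
    have t1 : Tendsto (fun r => waveE m S r - 1) (𝓝[>] 0) (𝓝 0) := by
      have : Tendsto (fun r => waveE m S r - 1) (𝓝 0) (𝓝 (waveE m S 0 - 1)) :=
        ((continuous_waveE m S).sub (continuous_const (y := (1 : ℝ)))).tendsto 0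
      refine Tendsto.mono_left ?_ nhdsWithin_le_nhds
      simpa [waveE] using this
    have t2 : Tendsto (fun r => r * lam) (𝓝[>] 0) (𝓝 0) := by
      have := (continuous_id.mul_const lam).tendsto (0 : ℝ)
      refine Tendsto.mono_left ?_ nhdsWithin_le_nhds
      simpa using this
    have hq : 0 < ε / (4 * (N * T * B + 1)) := by positivity
    obtain ⟨r, ⟨h1, h2⟩, h3⟩ := ((t1.eventually_le_const hq).and
      (t2.eventually_le_const hδ) |>.and (Ioc_mem_nhdsGT (zero_lt_one (α := ℝ)))).exists
    exact ⟨r, h3.1, h3.2, h2, h1⟩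
  obtain ⟨K, v, v', v'', hprof⟩ := exists_profile hm hS0 hr hr1 θ
  have hK := hprof.nonneg
  rw [hS] at hprof
  obtain ⟨a, ha, ha1, hE⟩ := exists_lyap_le hyp hC hT (ε := min 1 (ε / (8 * (N * T * B * K + 1))))
    (by positivity)
  obtain ⟨R, hR0, hR⟩ := exists_averaging hyp hC hT ha ha1 hg hB hη hprof
  refine ⟨max 1 (4 * R / ε), le_max_left _ _, fun γ hγ ρ hρ => ?_⟩
  have hγ1 : 1 ≤ γ := (le_max_left _ _).trans hγ
  have hγ2 : 4 * R / ε ≤ γ := (le_max_right _ _).trans hγ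
  obtain ⟨hE1, hE2⟩ := hE γ hγ1 ρ hρ
  have hR := hR γ hγ1 ρ hρ (hE2.trans (min_le_left _ _))
  have hAV := hAV γ hγ1 ρ hρ
  rw [← hS] at hR hprof ⊢
  obtain ⟨u, hu⟩ : ∃ u, u = fun y => waveE m S 1 * cos (y + θ) - waveE m S r * cos (r * y + θ) :=
    ⟨_, rfl⟩
  rw [← hu] at hR hprof
  obtain ⟨w, hw⟩ : ∃ w, w = fun y => cos (y + θ) - Real.exp (-(m * S / 2)) * cos θ := ⟨_, rfl⟩
  rw [← hw]
  obtain ⟨e, he⟩ : ∃ e, e = Real.exp (-(m * S / 2)) := ⟨_, rfl⟩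
  have he0 : 0 < e := he ▸ Real.exp_pos _
  have he1 : e ≤ 1 := he ▸ Real.exp_le_one_iff.2 (by have : 0 ≤ m * S := by positivity
                                                     linarith)
  have heE : e * waveE m S 1 = 1 := by
    rw [he, waveE, ← Real.exp_add]
    simp
  have hwc : Continuous w := by rw [hw]; fun_prop
  have hwb : ∀ y, |w y| ≤ 2 := fun y => by
    have h1 := abs_le.1 (abs_cos_le_one (y + θ))
    have h2 : |e * cos θ| ≤ 1 := by
      rw [abs_mul, abs_of_pos he0]
      exact mul_le_one₀ he1 (abs_nonneg _) (abs_cos_le_one _)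
    have h3 := abs_le.1 h2
    rw [hw, ← he, abs_le]
    constructor <;> linarith
  have huc := hprof.continuous_rhs
  have hub := hprof.bdd_rhs
  have hlc : Continuous (locZ a g) := (contDiff_locZ a hg).continuous
  have hlb := abs_locZ_le a hB
  have hgc : Continuous g := hg.continuous
  have hly : Continuous (lyap a : Phase d → ℝ) := (contDiff_lyap a (n := 0)).continuous
  obtain ⟨At, hAt⟩ : ∃ At : ℝ → ℝ, At = fun t =>
    ∫ x, min 1 (δ * ‖x.2‖) ∂(ρ t : Measure (Phase d)) := ⟨_, rfl⟩
  have hmb : ∀ x : Phase d, |min 1 (δ * ‖x.2‖)| ≤ 1 := fun x => by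
    rw [abs_of_nonneg (by positivity)]
    exact min_le_left _ _
  have hmc : Continuous fun x : Phase d => min 1 (δ * ‖x.2‖) := by fun_prop
  have hpt : ∀ x : Phase d, |g (Zmap γ x).1 * w (dotP l x)
      - e * (locZ a g (Zmap γ x) * u (dotP l x))| ≤
      2 * B * K * lyap a (Zmap γ x) + B * (waveE m S r - 1) + 2 * B * min 1 (δ * ‖x.2‖) := by
    intro x
    obtain ⟨y, hy⟩ : ∃ y, y = dotP l x := ⟨_, rfl⟩
    obtain ⟨D, hD⟩ : ∃ D, D = waveE m S r * cos (r * y + θ) - cos θ := ⟨_, rfl⟩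
    have e1 : w y = e * (u y + D) := by
      simp only [hw, hu, hD, ← he]
      linear_combination (-cos (y + θ)) * heE
    have e2 : g (Zmap γ x).1 * w y - e * (locZ a g (Zmap γ x) * u y) =
        e * ((g (Zmap γ x).1 - locZ a g (Zmap γ x)) * u y + g (Zmap γ x).1 * D) := by
      rw [e1]; ring
    have hDb : |D| ≤ (waveE m S r - 1) + 2 * min 1 (δ * ‖x.2‖) := by
      rw [hD]
      refine (abs_wave_sub_le (one_le_waveE hm.le hS0 r)).trans ?_
      have : |r * y| ≤ δ * ‖x.2‖ := by
        rw [abs_mul, abs_of_pos hr, hy]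
        calc r * |dotP l x| ≤ r * (lam * ‖x.2‖) :=
              mul_le_mul_of_nonneg_left (hlam ▸ abs_dotP_le l x) hr.le
          _ = r * lam * ‖x.2‖ := by ring
          _ ≤ _ := mul_le_mul_of_nonneg_right hrδ (norm_nonneg _)
      gcongr
    have h1 : |(g (Zmap γ x).1 - locZ a g (Zmap γ x)) * u y| ≤
        2 * B * lyap a (Zmap γ x) * K := by
      rw [abs_mul]
      have h2 := abs_sub_locZ_le ha.le hB (Zmap γ x)
      exact mul_le_mul h2 (hub y) (abs_nonneg _) ((abs_nonneg _).trans h2)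
    have h3 : |g (Zmap γ x).1 * D| ≤ B * ((waveE m S r - 1) + 2 * min 1 (δ * ‖x.2‖)) := by
      rw [abs_mul]
      exact mul_le_mul (hB _) hDb (abs_nonneg _) hB0
    rw [← hy, e2, abs_mul, abs_of_pos he0]
    refine (mul_le_of_le_one_left (abs_nonneg _) he1).trans ((abs_add_le _ _).trans ?_)
    linarith
  have hpt2 : ∀ t, |meanFast γ ρ l (fun z => g z.1) w t - e * meanFast γ ρ l (locZ a g) u t| ≤
      2 * B * K * meanZ γ ρ (lyap a) t + B * (waveE m S r - 1) + 2 * B * At t := by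
    intro t
    have i1 : Integrable (fun x => g (Zmap γ x).1 * w (dotP l x)) (ρ t : Measure (Phase d)) := by
      refine integrable_of_continuous_of_bdd (B := B * 2) (by fun_prop) (fun x => ?_) _
      rw [abs_mul]
      exact mul_le_mul (hB _) (hwb _) (abs_nonneg _) hB0
    have i2 : Integrable (fun x => locZ a g (Zmap γ x) * u (dotP l x))
        (ρ t : Measure (Phase d)) := by
      refine integrable_of_continuous_of_bdd (B := B * K) (by fun_prop) (fun x => ?_) _
      rw [abs_mul]
      exact mul_le_mul (hlb _) (hub _) (abs_nonneg _) hB0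
    have i3 : Integrable (fun x => lyap a (Zmap γ x)) (ρ t : Measure (Phase d)) :=
      integrable_of_continuous_of_bdd (h := fun x => lyap a (Zmap γ x))
        (hly.comp (Zmap γ).continuous) (fun x => abs_lyap_le_one ha.le _) _
    have i4 : Integrable (fun x : Phase d => min 1 (δ * ‖x.2‖)) (ρ t : Measure (Phase d)) :=
      integrable_of_continuous_of_bdd hmc hmb _
    have e1 : meanFast γ ρ l (fun z => g z.1) w t - e * meanFast γ ρ l (locZ a g) u t =
        ∫ x, (g (Zmap γ x).1 * w (dotP l x) - e * (locZ a g (Zmap γ x) * u (dotP l x)))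
          ∂(ρ t : Measure (Phase d)) := by
      rw [integral_sub i1 (i2.const_mul e), integral_const_mul]
      rfl
    have e2 : 2 * B * K * meanZ γ ρ (lyap a) t + B * (waveE m S r - 1) + 2 * B * At t =
        ∫ x, (2 * B * K * lyap a (Zmap γ x) + B * (waveE m S r - 1)
          + 2 * B * min 1 (δ * ‖x.2‖)) ∂(ρ t : Measure (Phase d)) := by
      have i5 : Integrable (fun x => 2 * B * K * lyap a (Zmap γ x) + B * (waveE m S r - 1))
        (ρ t : Measure (Phase d)) := (i3.const_mul _).add (integrable_const _)
      rw [integral_add i5 (i4.const_mul _),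
        integral_add (i3.const_mul _) (integrable_const _), integral_const_mul,
        integral_const_mul]
      simp [meanZ, hAt, integral_const_mul]
    rw [e1, e2]
    exact norm_integral_le_of_norm_le (f := fun x => g (Zmap γ x).1 * w (dotP l x)
        - e * (locZ a g (Zmap γ x) * u (dotP l x))) (μ := (ρ t : Measure (Phase d)))
      (((i3.const_mul _).add (integrable_const _)).add (i4.const_mul _))
      (Filter.Eventually.of_forall hpt)
  have huI : uIcc 0 T = Icc 0 T := uIcc_of_le hT
  have hηc : Continuous η := hη.1.continuous
  have c1 := continuousOn_meanFast (γ := γ) (ρ := ρ) (l := l) (G := fun z => g z.1)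
    (by fun_prop) hwc (fun z => hB _) hwb hρ.cont
  have c2 := continuousOn_meanFast (γ := γ) (ρ := ρ) (l := l) hlc huc hlb hub hρ.cont
  have c3 : ContinuousOn At (Icc 0 T) := by
    rw [hAt]
    exact (continuous_integral_probabilityMeasure hmc hmb).comp_continuousOn hρ.cont
  have j1 : IntervalIntegrable (fun t => η t * meanFast γ ρ l (fun z => g z.1) w t) volume 0 T :=
    ContinuousOn.intervalIntegrable (by rw [huI]; exact hηc.continuousOn.mul c1)
  have j2 : IntervalIntegrable (fun t => η t * meanFast γ ρ l (locZ a g) u t) volume 0 T :=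
    ContinuousOn.intervalIntegrable (by rw [huI]; exact hηc.continuousOn.mul c2)
  have j3 : IntervalIntegrable At volume 0 T := ContinuousOn.intervalIntegrable (by rwa [huI])
  obtain ⟨ε1, hε1⟩ : ∃ ε1, ε1 = min 1 (ε / (8 * (N * T * B * K + 1))) := ⟨_, rfl⟩
  rw [← hε1] at hE1
  have hfin : |(∫ t in (0 : ℝ)..T, η t * meanFast γ ρ l (fun z => g z.1) w t)
      - e * ∫ t in (0 : ℝ)..T, η t * meanFast γ ρ l (locZ a g) u t| ≤
      N * (T * (2 * B * K * ε1 + B * (waveE m S r - 1)) + 2 * B * ∫ t in (0 : ℝ)..T, At t) := by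
    rw [← intervalIntegral.integral_const_mul, ← intervalIntegral.integral_sub j1 (j2.const_mul e)]
    have e1 : N * (T * (2 * B * K * ε1 + B * (waveE m S r - 1)) + 2 * B * ∫ t in (0 : ℝ)..T, At t)
        = ∫ t in (0 : ℝ)..T, N * ((2 * B * K * ε1 + B * (waveE m S r - 1)) + 2 * B * At t) := by
      rw [intervalIntegral.integral_const_mul, intervalIntegral.integral_add
        intervalIntegrable_const (j3.const_mul _), intervalIntegral.integral_const_mul,
        intervalIntegral.integral_const, smul_eq_mul, sub_zero]
    rw [e1]
    have j4 : IntervalIntegrable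
        (fun t => N * ((2 * B * K * ε1 + B * (waveE m S r - 1)) + 2 * B * At t)) volume 0 T :=
      (intervalIntegrable_const.add (j3.const_mul _)).const_mul _
    refine intervalIntegral.norm_integral_le_of_norm_le (μ := volume)
      (f := fun t => η t * meanFast γ ρ l (fun z => g z.1) w t
        - e * (η t * meanFast γ ρ l (locZ a g) u t))
      (g := fun t => N * ((2 * B * K * ε1 + B * (waveE m S r - 1)) + 2 * B * At t)) hT
      (Filter.Eventually.of_forall fun t ht => ?_) j4
    have e2 : η t * meanFast γ ρ l (fun z => g z.1) w t
        - e * (η t * meanFast γ ρ l (locZ a g) u t) =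
        η t * (meanFast γ ρ l (fun z => g z.1) w t - e * meanFast γ ρ l (locZ a g) u t) := by ring
    rw [e2, norm_mul]
    refine mul_le_mul (hN t) ((hpt2 t).trans ?_) (norm_nonneg _) hN0
    have := mul_le_mul_of_nonneg_left (hE1 t ⟨ht.1.le, ht.2⟩) (by positivity : 0 ≤ 2 * B * K)
    linarith
  have q1 : N * (T * (2 * B * K * ε1)) ≤ ε / 4 := by
    have h1 : ε1 ≤ ε / (8 * (N * T * B * K + 1)) := hε1 ▸ min_le_right _ _
    calc N * (T * (2 * B * K * ε1)) = 2 * (N * T * B * K) * ε1 := by ring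
      _ ≤ 2 * (N * T * B * K + 1) * (ε / (8 * (N * T * B * K + 1))) := by
        have : 0 ≤ N * T * B * K := by positivity
        have : 0 ≤ ε1 := hε1 ▸ by positivity
        gcongr
        linarith
      _ = ε / 4 := by field_simp; norm_num
  have q2 : N * (T * (B * (waveE m S r - 1))) ≤ ε / 4 := by
    calc N * (T * (B * (waveE m S r - 1))) = (N * T * B) * (waveE m S r - 1) := by ring
      _ ≤ (N * T * B + 1) * (ε / (4 * (N * T * B + 1))) := by
        have : 0 ≤ N * T * B := by positivity
        have : 0 ≤ waveE m S r - 1 := by linarith [one_le_waveE hm.le hS0 r]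
        gcongr
        linarith
      _ = ε / 4 := by field_simp
  have q3 : N * (2 * B * ∫ t in (0 : ℝ)..T, At t) ≤ ε / 4 := by
    have h0 : 0 ≤ ∫ t in (0 : ℝ)..T, At t := by
      refine intervalIntegral.integral_nonneg hT fun t _ => ?_
      rw [hAt]
      exact integral_nonneg fun x => by positivity
    have h1 : ∫ t in (0 : ℝ)..T, At t ≤ ε / (8 * (N * B + 1)) := by
      simp only [hAt]
      exact hAV
    calc N * (2 * B * ∫ t in (0 : ℝ)..T, At t) = 2 * (N * B) * ∫ t in (0 : ℝ)..T, At t := by ring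
      _ ≤ 2 * (N * B + 1) * (ε / (8 * (N * B + 1))) := by
        have : 0 ≤ N * B := by positivity
        gcongr
        linarith
      _ = ε / 4 := by field_simp; norm_num
  have q4 : |e * ∫ t in (0 : ℝ)..T, η t * meanFast γ ρ l (locZ a g) u t| ≤ ε / 4 := by
    rw [abs_mul, abs_of_pos he0]
    refine (mul_le_of_le_one_left (abs_nonneg _) he1).trans (hR.trans ?_)
    rw [div_le_iff₀ (by linarith)]
    rw [div_le_iff₀ hε] at hγ2
    linarith
  rw [abs_le] at hfin q4 ⊢
  constructor <;> nlinarith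

end GaussianAveraging

section Maxwellian

variable {d : ℕ}

/-- The unnormalized Maxwellian density. -/
def maxwellDensity (m : ℝ) (p : Fin d → ℝ) : ℝ := exp (-((∑ i, (p i) ^ 2) / (2 * m)))

/-- The Maxwellian distribution of the momenta. -/
def maxwell (d : ℕ) (m : ℝ) : Measure (Fin d → ℝ) :=
  (ENNReal.ofReal (∫ p : Fin d → ℝ, maxwellDensity m p))⁻¹ •
    volume.withDensity (fun p => ENNReal.ofReal (maxwellDensity m p))

lemma maxwellDensity_pos (m : ℝ) (p : Fin d → ℝ) : 0 < maxwellDensity m p := exp_pos _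

lemma contDiff_maxwellDensity (m : ℝ) {n : WithTop ℕ∞} :
    ContDiff ℝ n (maxwellDensity m : (Fin d → ℝ) → ℝ) := by
  unfold maxwellDensity
  fun_prop

lemma integrable_maxwellDensity {m : ℝ} (hm : 0 < m) :
    Integrable (maxwellDensity m : (Fin d → ℝ) → ℝ) volume :=
  integrable_exp_neg_sum_sq hm

lemma integral_maxwellDensity_pos {m : ℝ} (hm : 0 < m) :
    0 < ∫ p : Fin d → ℝ, maxwellDensity m p :=
  integral_exp_pos (integrable_exp_neg_sum_sq hm)

lemma isProbabilityMeasure_maxwell {m : ℝ} (hm : 0 < m) :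
    IsProbabilityMeasure (maxwell d m) := by
  have hpos := integral_maxwellDensity_pos (d := d) hm
  constructor
  rw [maxwell, Measure.smul_apply, withDensity_apply _ MeasurableSet.univ, setLIntegral_univ,
    ← ofReal_integral_eq_lintegral_ofReal (integrable_maxwellDensity hm)
      (Filter.Eventually.of_forall fun p => (maxwellDensity_pos m p).le), smul_eq_mul]
  exact ENNReal.inv_mul_cancel (by simpa using hpos) ENNReal.ofReal_ne_top

lemma integral_maxwell {m : ℝ} (hm : 0 < m) (f : (Fin d → ℝ) → ℝ) :
    ∫ p, f p ∂(maxwell d m) =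
      (∫ p : Fin d → ℝ, maxwellDensity m p)⁻¹ * ∫ p, maxwellDensity m p * f p := by
  have hpos := integral_maxwellDensity_pos (d := d) hm
  rw [maxwell, integral_smul_measure, integral_withDensity_eq_integral_toReal_smul
    (by
      have : Continuous (maxwellDensity m : (Fin d → ℝ) → ℝ) :=
        (contDiff_maxwellDensity m (n := 0)).continuous
      fun_prop) (Filter.Eventually.of_forall fun _ => ENNReal.ofReal_lt_top)]
  simp only [ENNReal.toReal_inv, ENNReal.toReal_ofReal hpos.le,
    ENNReal.toReal_ofReal (maxwellDensity_pos m _).le, smul_eq_mul]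

lemma integral_maxwellDensity_cexp {m : ℝ} (hm : 0 < m) (l : Fin d → ℝ) :
    ∫ p : Fin d → ℝ, (maxwellDensity m p : ℂ) * Complex.exp ((∑ i, l i * p i : ℝ) * Complex.I) =
      ((∫ p : Fin d → ℝ, maxwellDensity m p) * Real.exp (-(m * (∑ i, l i ^ 2) / 2)) : ℝ) := by
  have hm' : (m : ℂ) ≠ 0 := by exact_mod_cast hm.ne'
  have hb : 0 < ((1 / (2 * m) : ℝ) : ℂ).re := by
    rw [Complex.ofReal_re]; positivity
  have key : ∀ l : Fin d → ℝ, ∫ p : Fin d → ℝ,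
      (maxwellDensity m p : ℂ) * Complex.exp ((∑ i, l i * p i : ℝ) * Complex.I) =
      (π / ((1 / (2 * m) : ℝ) : ℂ)) ^ (Fintype.card (Fin d) / 2 : ℂ) *
        Complex.exp ((∑ i, (l i * Complex.I) ^ 2) / (4 * ((1 / (2 * m) : ℝ) : ℂ))) := by
    intro l
    rw [← GaussianFourier.integral_cexp_neg_mul_sum_add hb]
    refine integral_congr_ae (Filter.Eventually.of_forall fun p => ?_)
    simp only [maxwellDensity, Complex.ofReal_exp]
    rw [← Complex.exp_add]
    congr 1
    push_cast
    rw [Finset.sum_mul]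
    congr 1
    · field_simp
    · exact Finset.sum_congr rfl fun i _ => by ring
  have h0 := key 0
  simp only [Pi.zero_apply, zero_mul, Finset.sum_const_zero, Complex.ofReal_zero, Complex.exp_zero,
    mul_one, ne_eq, OfNat.ofNat_ne_zero, not_false_eq_true, zero_pow, zero_div] at h0
  rw [key l, ← h0, integral_complex_ofReal, Complex.ofReal_mul, Complex.ofReal_exp]
  congr 2
  push_cast
  simp only [mul_pow, Complex.I_sq]
  rw [← Finset.sum_mul]
  field_simp
  ring

lemma integral_maxwell_cos {m : ℝ} (hm : 0 < m) (l : Fin d → ℝ) (θ : ℝ) :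
    ∫ p, cos ((∑ i, l i * p i) + θ) ∂(maxwell d m) =
      Real.exp (-(m * (∑ i, l i ^ 2) / 2)) * cos θ := by
  have hpos := integral_maxwellDensity_pos (d := d) hm
  have hc : Continuous (maxwellDensity m : (Fin d → ℝ) → ℝ) :=
    (contDiff_maxwellDensity m (n := 0)).continuous
  have hi : Integrable (fun p : Fin d → ℝ => Complex.exp (θ * Complex.I) *
      ((maxwellDensity m p : ℂ) * Complex.exp ((∑ i, l i * p i : ℝ) * Complex.I))) := by
    refine ((integrable_maxwellDensity (d := d) hm).mono' (by fun_prop) ?_).const_mul _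
    refine Filter.Eventually.of_forall fun p => ?_
    rw [norm_mul, Complex.norm_exp_ofReal_mul_I, mul_one, Complex.norm_real,
      norm_of_nonneg (maxwellDensity_pos m p).le]
  have h1 : ∫ p : Fin d → ℝ, maxwellDensity m p * cos ((∑ i, l i * p i) + θ) =
      (∫ p : Fin d → ℝ, Complex.exp (θ * Complex.I) *
      ((maxwellDensity m p : ℂ) * Complex.exp ((∑ i, l i * p i : ℝ) * Complex.I))).re := by
    rw [← RCLike.re_eq_complex_re, ← integral_re hi]
    refine integral_congr_ae (Filter.Eventually.of_forall fun p => ?_)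
    simp only [RCLike.re_eq_complex_re]
    rw [mul_left_comm, ← Complex.exp_add, ← add_mul, ← Complex.ofReal_add, Complex.re_ofReal_mul,
      Complex.exp_ofReal_mul_I_re, add_comm]
  rw [integral_maxwell hm, h1, integral_const_mul, integral_maxwellDensity_cexp hm,
    Complex.re_mul_ofReal, Complex.exp_ofReal_mul_I_re]
  field_simp

lemma fderiv_maxwellDensity {m : ℝ} (p : Fin d → ℝ) (i : Fin d) :
    fderiv ℝ (maxwellDensity m) p (Pi.single i 1) = -(1 / m) * p i * maxwellDensity m p := by
  have h1 : HasFDerivAt (fun p : Fin d → ℝ => -((∑ j, (p j) ^ 2) / (2 * m)))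
      (-((2 * m)⁻¹ • ∑ j, (2 * p j) • ContinuousLinearMap.proj (R := ℝ) (φ := fun _ => ℝ) j)) p := by
    have h2 : HasFDerivAt (fun p : Fin d → ℝ => ∑ j, (p j) ^ 2)
      (∑ j, (2 * p j) • ContinuousLinearMap.proj (R := ℝ) (φ := fun _ => ℝ) j) p := by
      refine HasFDerivAt.fun_sum fun j _ => ?_
      have := (hasFDerivAt_apply (𝕜 := ℝ) j p).pow 2
      simpa using this
    have h3 := (h2.const_mul (2 * m)⁻¹).neg
    refine h3.congr_of_eventuallyEq (Filter.Eventually.of_forall fun p => ?_)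
    simp only [Pi.neg_apply, div_eq_inv_mul]
  have h4 : HasFDerivAt (maxwellDensity m) _ p := h1.exp
  rw [h4.fderiv]
  simp only [_root_.smul_apply, _root_.neg_apply, _root_.sum_apply,
    ContinuousLinearMap.proj_apply, smul_eq_mul, Pi.single_apply, mul_ite, mul_one, mul_zero,
    Finset.sum_ite_eq', Finset.mem_univ, if_true]
  rw [maxwellDensity]
  rw [mul_inv]
  ring

lemma IsTestFn.pdP {φ : Phase d → ℝ} (hφ : IsTestFn φ) (i : Fin d) :
    IsTestFn (fun x => pdP φ x i) :=
  ⟨(hφ.1.fderiv_right (m := (⊤ : ℕ∞)) le_rfl).clm_apply contDiff_const,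
    hφ.2.fderiv_apply (𝕜 := ℝ) _⟩

lemma IsTestFn.slice {φ : Phase d → ℝ} (hφ : IsTestFn φ) (q : Fin d → ℝ) :
    ContDiff ℝ (⊤ : ℕ∞) (fun p => φ (q, p)) ∧ HasCompactSupport (fun p => φ (q, p)) :=
  ⟨hφ.1.comp (contDiff_const.prodMk contDiff_id),
    HasCompactSupport.of_support_subset_isCompact (hφ.2.isCompact.image continuous_snd)
      fun p hp => ⟨(q, p), subset_tsupport _ hp, rfl⟩⟩

lemma integral_maxwellDensity_mul_fderiv {m : ℝ} {f : (Fin d → ℝ) → ℝ} (hf : ContDiff ℝ 1 f)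
    (hc : HasCompactSupport f) (i : Fin d) :
    ∫ p, maxwellDensity m p * (fderiv ℝ f p (Pi.single i 1) - 1 / m * (p i * f p)) = 0 := by
  have hG : ContDiff ℝ 1 (maxwellDensity m : (Fin d → ℝ) → ℝ) := contDiff_maxwellDensity m
  have hGc := hG.continuous
  have hfc := hf.continuous
  have hf'c : Continuous fun p => fderiv ℝ f p (Pi.single i 1) :=
    (hf.continuous_fderiv one_ne_zero).clm_apply continuous_const
  have hf's : HasCompactSupport fun p => fderiv ℝ f p (Pi.single i 1) := hc.fderiv_apply (𝕜 := ℝ) _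
  have i1 : Integrable (fun p => maxwellDensity m p * fderiv ℝ f p (Pi.single i 1)) volume :=
    (hGc.mul hf'c).integrable_of_hasCompactSupport hf's.mul_left
  have i2 : Integrable (fun p => fderiv ℝ (maxwellDensity m) p (Pi.single i 1) * f p) volume :=
    (((hG.continuous_fderiv one_ne_zero).clm_apply
      continuous_const).mul hfc).integrable_of_hasCompactSupport hc.mul_left
  have i3 : Integrable (fun p => maxwellDensity m p * f p) volume :=
    (hGc.mul hfc).integrable_of_hasCompactSupport hc.mul_left
  have h := integral_mul_fderiv_eq_neg_fderiv_mul_of_integrable i2 i1 i3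
    (fun p _ => (hG.differentiable one_ne_zero) p) (fun p _ => (hf.differentiable one_ne_zero) p)
  have e : ∀ p, maxwellDensity m p * (fderiv ℝ f p (Pi.single i 1) - 1 / m * (p i * f p)) =
      maxwellDensity m p * fderiv ℝ f p (Pi.single i 1) +
        fderiv ℝ (maxwellDensity m) p (Pi.single i 1) * f p := fun p => by
    rw [fderiv_maxwellDensity]; ring
  rw [integral_congr_ae (Filter.Eventually.of_forall e), integral_add i1 i2, h, neg_add_cancel]

lemma fderiv_slice {f : Phase d → ℝ} (hf : Differentiable ℝ f) (q p : Fin d → ℝ) (i : Fin d) :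
    fderiv ℝ (fun p => f (q, p)) p (Pi.single i 1) = fderiv ℝ f (q, p) (dirP i) := by
  have h1 : HasFDerivAt (fun p : Fin d → ℝ => (q, p))
      (ContinuousLinearMap.inr ℝ (Fin d → ℝ) (Fin d → ℝ)) p := hasFDerivAt_prodMk_right q p
  have h2 := (hf (q, p)).hasFDerivAt.comp p h1
  have h3 : HasFDerivAt (fun p => f (q, p))
    ((fderiv ℝ f (q, p)).comp (ContinuousLinearMap.inr ℝ (Fin d → ℝ) (Fin d → ℝ))) p := h2
  rw [h3.fderiv]
  rfl

lemma IsTestFn.integral_maxwell_nonpos {m : ℝ} (hm : 0 < m) {φ : Phase d → ℝ} (hφ : IsTestFn φ)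
    (q : Fin d → ℝ) : ∫ p, fisherIntegrand m φ (q, p) ∂(maxwell d m) ≤ 0 := by
  have hd : ∀ i, Differentiable ℝ fun x => _root_.pdP φ x i := fun i =>
    (hφ.pdP i).1.differentiable (by simp)
  rw [integral_maxwell hm]
  refine mul_nonpos_of_nonneg_of_nonpos (inv_nonneg.2 (integral_maxwellDensity_pos hm).le) ?_
  obtain ⟨f, hf⟩ : ∃ f : Fin d → (Fin d → ℝ) → ℝ, f = fun i p => _root_.pdP φ (q, p) i :=
    ⟨_, rfl⟩
  have hfd : ∀ i, ContDiff ℝ 1 (f i) := fun i => by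
    rw [hf]; exact ((hφ.pdP i).slice q).1.of_le (by simp)
  have hfs : ∀ i, HasCompactSupport (f i) := fun i => by
    rw [hf]; exact ((hφ.pdP i).slice q).2
  have hGc : Continuous (maxwellDensity m : (Fin d → ℝ) → ℝ) :=
    (contDiff_maxwellDensity m (n := 0)).continuous
  have i1 : ∀ i, Integrable (fun p => maxwellDensity m p *
      (fderiv ℝ (f i) p (Pi.single i 1) - 1 / m * (p i * f i p))) volume := fun i => by
    refine Continuous.integrable_of_hasCompactSupport ?_ (HasCompactSupport.mul_left ?_)
    · have := (hfd i).continuous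
      have := ((hfd i).continuous_fderiv one_ne_zero).clm_apply
        (continuous_const (y := (Pi.single i 1 : Fin d → ℝ)))
      fun_prop
    · exact ((hfs i).fderiv_apply (𝕜 := ℝ) _).sub ((hfs i).mul_left.mul_left)
  have i2 : ∀ i, Integrable (fun p => maxwellDensity m p * (1 / 2 * f i p ^ 2)) volume :=
    fun i => by
    refine Continuous.integrable_of_hasCompactSupport ?_ (HasCompactSupport.mul_left ?_)
    · have := (hfd i).continuous
      fun_prop
    · simp only [pow_two]
      exact (hfs i).mul_left.mul_left
  have e : ∀ p, maxwellDensity m p * fisherIntegrand m φ (q, p) =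
      ∑ i, (maxwellDensity m p * (fderiv ℝ (f i) p (Pi.single i 1) - 1 / m * (p i * f i p))
        - maxwellDensity m p * (1 / 2 * f i p ^ 2)) := fun p => by
    have e1 : ∀ i, fderiv ℝ (f i) p (Pi.single i 1) =
      fderiv ℝ (fun y => _root_.pdP φ y i) (q, p) (dirP i) := fun i => by
      rw [hf]; exact fderiv_slice (hd i) q p i
    simp only [e1]
    simp only [fisherIntegrand, laplP, hf, Finset.mul_sum, ← Finset.sum_sub_distrib]
    exact Finset.sum_congr rfl fun i _ => by ring
  have i3 : ∀ i ∈ Finset.univ, Integrable (fun p =>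
      maxwellDensity m p * (fderiv ℝ (f i) p (Pi.single i 1) - 1 / m * (p i * f i p))
        - maxwellDensity m p * (1 / 2 * f i p ^ 2)) volume := fun i _ => (i1 i).sub (i2 i)
  rw [integral_congr_ae (Filter.Eventually.of_forall e), integral_finsetSum _ i3]
  refine Finset.sum_nonpos fun i _ => ?_
  rw [integral_sub (i1 i) (i2 i), integral_maxwellDensity_mul_fderiv (hfd i) (hfs i) i, zero_sub,
    neg_nonpos]
  exact integral_nonneg fun p => mul_nonneg (maxwellDensity_pos m p).le (by positivity)

lemma IsTestFn.integrable_fisherIntegrand {m : ℝ} {φ : Phase d → ℝ} (hφ : IsTestFn φ)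
    (ν : Measure (Phase d)) [IsFiniteMeasure ν] : Integrable (fisherIntegrand m φ) ν := by
  have h1 : ∀ i, IsTestFn fun x => _root_.pdP φ x i := fun i => hφ.pdP i
  have h2 : ∀ i, IsTestFn fun x => _root_.pdP (fun y => _root_.pdP φ y i) x i :=
    fun i => (h1 i).pdP i
  have e : fisherIntegrand m φ = fun x => ∑ i, (_root_.pdP (fun y => _root_.pdP φ y i) x i
      - 1 / m * (x.2 i * _root_.pdP φ x i) - 1 / 2 * (_root_.pdP φ x i) ^ 2) := by
    funext x
    simp only [fisherIntegrand, laplP, Finset.mul_sum, ← Finset.sum_sub_distrib]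
    rfl
  rw [e]
  refine integrable_finsetSum _ fun i _ => ?_
  have c1 := (h1 i).1.continuous
  have c2 := (h2 i).1.continuous
  refine Continuous.integrable_of_hasCompactSupport (by fun_prop) (((h2 i).2.sub ?_).sub ?_)
  · exact (h1 i).2.mul_left.mul_left
  · simp only [pow_two]
    exact (h1 i).2.mul_left.mul_left

lemma relFisher_prod_maxwell {m : ℝ} (hm : 0 < m) (σ : Measure (Fin d → ℝ))
    [IsProbabilityMeasure σ] : relFisher m (σ.prod (maxwell d m)) = 0 := by
  have := isProbabilityMeasure_maxwell (d := d) hm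
  rw [relFisher, ENNReal.iSup_eq_zero]
  rintro ⟨φ, hφ⟩
  rw [ENNReal.ofReal_eq_zero, integral_prod _ (hφ.integrable_fisherIntegrand _)]
  exact mul_nonpos_of_nonneg_of_nonpos zero_le_two
    (integral_nonpos fun q => hφ.integral_maxwell_nonpos hm q)

end Maxwellian

section WeakConvergence

lemma tendsto_integral_of_continuous_of_bdd {E : Type*} [TopologicalSpace E] [MeasurableSpace E]
    [OpensMeasurableSpace E] {ι : Type*} {l : Filter ι}
    {μ : ι → ProbabilityMeasure E} {μ0 : ProbabilityMeasure E} (h : Tendsto μ l (𝓝 μ0))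
    {f : E → ℝ} (hf : Continuous f) {B : ℝ} (hB : ∀ x, |f x| ≤ B) :
    Tendsto (fun n => ∫ x, f x ∂(μ n : Measure E)) l (𝓝 (∫ x, f x ∂(μ0 : Measure E))) :=
  ((continuous_integral_probabilityMeasure hf hB).tendsto μ0).comp h

variable {E : Type*} [NormedAddCommGroup E] [NormedSpace ℝ E] [FiniteDimensional ℝ E]
  [MeasurableSpace E] [BorelSpace E]

lemma charFun_map_toEuclidean (μ : ProbabilityMeasure E)
    (t : EuclideanSpace ℝ (Fin (Module.finrank ℝ E))) :
    charFun (Measure.map (toEuclidean (E := E)) (μ : Measure E)) t =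
      ((∫ x, cos (((innerSL ℝ t).comp (toEuclidean (E := E) : E →L[ℝ] _)) x + 0)
        ∂(μ : Measure E) : ℝ) : ℂ) +
      ((∫ x, cos (((innerSL ℝ t).comp (toEuclidean (E := E) : E →L[ℝ] _)) x + (-(π / 2)))
        ∂(μ : Measure E) : ℝ) : ℂ) * Complex.I := by
  have hm : Measurable (toEuclidean (E := E)) := (toEuclidean (E := E)).continuous.measurable
  rw [charFun_apply, integral_map hm.aemeasurable (by fun_prop)]
  obtain ⟨L, hL⟩ : ∃ L : E →L[ℝ] ℝ,
    L = (innerSL ℝ t).comp (toEuclidean (E := E) : E →L[ℝ] _) := ⟨_, rfl⟩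
  rw [← hL]
  have e : ∀ x : E, inner ℝ (toEuclidean (E := E) x) t = L x := fun x => by
    rw [hL, real_inner_comm]; rfl
  simp only [e, add_zero, ← sub_eq_add_neg, cos_sub_pi_div_two]
  have i1 : Integrable (fun x => ((cos (L x) : ℝ) : ℂ)) (μ : Measure E) :=
    (integrable_of_continuous_of_bdd (by fun_prop) (fun x => abs_cos_le_one (L x)) _).ofReal
  have i2 : Integrable (fun x => ((sin (L x) : ℝ) : ℂ) * Complex.I) (μ : Measure E) :=
    (integrable_of_continuous_of_bdd (by fun_prop) (fun x => abs_sin_le_one (L x))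
      _).ofReal.mul_const _
  rw [← integral_complex_ofReal, ← integral_complex_ofReal, ← integral_mul_const,
    ← integral_add i1 i2]
  refine integral_congr_ae (Filter.Eventually.of_forall fun x => ?_)
  simp only
  rw [Complex.exp_mul_I, Complex.ofReal_cos, Complex.ofReal_sin]

/-- Convergence of all integrals `∫ cos (L x + θ)` characterizes narrow convergence. -/
theorem tendsto_of_tendsto_integral_cos {ι : Type*} {l : Filter ι} [l.IsCountablyGenerated]
    {μ : ι → ProbabilityMeasure E} {μ0 : ProbabilityMeasure E}
    (h : ∀ (L : E →L[ℝ] ℝ) (θ : ℝ), Tendsto (fun n => ∫ x, cos (L x + θ) ∂(μ n : Measure E)) l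
      (𝓝 (∫ x, cos (L x + θ) ∂(μ0 : Measure E)))) :
    Tendsto μ l (𝓝 μ0) := by
  refine tendsto_of_seq_tendsto fun u hu => ?_
  have hm : Continuous (toEuclidean (E := E)) := (toEuclidean (E := E)).continuous
  have hs : Continuous (toEuclidean (E := E)).symm := (toEuclidean (E := E)).symm.continuous
  have key : Tendsto (fun n => (μ (u n)).map (f := toEuclidean (E := E)) hm.measurable.aemeasurable)
      atTop (𝓝 (μ0.map (f := toEuclidean (E := E)) hm.measurable.aemeasurable)) := by
    refine ProbabilityMeasure.tendsto_of_tendsto_charFun fun t => ?_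
    simp only [ProbabilityMeasure.toMeasure_map]
    simp only [charFun_map_toEuclidean]
    refine Tendsto.add ?_ (Tendsto.mul_const _ ?_)
    · exact (Complex.continuous_ofReal.tendsto _).comp ((h _ 0).comp hu)
    · exact (Complex.continuous_ofReal.tendsto _).comp ((h _ _).comp hu)
  have key2 := ProbabilityMeasure.tendsto_map_of_tendsto_of_continuous _ _ key hs
  have e : ∀ ν : ProbabilityMeasure E,
      (ν.map (f := toEuclidean (E := E)) hm.measurable.aemeasurable).map
        (f := (toEuclidean (E := E)).symm) hs.measurable.aemeasurable = ν := fun ν => by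
    apply Subtype.ext
    simp only [ProbabilityMeasure.toMeasure_map, ProbabilityMeasure.val_eq_to_measure]
    rw [Measure.map_map hs.measurable hm.measurable]
    have : (toEuclidean (E := E)).symm ∘ (toEuclidean (E := E)) = id := by
      funext x; simp
    rw [this, Measure.map_id]
  simp only [e] at key2
  exact key2

/-- Narrow compactness of tight, equicontinuous families of curves of probability measures. -/
theorem exists_subseq_tendsto_curve {T : ℝ} (hT : 0 ≤ T) (σ : ℕ → ℝ → ProbabilityMeasure E)
    (htight : IsTightMeasureSet {ν : Measure E | ∃ n, ∃ t ∈ Icc 0 T, (σ n t : Measure E) = ν})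
    (hequi : ∀ (L : E →L[ℝ] ℝ) (θ : ℝ), ∀ ε > 0, ∃ δ > 0, ∀ n, ∀ s ∈ Icc 0 T, ∀ t ∈ Icc 0 T,
      |s - t| ≤ δ → |(∫ x, cos (L x + θ) ∂(σ n s : Measure E))
        - ∫ x, cos (L x + θ) ∂(σ n t : Measure E)| ≤ ε) :
    ∃ s : ℕ → ℕ, StrictMono s ∧ ∃ τ : ℝ → ProbabilityMeasure E, ContinuousOn τ (Icc 0 T) ∧
      ∀ t ∈ Icc 0 T, Tendsto (fun p : ℕ × ℝ => σ (s p.1) p.2) (atTop ×ˢ 𝓝[Icc 0 T] t)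
        (𝓝 (τ t)) := by
  have : Nonempty (Icc 0 T) := ⟨⟨0, le_rfl, hT⟩⟩
  obtain ⟨D, hD⟩ : ∃ D : ℕ → Icc 0 T, D = TopologicalSpace.denseSeq (Icc 0 T) := ⟨_, rfl⟩
  have hDd : DenseRange D := hD ▸ TopologicalSpace.denseRange_denseSeq _
  obtain ⟨K, hK⟩ : ∃ K, K = closure {ν : ProbabilityMeasure E | ∃ n, ∃ t ∈ Icc 0 T, σ n t = ν} :=
    ⟨_, rfl⟩
  have hKc : IsCompact K := by
    rw [hK]
    refine isCompact_closure_of_isTightMeasureSet ?_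
    convert htight using 1
    ext ν
    constructor
    · rintro ⟨_, ⟨n, t, ht, rfl⟩, rfl⟩
      exact ⟨n, t, ht, rfl⟩
    · rintro ⟨n, t, ht, rfl⟩
      exact ⟨_, ⟨n, t, ht, rfl⟩, rfl⟩
  have hmem : ∀ n, ∀ t ∈ Icc 0 T, σ n t ∈ K := fun n t ht =>
    hK ▸ subset_closure ⟨n, t, ht, rfl⟩
  obtain ⟨a, -, s, hs, ha⟩ := (isCompact_univ_pi fun _ : ℕ => hKc).tendsto_subseq
    (x := fun n k => σ n (D k)) fun n k _ => hmem n _ (D k).2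
  have ha' : ∀ k, Tendsto (fun n => σ (s n) (D k)) atTop (𝓝 (a k)) := fun k =>
    tendsto_pi_nhds.1 ha k
  obtain ⟨c, hc⟩ : ∃ c : (E →L[ℝ] ℝ) → ℝ → ℕ → ℝ → ℝ,
    c = fun L θ n t => ∫ x, cos (L x + θ) ∂(σ (s n) t : Measure E) := ⟨_, rfl⟩
  have hcos : ∀ (L : E →L[ℝ] ℝ) (θ : ℝ), Continuous fun x => cos (L x + θ) := fun L θ => by
    fun_prop
  have hcosb : ∀ (L : E →L[ℝ] ℝ) (θ : ℝ) (x : E), |cos (L x + θ)| ≤ 1 := fun L θ x =>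
    abs_cos_le_one _
  have hequi' : ∀ (L : E →L[ℝ] ℝ) (θ : ℝ), ∀ ε > 0, ∃ δ > 0, ∀ n, ∀ r ∈ Icc 0 T, ∀ t ∈ Icc 0 T,
      |r - t| ≤ δ → |c L θ n r - c L θ n t| ≤ ε := fun L θ ε hε => by
    obtain ⟨δ, hδ, h⟩ := hequi L θ ε hε
    exact ⟨δ, hδ, fun n r hr t ht hrt => hc ▸ h (s n) r hr t ht hrt⟩
  have hcauchy : ∀ L θ, ∀ t ∈ Icc 0 T, CauchySeq fun n => c L θ n t := by
    intro L θ t ht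
    rw [Metric.cauchySeq_iff]
    intro ε hε
    obtain ⟨δ, hδ, h⟩ := hequi' L θ (ε / 4) (by positivity)
    obtain ⟨k, hk⟩ : ∃ k, D k ∈ Metric.ball (⟨t, ht⟩ : Icc 0 T) δ :=
      hDd.exists_mem_open Metric.isOpen_ball ⟨_, Metric.mem_ball_self hδ⟩
    have hk' : |(D k : ℝ) - t| ≤ δ := (Metric.mem_ball.1 hk).le
    have h1 : Tendsto (fun n => c L θ n (D k)) atTop (𝓝 (∫ x, cos (L x + θ) ∂(a k : Measure E))) :=
      hc ▸ tendsto_integral_of_continuous_of_bdd (ha' k) (hcos L θ) (hcosb L θ)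
    obtain ⟨N, hN⟩ := Metric.cauchySeq_iff.1 h1.cauchySeq (ε / 4) (by positivity)
    refine ⟨N, fun i hi j hj => ?_⟩
    have e1 := abs_le.1 (h i _ (D k).2 t ht hk')
    have e2 := abs_le.1 (h j _ (D k).2 t ht hk')
    have e3 := hN i hi j hj
    rw [Real.dist_eq, abs_lt] at e3 ⊢
    constructor <;> linarith
  have hlim : ∀ t ∈ Icc 0 T, ∃ b : ProbabilityMeasure E, ∀ L θ,
      Tendsto (fun n => c L θ n t) atTop (𝓝 (∫ x, cos (L x + θ) ∂(b : Measure E))) := by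
    intro t ht
    obtain ⟨b, -, r, hr, hb⟩ := hKc.tendsto_subseq fun n => hmem (s n) t ht
    refine ⟨b, fun L θ => tendsto_nhds_of_cauchySeq_of_subseq (hcauchy L θ t ht) hr.tendsto_atTop ?_⟩
    rw [hc]
    exact tendsto_integral_of_continuous_of_bdd hb (hcos L θ) (hcosb L θ)
  have : Nonempty (ProbabilityMeasure E) := ⟨a 0⟩
  choose! τ hτ using hlim
  refine ⟨s, hs, τ, fun t ht => ?_, fun t ht => ?_⟩
  · refine tendsto_of_tendsto_integral_cos fun L θ => ?_
    rw [Metric.tendsto_nhds]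
    intro ε hε
    obtain ⟨δ, hδ, h⟩ := hequi' L θ (ε / 2) (by positivity)
    filter_upwards [self_mem_nhdsWithin, mem_nhdsWithin_of_mem_nhds (Metric.ball_mem_nhds t hδ)]
      with r hr hrt
    have h1 : |(∫ x, cos (L x + θ) ∂(τ r : Measure E)) - ∫ x, cos (L x + θ) ∂(τ t : Measure E)|
        ≤ ε / 2 :=
      le_of_tendsto ((hτ r hr L θ).sub (hτ t ht L θ)).abs
        (Filter.Eventually.of_forall fun n => h n r hr t ht (Metric.mem_ball.1 hrt).le)
    rw [Real.dist_eq]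
    linarith
  · refine tendsto_of_tendsto_integral_cos fun L θ => ?_
    rw [Metric.tendsto_nhds]
    intro ε hε
    obtain ⟨δ, hδ, h⟩ := hequi' L θ (ε / 2) (by positivity)
    have h1 : ∀ᶠ n in atTop,
        |c L θ n t - ∫ x, cos (L x + θ) ∂(τ t : Measure E)| < ε / 2 :=
      (Metric.tendsto_nhds.1 (hτ t ht L θ)) (ε / 2) (by positivity)
    have h2 : ∀ᶠ r in 𝓝[Icc 0 T] t, r ∈ Icc 0 T ∧ |r - t| < δ :=
      Filter.Eventually.and self_mem_nhdsWithin
        (mem_nhdsWithin_of_mem_nhds (Metric.ball_mem_nhds t hδ))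
    filter_upwards [h1.prod_mk h2] with p hp
    have e1 := abs_le.1 (h p.1 p.2 hp.2.1 t ht hp.2.2.le)
    have e2 := abs_lt.1 hp.1
    rw [hc] at e1 e2
    rw [Real.dist_eq, abs_lt]
    constructor <;> linarith

lemma tendstoUniformlyOn_of_tendsto_prod {X : Type*} [TopologicalSpace X] {K : Set X}
    (hK : IsCompact K) {F : ℕ → X → ℝ} {f : X → ℝ} (hf : ContinuousOn f K)
    (h : ∀ t ∈ K, Tendsto (fun p : ℕ × X => F p.1 p.2) (atTop ×ˢ 𝓝[K] t) (𝓝 (f t))) :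
    TendstoUniformlyOn F f atTop K := by
  rw [← tendstoLocallyUniformlyOn_iff_tendstoUniformlyOn_of_compact hK,
    tendstoLocallyUniformlyOn_iff_forall_tendsto]
  intro t ht
  exact (((hf t ht).tendsto.comp tendsto_snd).prodMk_nhds (h t ht)).mono_right
    (nhds_le_uniformity (f t))

end WeakConvergence

section SpaceTime

variable {X : Type*} [TopologicalSpace X] [MeasurableSpace X] [BorelSpace X]
  [HasOuterApproxClosed X]

lemma measurable_of_continuous_probabilityMeasure {κ : ℝ → ProbabilityMeasure X}
    (hκ : Continuous κ) : Measurable fun t => (κ t : Measure X) := by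
  refine Measurable.measure_of_isPiSystem_of_isProbabilityMeasure
    (BorelSpace.measurable_eq (α := X)) isPiSystem_isOpen fun G hG => ?_
  refine LowerSemicontinuous.measurable (lowerSemicontinuous_iff_le_liminf.2 fun t => ?_)
  exact ProbabilityMeasure.le_liminf_measure_open_of_tendsto (hκ.tendsto t) hG

/-- The space-time measure associated with a continuous curve of probability measures. -/
lemma exists_spaceTime {T : ℝ} (hT : 0 < T) {ρ : ℝ → ProbabilityMeasure X}
    (hρ : ContinuousOn ρ (Icc 0 T)) [SecondCountableTopology X] :
    ∃ M : ProbabilityMeasure (ℝ × X), ∀ (F : ℝ × X → ℝ) (B : ℝ), Continuous F →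
      (∀ z, |F z| ≤ B) → ∫ z, F z ∂(M : Measure (ℝ × X)) =
        T⁻¹ * ∫ t in Icc 0 T, ∫ x, F (t, x) ∂(ρ t : Measure X) := by
  obtain ⟨κ, hκ⟩ : ∃ κ : ℝ → ProbabilityMeasure X,
    κ = fun t => ρ (projIcc 0 T hT.le t) := ⟨_, rfl⟩
  have hκc : Continuous κ := by
    rw [hκ]
    exact (continuousOn_iff_continuous_domRestrict.1 hρ).comp continuous_projIcc
  let K : ProbabilityTheory.Kernel ℝ X :=
    ⟨fun t => (κ t : Measure X), measurable_of_continuous_probabilityMeasure hκc⟩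
  have hK : ProbabilityTheory.IsMarkovKernel K := ⟨fun t => (κ t).2⟩
  let U : Measure ℝ := (ENNReal.ofReal T)⁻¹ • volume.restrict (Icc 0 T)
  have hU : IsProbabilityMeasure U := ⟨by
    simp only [U, Measure.smul_apply, Measure.restrict_apply_univ, Real.volume_Icc, sub_zero,
      smul_eq_mul]
    exact ENNReal.inv_mul_cancel (by simpa using hT) ENNReal.ofReal_ne_top⟩
  refine ⟨⟨U.compProd K, inferInstance⟩, fun F B hF hB => ?_⟩
  have h1 : Integrable F (U.compProd K) := integrable_of_continuous_of_bdd hF hB _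
  simp only [ProbabilityMeasure.coe_mk]
  rw [Measure.integral_compProd h1, integral_smul_measure, ENNReal.toReal_inv,
    ENNReal.toReal_ofReal hT.le, smul_eq_mul]
  congr 1
  refine setIntegral_congr_fun measurableSet_Icc fun t ht => ?_
  have : K t = (ρ t : Measure X) := by
    change (κ t : Measure X) = _
    rw [hκ]
    simp only [projIcc_of_mem hT.le ht]
  simp only [this]

end SpaceTime

section SlowVariable

variable {d : ℕ}

lemma continuous_xiGamma (γ : ℝ) : Continuous (xiGamma γ : Phase d → Fin d → ℝ) := by
  unfold xiGamma
  fun_prop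

/-- The law of the slow variable. -/
def slowLaw (γ : ℝ) (ν : ProbabilityMeasure (Phase d)) : ProbabilityMeasure (Fin d → ℝ) :=
  ν.map (f := xiGamma γ) (continuous_xiGamma γ).measurable.aemeasurable

lemma integral_slowLaw (γ : ℝ) (ν : ProbabilityMeasure (Phase d)) {g : (Fin d → ℝ) → ℝ}
    (hg : Continuous g) : ∫ q, g q ∂(slowLaw γ ν : Measure (Fin d → ℝ)) =
      ∫ x, g (xiGamma γ x) ∂(ν : Measure (Phase d)) := by
  rw [slowLaw, ProbabilityMeasure.toMeasure_map, integral_map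
    (continuous_xiGamma γ).measurable.aemeasurable hg.aestronglyMeasurable]

variable {m T C : ℝ} {V ψ : (Fin d → ℝ) → ℝ}

lemma isTightMeasureSet_slowLaw (hyp : PotentialHyp d m V ψ) (hC : 0 ≤ C) (hT : 0 ≤ T)
    {γ : ℕ → ℝ} (hγ : ∀ n, 1 ≤ γ n) {ρ : ℕ → ℝ → ProbabilityMeasure (Phase d)}
    (hρ : ∀ n, GoodCurve d m (γ n) T V ψ C (ρ n)) :
    IsTightMeasureSet {ν : Measure (Fin d → ℝ) |
      ∃ n, ∃ t ∈ Icc 0 T, (slowLaw (γ n) (ρ n t) : Measure (Fin d → ℝ)) = ν} := by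
  rw [isTightMeasureSet_iff_exists_isCompact_measure_compl_le]
  intro ε hε
  obtain ⟨e, he0, he⟩ := ENNReal.lt_iff_exists_nnreal_btwn.1 hε
  have he0' : (0 : ℝ) < e := by exact_mod_cast he0
  obtain ⟨a, ha, -, h⟩ := exists_lyap_le hyp hC hT (ε := e / 2) (by positivity)
  refine ⟨Metric.closedBall 0 ((1 - 1 / 2) ^ (-a⁻¹)), isCompact_closedBall _ _, ?_⟩
  rintro _ ⟨n, t, ht, rfl⟩
  have h1 := (h (γ n) (hγ n) (ρ n) (hρ n)).1 t ht
  have hi : Integrable (fun x => lyap a (Zmap (γ n) x)) (ρ n t : Measure (Phase d)) :=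
    integrable_of_continuous_of_bdd (h := fun x => lyap a (Zmap (γ n) x))
      (((contDiff_lyap a (n := 0)).continuous).comp (Zmap (γ n)).continuous)
      (fun x => abs_lyap_le_one ha.le _) _
  have h2 := mul_meas_ge_le_integral_of_nonneg
    (Filter.Eventually.of_forall fun x => lyap_nonneg ha.le (Zmap (γ n) x)) hi (1 / 2)
  have h3 : (ρ n t : Measure (Phase d)).real {x | 1 / 2 ≤ lyap a (Zmap (γ n) x)} ≤ e := by
    unfold meanZ at h1
    linarith
  rw [slowLaw, ProbabilityMeasure.toMeasure_map, Measure.map_apply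
    (continuous_xiGamma _).measurable Metric.isClosed_closedBall.measurableSet.compl]
  refine le_trans (measure_mono (t := {x | 1 / 2 ≤ lyap a (Zmap (γ n) x)}) ?_)
    (le_trans (b := (e : ℝ≥0∞)) ?_ he.le)
  · intro x hx
    by_contra hle
    have hlt : lyap a (Zmap (γ n) x) < 1 / 2 := not_le.1 hle
    refine hx ?_
    have h4 := wtN_lt_of_lyap_lt ha (by norm_num) hlt
    have h5 := norm_sq_le_wtN (Zmap (γ n) x)
    rw [mem_closedBall_zero_iff, ← Zmap_fst_eq_xiGamma]
    have h6 := norm_fst_le (Zmap (γ n) x)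
    nlinarith [norm_nonneg (Zmap (γ n) x)]
  · rw [Measure.real] at h3
    rw [← ENNReal.ofReal_coe_nnreal, ← ENNReal.ofReal_toReal (measure_ne_top _ _)]
    exact ENNReal.ofReal_le_ofReal h3

theorem exists_subseq_slowLaw (hyp : PotentialHyp d m V ψ) (hC : 0 ≤ C) (hT : 0 ≤ T)
    {γ : ℕ → ℝ} (hγ : ∀ n, 1 ≤ γ n) {ρ : ℕ → ℝ → ProbabilityMeasure (Phase d)}
    (hρ : ∀ n, GoodCurve d m (γ n) T V ψ C (ρ n)) :
    ∃ s : ℕ → ℕ, StrictMono s ∧ ∃ τ : ℝ → ProbabilityMeasure (Fin d → ℝ),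
      ContinuousOn τ (Icc 0 T) ∧ ∀ t ∈ Icc 0 T,
        Tendsto (fun p : ℕ × ℝ => slowLaw (γ (s p.1)) (ρ (s p.1) p.2)) (atTop ×ˢ 𝓝[Icc 0 T] t)
          (𝓝 (τ t)) := by
  refine exists_subseq_tendsto_curve hT (fun n t => slowLaw (γ n) (ρ n t))
    (isTightMeasureSet_slowLaw hyp hC hT hγ hρ) fun L θ ε hε => ?_
  have hg : ContDiff ℝ 2 fun q : Fin d → ℝ => cos (L q + θ) := (isCb2_cos_clm L θ).1
  obtain ⟨δ, hδ, h⟩ := exists_equicontinuity hyp hC hT hg (fun q => abs_cos_le_one _) hε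
  refine ⟨δ, hδ, fun n s hs t ht hst => ?_⟩
  have := h (γ n) (hγ n) (ρ n) (hρ n) s hs t ht hst
  simp only [meanZ, Zmap_fst_eq_xiGamma] at this
  rwa [integral_slowLaw _ _ hg.continuous, integral_slowLaw _ _ hg.continuous]

end SlowVariable

section Product

lemma integral_sub_sub_sub {X : Type*} [MeasurableSpace X] {μ : Measure X}
    {f g h k : X → ℝ} (hf : Integrable f μ) (hg : Integrable g μ) (hh : Integrable h μ) (hk : Integrable k μ) :
    ∫ x, (f x - g x - h x - k x) ∂μ = ∫ x, f x ∂μ - ∫ x, g x ∂μ - ∫ x, h x ∂μ - ∫ x, k x ∂μ := by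
  have h1 : Integrable (fun x => f x - g x) μ := hf.sub hg
  have h2 : Integrable (fun x => f x - g x - h x) μ := h1.sub hh
  rw [integral_sub h2 hk, integral_sub h1 hh, integral_sub hf hg]

variable {X : Type*} [TopologicalSpace X] [MeasurableSpace X] [BorelSpace X]

lemma continuousOn_integral_cos {ρ : ℝ → ProbabilityMeasure X} {S : Set ℝ}
    (hρ : ContinuousOn ρ S) {h : X → ℝ} (hh : Continuous h) (c : ℝ) :
    ContinuousOn (fun t => ∫ x, cos (c * t + h x) ∂(ρ t : Measure X)) S := by
  have hc := (continuous_integral_probabilityMeasure (h := fun x => cos (h x)) (by fun_prop)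
    (fun x => abs_cos_le_one _)).comp_continuousOn hρ
  have hs := (continuous_integral_probabilityMeasure (h := fun x => sin (h x)) (by fun_prop)
    (fun x => abs_sin_le_one _)).comp_continuousOn hρ
  have h1 : ContinuousOn (fun t : ℝ => cos (c * t)) S := by fun_prop
  have h2 : ContinuousOn (fun t : ℝ => sin (c * t)) S := by fun_prop
  refine ((h1.mul hc).sub (h2.mul hs)).congr fun t _ => ?_
  simp only [cos_add]
  have i1 : Integrable (fun x => cos (c * t) * cos (h x)) (ρ t : Measure X) :=
    (integrable_of_continuous_of_bdd (h := fun x => cos (h x)) (by fun_prop)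
      (fun x => abs_cos_le_one _) _).const_mul _
  have i2 : Integrable (fun x => sin (c * t) * sin (h x)) (ρ t : Measure X) :=
    (integrable_of_continuous_of_bdd (h := fun x => sin (h x)) (by fun_prop)
      (fun x => abs_sin_le_one _) _).const_mul _
  rw [integral_sub i1 i2, integral_const_mul, integral_const_mul]
  rfl

end Product

section Limit

variable {d : ℕ} {m T C : ℝ} {V ψ : (Fin d → ℝ) → ℝ}
  {γ : ℕ → ℝ} {ρ : ℕ → ℝ → ProbabilityMeasure (Phase d)}

lemma xiGamma_eq (γ : ℝ) (x : Phase d) : xiGamma γ x = x.1 + γ⁻¹ • x.2 := by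
  ext i
  simp [xiGamma, div_eq_inv_mul]

lemma abs_cos_sub_cos_le_min {a b c : ℝ} (h : |a - b| ≤ c) :
    |cos a - cos b| ≤ 2 * min 1 c := by
  have h1 : |cos a - cos b| ≤ |a - b| := by
    rw [cos_sub_cos, abs_mul, abs_mul, abs_neg, abs_two]
    have e1 := abs_sin_le_one ((a + b) / 2)
    have e2 : |sin ((a - b) / 2)| ≤ |(a - b) / 2| := abs_sin_le_abs
    rw [abs_div, abs_two] at e2
    nlinarith [abs_nonneg (sin ((a + b) / 2)), abs_nonneg (sin ((a - b) / 2))]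
  have h2 : |cos a - cos b| ≤ 2 := by
    refine (abs_sub _ _).trans ?_
    linarith [abs_cos_le_one a, abs_cos_le_one b]
  have h3 := (abs_nonneg _).trans h
  rcases min_cases 1 c with ⟨e, _⟩ | ⟨e, _⟩ <;> rw [e] <;> linarith

lemma tendsto_cos_slow_replace (hyp : PotentialHyp d m V ψ) (hC : 0 ≤ C) (hT : 0 ≤ T)
    (hγ1 : ∀ n, 1 ≤ γ n) (hγ : Tendsto γ atTop atTop)
    (hρ : ∀ n, GoodCurve d m (γ n) T V ψ C (ρ n)) (c θ : ℝ) (k : (Fin d → ℝ) →L[ℝ] ℝ)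
    (l : Fin d → ℝ) :
    Tendsto (fun n => (∫ t in (0 : ℝ)..T,
        ∫ x, cos (c * t + (k x.1 + dotP l x + θ)) ∂(ρ n t : Measure (Phase d))) -
      ∫ t in (0 : ℝ)..T,
        ∫ x, cos (c * t + (k (xiGamma (γ n) x) + dotP l x + θ)) ∂(ρ n t : Measure (Phase d)))
      atTop (𝓝 0) := by
  rw [Metric.tendsto_nhds]
  intro ε hε
  obtain ⟨δ, hδ, h⟩ := exists_momentum_le hyp hC hT (ε := ε / 4) (by positivity)
  have hev : ∀ᶠ n in atTop, ‖k‖ / δ ≤ γ n := hγ.eventually_ge_atTop _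
  filter_upwards [hev] with n hn
  have hγ0 : 0 < γ n := by linarith [hγ1 n]
  have hkδ : ‖k‖ * (γ n)⁻¹ ≤ δ := by
    rw [← div_eq_mul_inv, div_le_iff₀ hγ0]
    rw [div_le_iff₀ hδ] at hn
    linarith
  have hxi := continuous_xiGamma (d := d) (γ n)
  have huI : uIcc 0 T = Icc 0 T := uIcc_of_le hT
  have j1 : IntervalIntegrable (fun t => ∫ x, cos (c * t + (k x.1 + dotP l x + θ))
      ∂(ρ n t : Measure (Phase d))) volume 0 T :=
    ContinuousOn.intervalIntegrable (by
      rw [huI]; exact continuousOn_integral_cos (hρ n).cont (by fun_prop) c)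
  have j2 : IntervalIntegrable (fun t => ∫ x, cos (c * t + (k (xiGamma (γ n) x) + dotP l x + θ))
      ∂(ρ n t : Measure (Phase d))) volume 0 T :=
    ContinuousOn.intervalIntegrable (by
      rw [huI]; exact continuousOn_integral_cos (hρ n).cont (by fun_prop) c)
  have hmc : Continuous fun x : Phase d => min 1 (δ * ‖x.2‖) := by fun_prop
  have hmb : ∀ x : Phase d, |min 1 (δ * ‖x.2‖)| ≤ 1 := fun x => by
    rw [abs_of_nonneg (le_min zero_le_one (by positivity))]
    exact min_le_left _ _
  have j3 : IntervalIntegrable (fun t => 2 * ∫ x, min 1 (δ * ‖x.2‖)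
      ∂(ρ n t : Measure (Phase d))) volume 0 T :=
    (ContinuousOn.intervalIntegrable (by
      rw [huI]
      exact (continuous_integral_probabilityMeasure hmc hmb).comp_continuousOn
        (hρ n).cont)).const_mul 2
  have hmain := h (γ n) (hγ1 n) (ρ n) (hρ n)
  rw [dist_zero_right, ← intervalIntegral.integral_sub j1 j2]
  refine lt_of_le_of_lt (intervalIntegral.norm_integral_le_of_norm_le (μ := volume) hT
    (Filter.Eventually.of_forall fun t _ => ?_) j3) ?_
  · have i1 : Integrable (fun x => cos (c * t + (k x.1 + dotP l x + θ)))
        (ρ n t : Measure (Phase d)) :=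
      integrable_of_continuous_of_bdd (by fun_prop) (fun x => abs_cos_le_one _) _
    have i2 : Integrable (fun x => cos (c * t + (k (xiGamma (γ n) x) + dotP l x + θ)))
        (ρ n t : Measure (Phase d)) :=
      integrable_of_continuous_of_bdd (by fun_prop) (fun x => abs_cos_le_one _) _
    have i3 : Integrable (fun x : Phase d => 2 * min 1 (δ * ‖x.2‖)) (ρ n t : Measure (Phase d)) :=
      (integrable_of_continuous_of_bdd hmc hmb _).const_mul 2
    rw [← integral_sub i1 i2, ← integral_const_mul]
    refine norm_integral_le_of_norm_le i3 (Filter.Eventually.of_forall fun x => ?_)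
    rw [Real.norm_eq_abs]
    refine abs_cos_sub_cos_le_min ?_
    have e : c * t + (k x.1 + dotP l x + θ) - (c * t + (k (xiGamma (γ n) x) + dotP l x + θ)) =
        -((γ n)⁻¹ * k x.2) := by
      rw [xiGamma_eq, map_add, map_smul, smul_eq_mul]
      ring
    rw [e, abs_neg, abs_mul, abs_of_pos (inv_pos.2 hγ0)]
    calc (γ n)⁻¹ * |k x.2| ≤ (γ n)⁻¹ * (‖k‖ * ‖x.2‖) :=
          mul_le_mul_of_nonneg_left (k.le_opNorm x.2) (inv_pos.2 hγ0).le
      _ = ‖k‖ * (γ n)⁻¹ * ‖x.2‖ := by ring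
      _ ≤ δ * ‖x.2‖ := mul_le_mul_of_nonneg_right hkδ (norm_nonneg _)
  · rw [intervalIntegral.integral_const_mul]
    linarith

lemma cos_add_four_terms (α β y e θ : ℝ) :
    cos (α + (β + y + θ)) - e * cos (α + (β + θ)) =
      cos α * (cos β * (cos (y + θ) - e * cos θ)) -
      cos (α + -(π / 2)) * (cos (β + -(π / 2)) * (cos (y + θ) - e * cos θ)) -
      cos (α + -(π / 2)) * (cos β * (cos (y + (θ - π / 2)) - e * cos (θ - π / 2))) -
      cos α * (cos (β + -(π / 2)) * (cos (y + (θ - π / 2)) - e * cos (θ - π / 2))) := by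
  have h : ∀ u : ℝ, cos (u + -(π / 2)) = sin u := fun u => by
    rw [← sub_eq_add_neg, cos_sub_pi_div_two]
  have h' : y + (θ - π / 2) = y + θ + -(π / 2) := by ring
  rw [h', h, h, h, cos_sub_pi_div_two,
    show α + (β + y + θ) = (α + β) + (y + θ) by ring,
    show α + (β + θ) = (α + β) + θ by ring, cos_add (α + β), cos_add (α + β) θ, cos_add α β,
    sin_add α β]
  ring

lemma tendsto_cos_gaussian (hyp : PotentialHyp d m V ψ) (hC : 0 ≤ C) (hT : 0 ≤ T)
    (hγ : Tendsto γ atTop atTop)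
    (hρ : ∀ n, GoodCurve d m (γ n) T V ψ C (ρ n)) (c θ : ℝ) (k : (Fin d → ℝ) →L[ℝ] ℝ)
    (l : Fin d → ℝ) :
    Tendsto (fun n => (∫ t in (0 : ℝ)..T,
        ∫ x, cos (c * t + (k (xiGamma (γ n) x) + dotP l x + θ)) ∂(ρ n t : Measure (Phase d))) -
      Real.exp (-(m * (∑ i, l i ^ 2) / 2)) * ∫ t in (0 : ℝ)..T,
        ∫ x, cos (c * t + (k (xiGamma (γ n) x) + θ)) ∂(ρ n t : Measure (Phase d)))
      atTop (𝓝 0) := by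
  obtain ⟨e, he⟩ : ∃ e, e = Real.exp (-(m * (∑ i, l i ^ 2) / 2)) := ⟨_, rfl⟩
  obtain ⟨w, hw⟩ : ∃ w : ℝ → ℝ → ℝ, w = fun θ' y => cos (y + θ') - e * cos θ' := ⟨_, rfl⟩
  have hwc : ∀ θ', Continuous (w θ') := fun θ' => by rw [hw]; fun_prop
  have hwb : ∀ θ' y, |w θ' y| ≤ 1 + |e| := fun θ' y => by
    rw [hw]
    refine (abs_sub _ _).trans ?_
    rw [abs_mul]
    nlinarith [abs_cos_le_one (y + θ'), abs_cos_le_one θ', abs_nonneg e]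
  have huI : uIcc 0 T = Icc 0 T := uIcc_of_le hT
  obtain ⟨A, hA⟩ : ∃ A : ℝ → ℝ → ℝ → ℕ → ℝ → ℝ, A = fun a b θ' n t =>
    cos (c * t + a) * meanFast (γ n) (ρ n) l (fun z => cos (k z.1 + b)) (w θ') t := ⟨_, rfl⟩
  have hAi : ∀ a b θ' n, IntervalIntegrable (A a b θ' n) volume 0 T := fun a b θ' n => by
    refine ContinuousOn.intervalIntegrable ?_
    rw [huI, hA]
    exact (by fun_prop : ContinuousOn (fun t : ℝ => cos (c * t + a)) (Icc 0 T)).mul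
      (continuousOn_meanFast (by fun_prop) (hwc θ') (fun z => abs_cos_le_one _) (hwb θ')
        (hρ n).cont)
  have hAt : ∀ a b θ', Tendsto (fun n => ∫ t in (0 : ℝ)..T, A a b θ' n t) atTop (𝓝 0) := by
    intro a b θ'
    rw [Metric.tendsto_nhds]
    intro ε hε
    obtain ⟨Γ, -, h⟩ := exists_gaussian_averaging hyp hC hT
      (g := fun q => cos (k q + b)) (isCb2_cos_clm k b).1 (fun q => abs_cos_le_one _)
      (isCb2_cos c a) l θ' (half_pos hε)
    filter_upwards [hγ.eventually_ge_atTop Γ] with n hn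
    rw [dist_zero_right, Real.norm_eq_abs]
    have := h (γ n) hn (ρ n) (hρ n)
    rw [hA, hw, he]
    exact this.trans_lt (half_lt_self hε)
  have hlim := (((hAt 0 0 θ).sub (hAt (-(π / 2)) (-(π / 2)) θ)).sub
    (hAt (-(π / 2)) 0 (θ - π / 2))).sub (hAt 0 (-(π / 2)) (θ - π / 2))
  simp only [sub_zero] at hlim
  refine hlim.congr fun n => ?_
  have hxi := continuous_xiGamma (d := d) (γ n)
  have j1 : IntervalIntegrable (fun t => ∫ x, cos (c * t + (k (xiGamma (γ n) x) + dotP l x + θ))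
      ∂(ρ n t : Measure (Phase d))) volume 0 T :=
    ContinuousOn.intervalIntegrable (by
      rw [huI]; exact continuousOn_integral_cos (hρ n).cont (by fun_prop) c)
  have j2 : IntervalIntegrable (fun t => e * ∫ x, cos (c * t + (k (xiGamma (γ n) x) + θ))
      ∂(ρ n t : Measure (Phase d))) volume 0 T :=
    (ContinuousOn.intervalIntegrable (by
      rw [huI]; exact continuousOn_integral_cos (hρ n).cont (by fun_prop) c)).const_mul e
  rw [← he, ← intervalIntegral.integral_const_mul, ← intervalIntegral.integral_sub j1 j2,
    ← intervalIntegral.integral_sub (hAi _ _ _ n) (hAi _ _ _ n),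
    ← intervalIntegral.integral_sub ((hAi _ _ _ n).sub (hAi _ _ _ n)) (hAi _ _ _ n),
    ← intervalIntegral.integral_sub (((hAi _ _ _ n).sub (hAi _ _ _ n)).sub (hAi _ _ _ n))
      (hAi _ _ _ n)]
  refine intervalIntegral.integral_congr fun t _ => ?_
  have i1 : Integrable (fun x => cos (c * t + (k (xiGamma (γ n) x) + dotP l x + θ)))
      (ρ n t : Measure (Phase d)) :=
    integrable_of_continuous_of_bdd (by fun_prop) (fun x => abs_cos_le_one _) _
  have i2 : Integrable (fun x => e * cos (c * t + (k (xiGamma (γ n) x) + θ)))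
      (ρ n t : Measure (Phase d)) :=
    (integrable_of_continuous_of_bdd (h := fun x => cos (c * t + (k (xiGamma (γ n) x) + θ)))
      (by fun_prop) (fun x => abs_cos_le_one _) _).const_mul e
  have i3 : ∀ a b θ', Integrable (fun x => cos (c * t + a) *
      (cos (k (xiGamma (γ n) x) + b) * w θ' (dotP l x))) (ρ n t : Measure (Phase d)) :=
    fun a b θ' => (integrable_of_continuous_of_bdd
      (h := fun x => cos (k (xiGamma (γ n) x) + b) * w θ' (dotP l x)) (B := 1 * (1 + |e|))
      (by have := hwc θ'; fun_prop) (fun x => by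
        rw [abs_mul]
        exact mul_le_mul (abs_cos_le_one _) (hwb _ _) (abs_nonneg _) zero_le_one) _).const_mul _
  have hAeq : ∀ a b θ', A a b θ' n t = ∫ x, cos (c * t + a) *
      (cos (k (xiGamma (γ n) x) + b) * w θ' (dotP l x)) ∂(ρ n t : Measure (Phase d)) := by
    intro a b θ'
    rw [integral_const_mul, hA]
    simp only [meanFast, Zmap_fst_eq_xiGamma]
  simp only [hAeq]
  rw [← integral_const_mul, ← integral_sub i1 i2,
    ← integral_sub_sub_sub (i3 _ _ _) (i3 _ _ _) (i3 _ _ _) (i3 _ _ _)]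
  refine integral_congr_ae (Filter.Eventually.of_forall fun x => ?_)
  simp only [hw, add_zero]
  exact (cos_add_four_terms _ _ _ _ _).symm

lemma tendsto_cos_slowLaw (hT : 0 ≤ T) (hρ : ∀ n, ContinuousOn (ρ n) (Icc 0 T))
    {τ : ℝ → ProbabilityMeasure (Fin d → ℝ)}
    (hτ : ∀ t ∈ Icc 0 T, Tendsto (fun n => slowLaw (γ n) (ρ n t)) atTop (𝓝 (τ t)))
    (c θ : ℝ) (k : (Fin d → ℝ) →L[ℝ] ℝ) :
    Tendsto (fun n => ∫ t in (0 : ℝ)..T,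
        ∫ x, cos (c * t + (k (xiGamma (γ n) x) + θ)) ∂(ρ n t : Measure (Phase d))) atTop
      (𝓝 (∫ t in (0 : ℝ)..T, ∫ q, cos (c * t + (k q + θ)) ∂(τ t : Measure (Fin d → ℝ)))) := by
  have huI : uIoc 0 T ⊆ Icc 0 T := by
    rw [uIoc_of_le hT]
    exact Ioc_subset_Icc_self
  refine intervalIntegral.tendsto_integral_filter_of_dominated_convergence (fun _ => 1)
    (Filter.Eventually.of_forall fun n => ?_)
    (Filter.Eventually.of_forall fun n => Filter.Eventually.of_forall fun t _ =>
      abs_integral_le_of_bdd (fun x => abs_cos_le_one _) _)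
    intervalIntegrable_const (Filter.Eventually.of_forall fun t ht => ?_)
  · have hxi := continuous_xiGamma (d := d) (γ n)
    have h1 : Continuous fun x => k (xiGamma (γ n) x) + θ := by fun_prop
    exact ((continuousOn_integral_cos (hρ n) h1 c).mono huI).aestronglyMeasurable
      measurableSet_uIoc
  · have h1 : Continuous fun q : Fin d → ℝ => cos (c * t + (k q + θ)) := by fun_prop
    have := tendsto_integral_of_continuous_of_bdd (hτ t (huI ht)) h1 (fun q => abs_cos_le_one _)
    simpa only [integral_slowLaw _ _ h1] using this

end Limit

section Conclusion

variable {d : ℕ} {m T C : ℝ} {V ψ : (Fin d → ℝ) → ℝ}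
  {γ : ℕ → ℝ} {ρ : ℕ → ℝ → ProbabilityMeasure (Phase d)}

lemma clm_spaceTime_apply (L : ℝ × Phase d →L[ℝ] ℝ) (t : ℝ) (x : Phase d) :
    L (t, x) = L (1, 0) * t +
      ((L.comp ((ContinuousLinearMap.inr ℝ ℝ (Phase d)).comp
        (ContinuousLinearMap.inl ℝ (Fin d → ℝ) (Fin d → ℝ)))) x.1 +
      dotP (fun i => L (0, dirP i)) x) := by
  have hp : (x.2 : Fin d → ℝ) = ∑ i, x.2 i • Pi.single i (1 : ℝ) := by
    ext j
    simp [Finset.sum_apply, Pi.single_apply]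
  have h1 : (t, x) = t • ((1 : ℝ), (0 : Phase d)) + ((0 : ℝ), (x.1, (0 : Fin d → ℝ))) +
      ∑ i, x.2 i • ((0 : ℝ), (dirP i : Phase d)) := by
    refine Prod.ext ?_ (Prod.ext ?_ ?_)
    · simp [Prod.fst_sum]
    · simp [Prod.fst_sum, Prod.snd_sum, dirP]
    · simp only [Prod.snd_add, Prod.smul_snd, smul_zero, zero_add, Prod.snd_sum,
        dirP]
      exact hp
  rw [h1, map_add, map_add, map_smul, map_sum, dotP_apply]
  simp only [map_smul, smul_eq_mul, ContinuousLinearMap.comp_apply,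
    ContinuousLinearMap.inr_apply, ContinuousLinearMap.inl_apply, mul_comm, add_assoc]

/-- The curve of local equilibria with the given spatial marginals. -/
def localEquilibrium (d : ℕ) (hm : 0 < m) (τ : ℝ → ProbabilityMeasure (Fin d → ℝ)) (t : ℝ) :
    ProbabilityMeasure (Phase d) :=
  (τ t).prod ⟨maxwell d m, isProbabilityMeasure_maxwell hm⟩

lemma toMeasure_localEquilibrium (hm : 0 < m) (τ : ℝ → ProbabilityMeasure (Fin d → ℝ)) (t : ℝ) :
    (localEquilibrium d hm τ t : Measure (Phase d)) =
      (τ t : Measure (Fin d → ℝ)).prod (maxwell d m) :=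
  ProbabilityMeasure.toMeasure_prod _ _

lemma continuousOn_localEquilibrium (hm : 0 < m) {τ : ℝ → ProbabilityMeasure (Fin d → ℝ)}
    {S : Set ℝ} (hτ : ContinuousOn τ S) : ContinuousOn (localEquilibrium d hm τ) S :=
  ProbabilityMeasure.continuous_prod.comp_continuousOn (hτ.prodMk continuousOn_const)

lemma integral_localEquilibrium_cos (hm : 0 < m) (τ : ℝ → ProbabilityMeasure (Fin d → ℝ)) (t : ℝ)
    {h : (Fin d → ℝ) → ℝ} (hh : Continuous h) (l : Fin d → ℝ) :
    ∫ x, cos (h x.1 + dotP l x) ∂(localEquilibrium d hm τ t : Measure (Phase d)) =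
      Real.exp (-(m * (∑ i, l i ^ 2) / 2)) * ∫ q, cos (h q) ∂(τ t : Measure (Fin d → ℝ)) := by
  have := isProbabilityMeasure_maxwell (d := d) hm
  have hi : Integrable (fun x : Phase d => cos (h x.1 + dotP l x))
      ((τ t : Measure (Fin d → ℝ)).prod (maxwell d m)) :=
    integrable_of_continuous_of_bdd (by fun_prop) (fun x => abs_cos_le_one _) _
  rw [toMeasure_localEquilibrium, integral_prod _ hi, ← integral_const_mul]
  refine integral_congr_ae (Filter.Eventually.of_forall fun q => ?_)
  simp only [dotP_apply]
  rw [← integral_maxwell_cos hm l (h q)]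
  simp only [add_comm]

theorem tendsto_integral_localEquilibrium (hyp : PotentialHyp d m V ψ) (hC : 0 ≤ C) (hT : 0 < T)
    (hγ1 : ∀ n, 1 ≤ γ n) (hγ : Tendsto γ atTop atTop)
    (hρ : ∀ n, GoodCurve d m (γ n) T V ψ C (ρ n))
    {τ : ℝ → ProbabilityMeasure (Fin d → ℝ)} (hτc : ContinuousOn τ (Icc 0 T))
    (hτ : ∀ t ∈ Icc 0 T, Tendsto (fun n => slowLaw (γ n) (ρ n t)) atTop (𝓝 (τ t)))
    {F : ℝ × Phase d → ℝ} (hF : Continuous F) {B : ℝ} (hB : ∀ z, |F z| ≤ B) :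
    Tendsto (fun n => ∫ t in Icc 0 T, ∫ x, F (t, x) ∂(ρ n t : Measure (Phase d))) atTop
      (𝓝 (∫ t in Icc 0 T,
        ∫ x, F (t, x) ∂(localEquilibrium d hyp.hm τ t : Measure (Phase d)))) := by
  choose M hM using fun n => exists_spaceTime hT (hρ n).cont
  obtain ⟨M0, hM0⟩ := exists_spaceTime hT (continuousOn_localEquilibrium hyp.hm hτc)
  have key : Tendsto M atTop (𝓝 M0) := by
    refine tendsto_of_tendsto_integral_cos fun L θ => ?_
    have hc : Continuous fun z => cos (L z + θ) := by fun_prop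
    simp only [hM _ _ 1 hc (fun z => abs_cos_le_one _), hM0 _ 1 hc (fun z => abs_cos_le_one _)]
    refine Tendsto.const_mul _ ?_
    obtain ⟨c, hc⟩ : ∃ c, c = L (1, 0) := ⟨_, rfl⟩
    obtain ⟨k, hk⟩ : ∃ k, k = L.comp ((ContinuousLinearMap.inr ℝ ℝ (Phase d)).comp
        (ContinuousLinearMap.inl ℝ (Fin d → ℝ) (Fin d → ℝ))) := ⟨_, rfl⟩
    obtain ⟨l, hl⟩ : ∃ l : Fin d → ℝ, l = fun i => L (0, dirP i) := ⟨_, rfl⟩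
    have hL : ∀ t x, L (t, x) + θ = c * t + (k x.1 + dotP l x + θ) := fun t x => by
      rw [clm_spaceTime_apply L t x, ← hc, ← hk, ← hl]
      ring
    have hr : ∀ t, ∫ x, cos (L (t, x) + θ)
        ∂(localEquilibrium d hyp.hm τ t : Measure (Phase d)) =
        Real.exp (-(m * (∑ i, l i ^ 2) / 2)) *
          ∫ q, cos (c * t + (k q + θ)) ∂(τ t : Measure (Fin d → ℝ)) := fun t => by
      rw [← integral_localEquilibrium_cos hyp.hm τ t (h := fun q => c * t + (k q + θ))
        (by fun_prop) l]
      refine integral_congr_ae (Filter.Eventually.of_forall fun x => ?_)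
      simp only [hL]
      congr 1
      ring
    simp only [hr]
    simp only [hL, integral_Icc_eq_integral_Ioc, ← intervalIntegral.integral_of_le hT.le]
    rw [intervalIntegral.integral_const_mul]
    have h1 := tendsto_cos_slow_replace hyp hC hT.le hγ1 hγ hρ c θ k l
    have h2 := tendsto_cos_gaussian hyp hC hT.le hγ hρ c θ k l
    have h3 := (tendsto_cos_slowLaw hT.le (fun n => (hρ n).cont) hτ c θ k).const_mul
      (Real.exp (-(m * (∑ i, l i ^ 2) / 2)))
    have h4 := (h1.add h2).add h3
    simp only [zero_add] at h4
    refine h4.congr fun n => ?_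
    ring
  have h := (tendsto_integral_of_continuous_of_bdd key hF hB).const_mul T
  simp only [hM _ _ B hF hB, hM0 _ B hF hB, mul_inv_cancel_left₀ hT.ne'] at h
  exact h

end Conclusion

/-- Theorem 2.4, compactness: given `γ_n → ∞` and curves `ρ^{γ_n}`
with `I^{γ_n}(ρ^{γ_n}) + F(ρ^{γ_n}_0) ≤ C`, along a subsequence:
(1) `ρ^{γ_n} → ρ` narrowly in `M([0,T]×ℝ^{2d})` (tested against bounded continuous
functions of `(t,x)`, integrated in time over `[0,T]`);
(2) `ξ^{γ_n}_#ρ^{γ_n} → ξ_#ρ` in `C([0,T];P(ℝ^d))`, uniformly in time and narrowly in space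
(and the limit curve `ξ_#ρ` is narrowly continuous);
(3) for a.e. `t ∈ [0,T]`, `I(ρ_t|μ) = 0`. -/
theorem stmt3 {d : ℕ} {m : ℝ} (V ψ : (Fin d → ℝ) → ℝ)
    (hyp : PotentialHyp d m V ψ)
    (T : ℝ) (hT : 0 < T)
    (γs : ℕ → ℝ) (hγpos : ∀ n, 0 < γs n) (hγ : Tendsto γs atTop atTop)
    (ρseq : ℕ → ℝ → ProbabilityMeasure (Phase d))
    (hρcont : ∀ n, ContinuousOn (ρseq n) (Icc 0 T))
    (C : ℝ≥0∞) (hC : C ≠ ⊤)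
    (hbound : ∀ n, RateI m (γs n) T V ψ (ρseq n)
      + FreeEnergy m V ψ (ρseq n 0 : Measure (Phase d)) ≤ C) :
    ∃ s : ℕ → ℕ, StrictMono s ∧
    ∃ ρ : ℝ → ProbabilityMeasure (Phase d),
      (∀ F : BoundedContinuousFunction (ℝ × Phase d) ℝ,
        Tendsto
          (fun n => ∫ t in Icc (0 : ℝ) T,
            (∫ x, F (t, x) ∂(ρseq (s n) t : Measure (Phase d))))
          atTop
          (𝓝 (∫ t in Icc (0 : ℝ) T, (∫ x, F (t, x) ∂(ρ t : Measure (Phase d)))))) ∧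
      (ContinuousOn
        (fun t => (ρ t).map (f := fun x : Phase d => x.1) measurable_fst.aemeasurable)
        (Icc 0 T)) ∧
      (∀ g : BoundedContinuousFunction (Fin d → ℝ) ℝ,
        TendstoUniformlyOn
          (fun n t => ∫ x, g (xiGamma (γs (s n)) x) ∂(ρseq (s n) t : Measure (Phase d)))
          (fun t => ∫ x, g x.1 ∂(ρ t : Measure (Phase d)))
          atTop (Icc 0 T)) ∧
      (∀ᵐ t ∂(volume.restrict (Icc (0 : ℝ) T)),
        relFisher m (ρ t : Measure (Phase d)) = 0) := by
  have hgood : ∀ n, GoodCurve d m (γs n) T V ψ C.toReal (ρseq n) := fun n =>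
    ⟨hρcont n, by
      rw [ENNReal.ofReal_toReal hC]
      exact le_self_add.trans (hbound n), by
      rw [ENNReal.ofReal_toReal hC]
      exact le_self_add.trans (le_add_self.trans (hbound n))⟩
  obtain ⟨N, hN⟩ := eventually_atTop.1 (hγ.eventually_ge_atTop 1)
  obtain ⟨s, hs, τ, hτc, hτ⟩ := exists_subseq_slowLaw hyp ENNReal.toReal_nonneg hT.le
    (γ := fun n => γs (n + N)) (fun n => hN _ (Nat.le_add_left _ _))
    (fun n => hgood (n + N))
  have hs' : StrictMono fun n => s n + N := fun a b h => Nat.add_lt_add_right (hs h) N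
  have hfst : ∀ t, (localEquilibrium d hyp.hm τ t).map (f := fun x : Phase d => x.1)
      measurable_fst.aemeasurable = τ t := fun t => by
    rw [localEquilibrium]
    exact ProbabilityMeasure.map_fst_prod _ _
  refine ⟨fun n => s n + N, hs', localEquilibrium d hyp.hm τ, fun F => ?_, ?_, fun g => ?_,
    Filter.Eventually.of_forall fun t => ?_⟩
  · refine tendsto_integral_localEquilibrium hyp ENNReal.toReal_nonneg hT
      (γ := fun n => γs (s n + N)) (fun n => hN _ (Nat.le_add_left _ _))
      (hγ.comp hs'.tendsto_atTop) (fun n => hgood _) hτc (fun t ht => ?_) F.continuous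
      (B := ‖F‖) F.norm_coe_le_norm
    exact (hτ t ht).comp (tendsto_id.prodMk
      (tendsto_const_pure.mono_right (pure_le_nhdsWithin ht)))
  · simpa only [hfst] using hτc
  · have hgb : ∀ q, |g q| ≤ ‖g‖ := g.norm_coe_le_norm
    have hlim : ∀ t, ∫ x, g x.1 ∂(localEquilibrium d hyp.hm τ t : Measure (Phase d)) =
        ∫ q, g q ∂(τ t : Measure (Fin d → ℝ)) := fun t => by
      rw [← hfst t, ProbabilityMeasure.toMeasure_map, integral_map measurable_fst.aemeasurable
        g.continuous.aestronglyMeasurable]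
    simp only [hlim]
    refine tendstoUniformlyOn_of_tendsto_prod isCompact_Icc
      ((continuous_integral_probabilityMeasure g.continuous hgb).comp_continuousOn hτc)
      fun t ht => ?_
    have := tendsto_integral_of_continuous_of_bdd (hτ t ht) g.continuous hgb
    simpa only [integral_slowLaw _ _ g.continuous] using this
  · rw [toMeasure_localEquilibrium]
    exact relFisher_prod_maxwell hyp.hm _


end
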